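/- arXiv:2410.04760 — 2 statements merged into one kernel-verified Lean document; each statement's English description precedes it below -/
import Mathlib

section
/- Assume q_0 is supported in the Euclidean ball {y ∈ ℝ^d : ‖y‖₂ ≤ √d}, and assume the step-size condition in the context. Fix 0 ≤ k ≤ K−1 and t ∈ [t_k, t_{k+1}], and let (Y_t, Y_{t_k}) be jointly distributed so that Y_t ~ q_{T−t} and Y_{t_k} = e^{−(t−t_k)} Y_t + (1 − e^{−2(t−t_k)})^{1/2} g with g ~ N(0, I_d) independent of Y_t. Then there is a universal constant C > 0 such that E[ ‖∇_x² log q_{T−t}(Y_t) − ∇_x² log q_{T−t_k}(Y_{t_k})‖_F² ] ≤ C d³ σ_{T−t_{k+1}}^{−6} Δ_k. -/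
open MeasureTheory ProbabilityTheory Real

noncomputable section

abbrev Vec (d : ℕ) := EuclideanSpace ℝ (Fin d)

def stdGaussian (d : ℕ) : Measure (Vec d) :=
  Measure.map (⇑(EuclideanSpace.equiv (Fin d) ℝ).symm)
    (Measure.pi fun _ : Fin d => gaussianReal 0 1)

/-- The law `q_u` of `e^{-u} θ + √(1 - e^{-2u}) g`, with `θ ~ q0` and `g ~ N(0, I_d)`
independent. -/
def forwardLaw {d : ℕ} (q0 : Measure (Vec d)) (u : ℝ) : Measure (Vec d) :=
  Measure.map (fun p : Vec d × Vec d =>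
      Real.exp (-u) • p.1 + Real.sqrt (1 - Real.exp (-2*u)) • p.2)
    (q0.prod (stdGaussian d))

/-- Gaussian weight `exp(-‖x - λ_t θ‖² / (2σ_t²))`. -/
def weight {d : ℕ} (t : ℝ) (x θ : Vec d) : ℝ :=
  Real.exp (-‖x - Real.exp (-t) • θ‖^2 / (2 * (1 - Real.exp (-2*t))))

/-- The conditional law `μ_{t,x}` of `θ` given `λ_t θ + σ_t g = x`:
`dμ_{t,x}(θ) = Z_{t,x}⁻¹ exp(-‖x - λ_t θ‖²/(2σ_t²)) dq0(θ)`. -/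
def condMeasure {d : ℕ} (q0 : Measure (Vec d)) (t : ℝ) (x : Vec d) : Measure (Vec d) :=
  (∫⁻ θ, ENNReal.ofReal (weight t x θ) ∂q0)⁻¹ •
    q0.withDensity fun θ => ENNReal.ofReal (weight t x θ)

/-- The conditional mean `m(t, x) = E_{t,x}[θ]`. -/
def condMean {d : ℕ} (q0 : Measure (Vec d)) (t : ℝ) (x : Vec d) : Vec d :=
  ∫ θ, θ ∂(condMeasure q0 t x)

/-- Partial derivative in the `i`-th coordinate direction. -/
def pd {d : ℕ} (i : Fin d) (f : Vec d → ℝ) (x : Vec d) : ℝ :=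
  fderiv ℝ f x (EuclideanSpace.single i 1)

open scoped RealInnerProductSpace

lemma stdGaussian_eq (d : ℕ) :
    _root_.stdGaussian d = ProbabilityTheory.stdGaussian (Vec d) := by
  rw [← map_pi_eq_stdGaussian]
  rfl

instance isProbabilityMeasure_stdGaussian_vec (d : ℕ) :
    IsProbabilityMeasure (_root_.stdGaussian d) := by
  rw [stdGaussian_eq]; infer_instance

instance isGaussian_stdGaussian_vec (d : ℕ) : IsGaussian (_root_.stdGaussian d) := by
  rw [stdGaussian_eq]; infer_instance

lemma charFun_stdGaussian_smul {d : ℕ} (r : ℝ) (s : Vec d) :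
    charFun ((_root_.stdGaussian d).map (r • ·)) s = Complex.exp (-(r ^ 2 * ‖s‖ ^ 2) / 2) := by
  rw [charFun_map_smul, stdGaussian_eq, charFun_stdGaussian, norm_smul]
  simp [mul_pow, ← Complex.ofReal_pow]

/-- Gaussian density on `Vec d` with covariance `τ I`. -/
def gaussDensity (d : ℕ) (τ : ℝ) (x : Vec d) : ℝ :=
  ((π / (2 * τ)⁻¹) ^ ((d : ℝ) / 2))⁻¹ * Real.exp (-(2 * τ)⁻¹ * ‖x‖ ^ 2)

lemma gaussDensity_pos {d : ℕ} {τ : ℝ} (hτ : 0 < τ) (x : Vec d) : 0 < gaussDensity d τ x := by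
  unfold gaussDensity; positivity

lemma measurable_gaussDensity {d : ℕ} {τ : ℝ} : Measurable (gaussDensity d τ) := by
  unfold gaussDensity; fun_prop

lemma integral_gaussDensity {d : ℕ} {τ : ℝ} (hτ : 0 < τ) : ∫ x, gaussDensity d τ x = 1 := by
  unfold gaussDensity
  rw [integral_const_mul, GaussianFourier.integral_rexp_neg_mul_sq_norm (by positivity)]
  simp only [finrank_euclideanSpace, Fintype.card_fin]
  exact inv_mul_cancel₀ (by positivity)

lemma integrable_gaussDensity {d : ℕ} {τ : ℝ} (hτ : 0 < τ) :
    Integrable (gaussDensity d τ) := by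
  by_contra h
  have := integral_gaussDensity (d := d) hτ
  rw [integral_undef h] at this
  norm_num at this

lemma isFiniteMeasure_gaussDensity {d : ℕ} {τ : ℝ} (hτ : 0 < τ) :
    IsFiniteMeasure ((volume : Measure (Vec d)).withDensity
      fun x => ENNReal.ofReal (gaussDensity d τ x)) := by
  exact isFiniteMeasure_withDensity_ofReal (integrable_gaussDensity hτ).2

lemma map_smul_stdGaussian {d : ℕ} {τ : ℝ} (hτ : 0 < τ) :
    (_root_.stdGaussian d).map (√τ • ·)
      = volume.withDensity fun x => ENNReal.ofReal (gaussDensity d τ x) := by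
  have := isFiniteMeasure_gaussDensity (d := d) hτ
  have : IsProbabilityMeasure ((_root_.stdGaussian d).map (√τ • ·)) :=
    Measure.isProbabilityMeasure_map (by fun_prop)
  apply Measure.ext_of_charFun
  ext s
  rw [charFun_stdGaussian_smul, charFun_apply,
    integral_withDensity_eq_integral_toReal_smul measurable_gaussDensity.ennreal_ofReal
      (ae_of_all _ fun x => ENNReal.ofReal_lt_top)]
  have h := GaussianFourier.integral_cexp_neg_mul_sq_norm_add_of_euclideanSpace (ι := Fin d)
    (b := ((2 * τ)⁻¹ : ℝ)) (by rw [Complex.ofReal_re]; positivity) Complex.I s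
  have e : ∀ x : Vec d, (ENNReal.ofReal (gaussDensity d τ x)).toReal •
      Complex.exp (⟪x, s⟫ * Complex.I) =
      ((((π / (2 * τ)⁻¹) ^ ((d : ℝ) / 2))⁻¹ : ℝ) : ℂ) *
        Complex.exp (-((2 * τ)⁻¹ : ℝ) * ‖x‖ ^ 2 + Complex.I * ⟪s, x⟫) := by
    intro x
    rw [ENNReal.toReal_ofReal (gaussDensity_pos hτ x).le, gaussDensity, Complex.exp_add,
      real_inner_comm]
    simp only [Complex.real_smul, Complex.ofReal_mul, Complex.ofReal_exp]
    push_cast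
    ring_nf
  simp_rw [e]
  rw [integral_const_mul, h, ← mul_assoc]
  have e2 : ((((π / (2 * τ)⁻¹) ^ ((d : ℝ) / 2))⁻¹ : ℝ) : ℂ) *
      (π / ((2 * τ)⁻¹ : ℝ)) ^ ((Fintype.card (Fin d) : ℂ) / 2) = 1 := by
    rw [Fintype.card_fin, ← Complex.ofReal_div,
      show ((d : ℂ) / 2) = (((d : ℝ) / 2 : ℝ) : ℂ) by push_cast; rfl,
      ← Complex.ofReal_cpow (by positivity), ← Complex.ofReal_mul,
      inv_mul_cancel₀ (by positivity), Complex.ofReal_one]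
  rw [e2, one_mul]
  congr 1
  have : (τ : ℂ) ≠ 0 := by exact_mod_cast hτ.ne'
  have h2 : ((√τ : ℝ) : ℂ) ^ 2 = τ := by rw [← Complex.ofReal_pow, Real.sq_sqrt hτ.le]
  rw [h2]
  simp only [Complex.I_sq]
  push_cast
  field_simp
  ring

lemma lintegral_affine_stdGaussian {d : ℕ} {τ : ℝ} (hτ : 0 < τ) (θ : Vec d)
    {f : Vec d → ENNReal} (hf : Measurable f) :
    ∫⁻ z, f (θ + √τ • z) ∂(_root_.stdGaussian d)
      = ∫⁻ x, ENNReal.ofReal (gaussDensity d τ (x - θ)) * f x := by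
  have h1 : ∫⁻ z, f (θ + √τ • z) ∂(_root_.stdGaussian d)
      = ∫⁻ z, f (θ + z) ∂((_root_.stdGaussian d).map (√τ • ·)) := by
    rw [lintegral_map (by fun_prop) (by fun_prop)]
  rw [h1, map_smul_stdGaussian hτ, lintegral_withDensity_eq_lintegral_mul _
    measurable_gaussDensity.ennreal_ofReal (by fun_prop)]
  rw [← lintegral_add_left_eq_self (μ := volume)
    (fun x => ENNReal.ofReal (gaussDensity d τ (x - θ)) * f x) θ]
  simp

/-- The law of `θ + √τ z` with `θ ~ q0` and `z ~ N(0, I)` independent. -/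
def heatLaw {d : ℕ} (q0 : Measure (Vec d)) (τ : ℝ) : Measure (Vec d) :=
  (q0.prod (_root_.stdGaussian d)).map fun p => p.1 + √τ • p.2

instance isProbabilityMeasure_heatLaw {d : ℕ} (q0 : Measure (Vec d)) [IsProbabilityMeasure q0]
    (τ : ℝ) : IsProbabilityMeasure (heatLaw q0 τ) :=
  Measure.isProbabilityMeasure_map (by fun_prop)

lemma charFun_map_add_smul_stdGaussian {d : ℕ} (q0 : Measure (Vec d)) [IsProbabilityMeasure q0]
    {τ : ℝ} (hτ : 0 ≤ τ) (s : Vec d) :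
    charFun (heatLaw q0 τ) s = charFun q0 s * Complex.exp (-(τ * ‖s‖ ^ 2) / 2) := by
  have : heatLaw q0 τ = q0 ∗ ((_root_.stdGaussian d).map (√τ • ·)) := by
    rw [heatLaw, Measure.conv]
    conv_rhs => rw [← Measure.map_id (μ := q0)]
    rw [Measure.map_prod_map _ _ (by fun_prop) (by fun_prop), Measure.map_map (by fun_prop) (by fun_prop)]
    rfl
  have : IsProbabilityMeasure ((_root_.stdGaussian d).map (√τ • ·)) :=
    Measure.isProbabilityMeasure_map (by fun_prop)
  have h2 : ((√τ : ℝ) : ℂ) ^ 2 = τ := by rw [← Complex.ofReal_pow, Real.sq_sqrt hτ]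
  rw [‹heatLaw q0 τ = _›, charFun_conv, charFun_stdGaussian_smul, h2]

lemma heatLaw_heatLaw {d : ℕ} (q0 : Measure (Vec d)) [IsProbabilityMeasure q0]
    {τ ε : ℝ} (hτ : 0 ≤ τ) (hε : 0 ≤ ε) : heatLaw (heatLaw q0 τ) ε = heatLaw q0 (τ + ε) := by
  apply Measure.ext_of_charFun
  ext s
  rw [charFun_map_add_smul_stdGaussian _ hε, charFun_map_add_smul_stdGaussian _ hτ,
    charFun_map_add_smul_stdGaussian _ (add_nonneg hτ hε), mul_assoc, ← Complex.exp_add]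
  congr 2
  push_cast
  ring

lemma integrable_norm_pow_stdGaussian (d n : ℕ) :
    Integrable (fun z => ‖z‖ ^ n) (_root_.stdGaussian d) := by
  rcases Nat.eq_zero_or_pos n with rfl | hn
  · simp
  · have := IsGaussian.memLp_id (_root_.stdGaussian d) n (by simp)
    simpa using this.integrable_norm_pow (by omega)

/-- The `n`-th moment of the standard real Gaussian. -/
def gaussMoment (n : ℕ) : ℝ := ∫ x, x ^ n ∂(gaussianReal 0 1)

lemma map_inner_stdGaussian {d : ℕ} (w : Vec d) :
    (_root_.stdGaussian d).map (fun z => ⟪w, z⟫) = (gaussianReal 0 1).map (‖w‖ * ·) := by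
  have : IsProbabilityMeasure ((_root_.stdGaussian d).map (fun z => ⟪w, z⟫)) :=
    Measure.isProbabilityMeasure_map (by fun_prop)
  have : IsProbabilityMeasure ((gaussianReal 0 1).map (‖w‖ * ·)) :=
    Measure.isProbabilityMeasure_map (by fun_prop)
  apply Measure.ext_of_charFun
  ext s
  rw [charFun_map_mul, charFun_gaussianReal, charFun_apply_real,
    integral_map (by fun_prop) (by fun_prop)]
  have h := charFun_stdGaussian (E := Vec d) (s • w)
  rw [← stdGaussian_eq, charFun_apply] at h
  have e : ∀ z : Vec d, Complex.exp (s * (⟪w, z⟫ : ℝ) * Complex.I)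
      = Complex.exp ((⟪z, s • w⟫ : ℝ) * Complex.I) := by
    intro z
    rw [real_inner_smul_right, real_inner_comm]; push_cast; rfl
  simp_rw [e]
  rw [h, norm_smul]
  congr 1
  push_cast
  simp [mul_pow, ← Complex.ofReal_pow]
  ring

lemma integral_inner_pow_stdGaussian {d : ℕ} (w : Vec d) (n : ℕ) :
    ∫ z, ⟪w, z⟫ ^ n ∂(_root_.stdGaussian d) = ‖w‖ ^ n * gaussMoment n := by
  have h : ∫ z, ⟪w, z⟫ ^ n ∂(_root_.stdGaussian d)
      = ∫ y, y ^ n ∂((_root_.stdGaussian d).map (fun z => ⟪w, z⟫)) := by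
    rw [integral_map (by fun_prop) (by fun_prop)]
  rw [h, map_inner_stdGaussian, integral_map (by fun_prop) (by fun_prop), gaussMoment,
    ← integral_const_mul]
  simp_rw [mul_pow]

lemma integrable_inner_pow_stdGaussian {d : ℕ} (w : Vec d) (n : ℕ) :
    Integrable (fun z => ⟪w, z⟫ ^ n) (_root_.stdGaussian d) := by
  refine ((integrable_norm_pow_stdGaussian d n).const_mul (‖w‖ ^ n)).mono (by fun_prop) ?_
  refine ae_of_all _ fun z => ?_
  rw [norm_pow, ← mul_pow, Real.norm_eq_abs, Real.norm_of_nonneg (by positivity)]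
  exact pow_le_pow_left₀ (abs_nonneg _) (abs_real_inner_le_norm w z) n

lemma gaussMoment_nonneg {n : ℕ} (hn : Even n) : 0 ≤ gaussMoment n :=
  integral_nonneg fun _ => hn.pow_nonneg _

lemma integral_norm_pow_eight_stdGaussian_le (d : ℕ) :
    ∫ z, ‖z‖ ^ 8 ∂(_root_.stdGaussian d) ≤ gaussMoment 8 * (d : ℝ) ^ 4 := by
  have hpt : ∀ z : Vec d, ‖z‖ ^ 8 ≤ (d : ℝ) ^ 3 * ∑ i, ⟪EuclideanSpace.single i (1 : ℝ), z⟫ ^ 8 := by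
    intro z
    have h1 : ‖z‖ ^ 8 = (∑ i, (z i) ^ 2) ^ 4 := by
      rw [← EuclideanSpace.real_norm_sq_eq]; ring
    have h2 := pow_sum_le_card_mul_sum_pow (s := (Finset.univ : Finset (Fin d)))
      (f := fun i => (z i) ^ 2) (fun i _ => sq_nonneg _) 3
    rw [h1]
    refine h2.trans (le_of_eq ?_)
    simp [← pow_mul, EuclideanSpace.inner_single_left]
  calc ∫ z, ‖z‖ ^ 8 ∂(_root_.stdGaussian d)
      ≤ ∫ z, (d : ℝ) ^ 3 * ∑ i, ⟪EuclideanSpace.single i (1 : ℝ), z⟫ ^ 8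
          ∂(_root_.stdGaussian d) := by
        refine integral_mono (integrable_norm_pow_stdGaussian d 8) ?_ hpt
        exact (integrable_finsetSum _ fun i _ => integrable_inner_pow_stdGaussian _ 8).const_mul _
    _ = gaussMoment 8 * (d : ℝ) ^ 4 := by
        rw [integral_const_mul, integral_finsetSum _
          fun i _ => integrable_inner_pow_stdGaussian _ 8]
        simp_rw [integral_inner_pow_stdGaussian]
        simp
        ring

lemma integral_norm_pow_six_stdGaussian_le {d : ℕ} (hd : 1 ≤ d) :
    ∫ z, ‖z‖ ^ 6 ∂(_root_.stdGaussian d) ≤ (1 + gaussMoment 8) * (d : ℝ) ^ 3 := by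
  have hd' : (0 : ℝ) < d := by exact_mod_cast hd
  have hpt : ∀ z : Vec d, ‖z‖ ^ 6 ≤ (d : ℝ) ^ 3 + ‖z‖ ^ 8 / d := by
    intro z
    have hy : 0 ≤ ‖z‖ ^ 2 := by positivity
    have h6 : ‖z‖ ^ 6 = (‖z‖ ^ 2) ^ 3 := by ring
    have h8 : ‖z‖ ^ 8 = (‖z‖ ^ 2) ^ 4 := by ring
    rw [h6, h8]
    rcases le_total (‖z‖ ^ 2) d with h | h
    · have := pow_le_pow_left₀ hy h 3
      have : 0 ≤ (‖z‖ ^ 2) ^ 4 / d := by positivity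
      linarith
    · have : (‖z‖ ^ 2) ^ 3 ≤ (‖z‖ ^ 2) ^ 4 / d := by
        rw [le_div_iff₀ hd', pow_succ _ 3]
        exact mul_le_mul_of_nonneg_left h (by positivity)
      have : 0 ≤ (d : ℝ) ^ 3 := by positivity
      linarith
  calc ∫ z, ‖z‖ ^ 6 ∂(_root_.stdGaussian d)
      ≤ ∫ z, ((d : ℝ) ^ 3 + ‖z‖ ^ 8 / d) ∂(_root_.stdGaussian d) :=
        integral_mono (integrable_norm_pow_stdGaussian d 6)
          ((integrable_const _).add ((integrable_norm_pow_stdGaussian d 8).div_const _)) hpt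
    _ = (d : ℝ) ^ 3 + (∫ z, ‖z‖ ^ 8 ∂(_root_.stdGaussian d)) / d := by
        rw [integral_add (integrable_const _) ((integrable_norm_pow_stdGaussian d 8).div_const _),
          integral_div]
        simp
    _ ≤ (d : ℝ) ^ 3 + (gaussMoment 8 * (d : ℝ) ^ 4) / d := by
        gcongr; exact integral_norm_pow_eight_stdGaussian_le d
    _ = (1 + gaussMoment 8) * (d : ℝ) ^ 3 := by field_simp

/-- Log-likelihood of `θ` given `θ + √τ z = x`, up to a term not depending on `θ`. -/
def tiltExp {d : ℕ} (τ : ℝ) (x θ : Vec d) : ℝ := (⟪x, θ⟫ - ‖θ‖ ^ 2 / 2) / τ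

/-- Conditional law of `θ` given `θ + √τ z = x`. -/
def post {d : ℕ} (q0 : Measure (Vec d)) (τ : ℝ) (x : Vec d) : Measure (Vec d) :=
  q0.tilted (tiltExp τ x)

/-- Conditional expectation of `F θ` given `θ + √τ z = x`. -/
def pmean {d : ℕ} (q0 : Measure (Vec d)) (τ : ℝ) (F : Vec d → ℝ) (x : Vec d) : ℝ :=
  ∫ θ, F θ ∂(post q0 τ x)

/-- Measurable functions essentially bounded by `B`. -/
def BddObs {d : ℕ} (q0 : Measure (Vec d)) (F : Vec d → ℝ) (B : ℝ) : Prop :=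
  Measurable F ∧ ∀ᵐ θ ∂q0, |F θ| ≤ B

section

variable {d : ℕ} {q0 : Measure (Vec d)} {D τ : ℝ} {F G : Vec d → ℝ} {A B : ℝ}

lemma BddObs.mul (hF : BddObs q0 F A) (hG : BddObs q0 G B) :
    BddObs q0 (fun θ => F θ * G θ) (A * B) := by
  refine ⟨hF.1.mul hG.1, ?_⟩
  filter_upwards [hF.2, hG.2] with θ h1 h2
  rw [abs_mul]
  exact mul_le_mul h1 h2 (abs_nonneg _) ((abs_nonneg _).trans h1)

lemma bddObs_inner (hD : ∀ᵐ θ ∂q0, ‖θ‖ ≤ D) (v : Vec d) :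
    BddObs q0 (fun θ => ⟪θ, v⟫) (D * ‖v‖) := by
  refine ⟨by fun_prop, ?_⟩
  filter_upwards [hD] with θ h
  exact (abs_real_inner_le_norm θ v).trans (by gcongr)

lemma bddObs_coord (hD : ∀ᵐ θ ∂q0, ‖θ‖ ≤ D) (i : Fin d) :
    BddObs q0 (fun θ => θ i) D := by
  refine ⟨by fun_prop, ?_⟩
  filter_upwards [hD] with θ h
  exact (PiLp.norm_apply_le θ i).trans h

lemma measurable_tiltExp (x : Vec d) : Measurable (tiltExp τ x) := by
  unfold tiltExp; fun_prop

lemma tiltExp_le (hτ : 0 < τ) {x θ : Vec d} (hθ : ‖θ‖ ≤ D) : tiltExp τ x θ ≤ ‖x‖ * D / τ := by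
  unfold tiltExp
  gcongr
  have := real_inner_le_norm x θ
  have : ‖x‖ * ‖θ‖ ≤ ‖x‖ * D := by gcongr
  nlinarith [sq_nonneg ‖θ‖]

lemma bddObs_one : BddObs q0 (fun _ => (1 : ℝ)) 1 := ⟨by fun_prop, by simp⟩

lemma ae_post {p : Vec d → Prop} (h : ∀ᵐ θ ∂q0, p θ) (x : Vec d) : ∀ᵐ θ ∂(post q0 τ x), p θ :=
  (tilted_absolutelyContinuous q0 _).ae_le h

/-- Unnormalised conditional expectation. -/
def expMoment {d : ℕ} (q0 : Measure (Vec d)) (τ : ℝ) (F : Vec d → ℝ) (x : Vec d) : ℝ :=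
  ∫ θ, F θ * rexp (tiltExp τ x θ) ∂q0

lemma pmean_eq_div (x : Vec d) :
    pmean q0 τ F x = expMoment q0 τ F x / expMoment q0 τ (fun _ => 1) x := by
  unfold pmean post expMoment
  rw [integral_tilted, ← integral_div]
  congr 1
  ext θ
  simp only [smul_eq_mul, one_mul]
  ring

variable [IsProbabilityMeasure q0]

lemma nonneg_of_ae_norm_le (hD : ∀ᵐ θ ∂q0, ‖θ‖ ≤ D) : 0 ≤ D := by
  obtain ⟨θ, h⟩ := hD.exists
  exact (norm_nonneg _).trans h

lemma BddObs.nonneg (hF : BddObs q0 F B) : 0 ≤ B := by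
  obtain ⟨θ, h⟩ := hF.2.exists
  exact (abs_nonneg _).trans h

lemma integrable_mul_exp_tiltExp (hD : ∀ᵐ θ ∂q0, ‖θ‖ ≤ D) (hτ : 0 < τ) (hF : BddObs q0 F B)
    (x : Vec d) : Integrable (fun θ => F θ * rexp (tiltExp τ x θ)) q0 := by
  refine Integrable.of_bound (C := B * rexp (‖x‖ * D / τ)) ?_ ?_
  · exact (hF.1.mul (measurable_tiltExp x).exp).aestronglyMeasurable
  · filter_upwards [hD, hF.2] with θ h1 h2
    rw [norm_mul, Real.norm_of_nonneg (exp_pos _).le, Real.norm_eq_abs]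
    exact mul_le_mul h2 (exp_le_exp.2 (tiltExp_le hτ h1)) (exp_pos _).le ((abs_nonneg _).trans h2)

lemma integrable_exp_tiltExp (hD : ∀ᵐ θ ∂q0, ‖θ‖ ≤ D) (hτ : 0 < τ) (x : Vec d) :
    Integrable (fun θ => rexp (tiltExp τ x θ)) q0 := by
  simpa using integrable_mul_exp_tiltExp hD hτ bddObs_one x

lemma isProbabilityMeasure_post (hD : ∀ᵐ θ ∂q0, ‖θ‖ ≤ D) (hτ : 0 < τ) (x : Vec d) :
    IsProbabilityMeasure (post q0 τ x) :=
  isProbabilityMeasure_tilted (integrable_exp_tiltExp hD hτ x)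

lemma BddObs.integrable_post (hF : BddObs q0 F B) (hD : ∀ᵐ θ ∂q0, ‖θ‖ ≤ D) (hτ : 0 < τ)
    (x : Vec d) : Integrable F (post q0 τ x) := by
  have := isProbabilityMeasure_post hD hτ x
  exact Integrable.of_bound (C := B) hF.1.aestronglyMeasurable (ae_post hF.2 x)

lemma abs_pmean_le (hD : ∀ᵐ θ ∂q0, ‖θ‖ ≤ D) (hτ : 0 < τ) (hF : BddObs q0 F B) (x : Vec d) :
    |pmean q0 τ F x| ≤ B := by
  have := isProbabilityMeasure_post hD hτ x
  have h := norm_integral_le_of_norm_le_const (f := F) (ae_post (τ := τ) hF.2 x)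
  simpa [pmean] using h

lemma expMoment_one_pos (hD : ∀ᵐ θ ∂q0, ‖θ‖ ≤ D) (hτ : 0 < τ) (x : Vec d) :
    0 < expMoment q0 τ (fun _ => 1) x := by
  unfold expMoment
  simpa using integral_exp_pos (integrable_exp_tiltExp hD hτ x)

lemma hasFDerivAt_expMoment (hD : ∀ᵐ θ ∂q0, ‖θ‖ ≤ D) (hτ : 0 < τ) (hF : BddObs q0 F B)
    (x : Vec d) : ∃ L : Vec d →L[ℝ] ℝ, HasFDerivAt (expMoment q0 τ F) L x ∧
      ∀ v, L v = τ⁻¹ * expMoment q0 τ (fun θ => F θ * ⟪θ, v⟫) x := by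
  have hD0 := nonneg_of_ae_norm_le hD
  have hB0 := hF.nonneg
  let F' : Vec d → Vec d → (Vec d →L[ℝ] ℝ) :=
    fun y θ => (F θ * rexp (tiltExp τ y θ) * τ⁻¹) • innerSL ℝ θ
  have hmeas : ∀ y, Measurable (F' y) := fun y =>
    ((hF.1.mul (measurable_tiltExp y).exp).mul_const _).smul (innerSL ℝ).continuous.measurable
  have hbd : ∀ᵐ θ ∂q0, ∀ y ∈ Metric.ball x 1,
      ‖F' y θ‖ ≤ B * rexp ((‖x‖ + 1) * D / τ) * τ⁻¹ * D := by
    filter_upwards [hD, hF.2] with θ h1 h2 y hy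
    have hy' : ‖y‖ ≤ ‖x‖ + 1 := by
      have := norm_le_norm_add_norm_sub' y x
      rw [← dist_eq_norm] at this
      have := Metric.mem_ball.1 hy
      linarith
    rw [norm_smul, innerSL_apply_norm, norm_mul, norm_mul, Real.norm_of_nonneg (exp_pos _).le,
      Real.norm_of_nonneg (inv_nonneg.2 hτ.le), Real.norm_eq_abs]
    have : rexp (tiltExp τ y θ) ≤ rexp ((‖x‖ + 1) * D / τ) := by
      apply exp_le_exp.2
      refine (tiltExp_le hτ h1).trans ?_
      gcongr
    gcongr
  have hint : Integrable (F' x) q0 := by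
    refine Integrable.of_bound (hmeas x).aestronglyMeasurable
      (B * rexp ((‖x‖ + 1) * D / τ) * τ⁻¹ * D) ?_
    filter_upwards [hbd] with θ h
    exact h x (Metric.mem_ball_self one_pos)
  refine ⟨∫ θ, F' x θ ∂q0, ?_, fun v => ?_⟩
  · refine hasFDerivAt_integral_of_dominated_of_fderiv_le (Metric.ball_mem_nhds x one_pos)
      (Filter.Eventually.of_forall fun y =>
        (integrable_mul_exp_tiltExp hD hτ hF y).aestronglyMeasurable)
      (integrable_mul_exp_tiltExp hD hτ hF x) (hmeas x).aestronglyMeasurable hbd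
      (integrable_const _) ?_
    refine ae_of_all _ fun θ y _ => ?_
    have h1 : HasFDerivAt (fun y => tiltExp τ y θ) (τ⁻¹ • innerSL ℝ θ) y := by
      have h := ((innerSL ℝ θ).hasFDerivAt (x := y)).sub_const (‖θ‖ ^ 2 / 2) |>.const_mul τ⁻¹
      refine h.congr_of_eventuallyEq (Filter.Eventually.of_forall fun z => ?_)
      simp only [tiltExp, innerSL_apply_apply, real_inner_comm]
      ring
    have h2 := (h1.exp).const_mul (F θ)
    convert! h2 using 1
    simp only [F', smul_smul]
    congr 1
    ring
  · rw [ContinuousLinearMap.integral_apply hint, expMoment, ← integral_const_mul]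
    congr 1
    ext θ
    simp only [F', FunLike.coe_smul, Pi.smul_apply, innerSL_apply_apply, smul_eq_mul]
    ring

lemma hasFDerivAt_pmean (hD : ∀ᵐ θ ∂q0, ‖θ‖ ≤ D) (hτ : 0 < τ) (hF : BddObs q0 F B)
    (x : Vec d) : ∃ L : Vec d →L[ℝ] ℝ, HasFDerivAt (pmean q0 τ F) L x ∧
      ∀ v, L v = τ⁻¹ * (pmean q0 τ (fun θ => F θ * ⟪θ, v⟫) x
        - pmean q0 τ F x * pmean q0 τ (fun θ => ⟪θ, v⟫) x) := by
  obtain ⟨L, hL, hLv⟩ := hasFDerivAt_expMoment hD hτ hF x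
  obtain ⟨M, hM, hMv⟩ := hasFDerivAt_expMoment hD hτ bddObs_one x
  have hpos := expMoment_one_pos hD hτ x
  have h := hL.mul ((hasDerivAt_inv hpos.ne').comp_hasFDerivAt x hM)
  refine ⟨_, h.congr_of_eventuallyEq (Filter.Eventually.of_forall fun y => by
    rw [pmean_eq_div, div_eq_mul_inv]; rfl),
    fun v => ?_⟩
  simp only [FunLike.coe_smul, Pi.smul_apply, FunLike.coe_add, Pi.add_apply, smul_eq_mul,
    Function.comp_apply, hLv, hMv, pmean_eq_div, one_mul]
  field_simp
  ring

lemma continuous_pmean (hD : ∀ᵐ θ ∂q0, ‖θ‖ ≤ D) (hτ : 0 < τ) (hF : BddObs q0 F B) :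
    Continuous (pmean q0 τ F) := by
  refine continuous_iff_continuousAt.2 fun x => ?_
  obtain ⟨L, hL, -⟩ := hasFDerivAt_pmean hD hτ hF x
  exact hL.continuousAt

lemma abs_pmean_add_sub_le (hD : ∀ᵐ θ ∂q0, ‖θ‖ ≤ D) (hτ : 0 < τ) (hF : BddObs q0 F B)
    (x u : Vec d) :
    |pmean q0 τ F (x + u) - pmean q0 τ F x| ≤ 2 * B * D / τ * ‖u‖ := by
  choose L hL hLv using hasFDerivAt_pmean (τ := τ) hD hτ hF
  have hD0 := nonneg_of_ae_norm_le hD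
  have hB0 := hF.nonneg
  have hb : ∀ y, ‖L y‖ ≤ 2 * B * D / τ := by
    intro y
    refine ContinuousLinearMap.opNorm_le_bound _ (by positivity) fun v => ?_
    rw [hLv, norm_mul, Real.norm_of_nonneg (inv_nonneg.2 hτ.le), Real.norm_eq_abs]
    have h1 := abs_pmean_le hD hτ (hF.mul (bddObs_inner hD v)) y
    have h2 := abs_pmean_le hD hτ (bddObs_inner hD v) y
    have h3 := abs_pmean_le hD hτ hF y
    have h4 : |pmean q0 τ F y * pmean q0 τ (fun θ => ⟪θ, v⟫) y| ≤ B * (D * ‖v‖) := by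
      rw [abs_mul]; gcongr
    have h5 := abs_sub (pmean q0 τ (fun θ => F θ * ⟪θ, v⟫) y)
      (pmean q0 τ F y * pmean q0 τ (fun θ => ⟪θ, v⟫) y)
    calc τ⁻¹ * _ ≤ τ⁻¹ * (B * (D * ‖v‖) + B * (D * ‖v‖)) := by gcongr; linarith
      _ = 2 * B * D / τ * ‖v‖ := by ring
  have h := Convex.norm_image_sub_le_of_norm_hasFDerivWithin_le (s := Set.univ)
    (f := pmean q0 τ F) (f' := L) (fun y _ => (hL y).hasFDerivWithinAt) (fun y _ => hb y)
    convex_univ (Set.mem_univ x) (Set.mem_univ (x + u))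
  simpa using h

end

lemma pow_integral_le {Ω : Type*} [MeasurableSpace Ω] {μ : Measure Ω} [IsProbabilityMeasure μ]
    {f : Ω → ℝ} {n : ℕ} (hf : Integrable f μ) (hfn : Integrable (fun ω => f ω ^ n) μ)
    (h0 : ∀ ω, 0 ≤ f ω) : (∫ ω, f ω ∂μ) ^ n ≤ ∫ ω, f ω ^ n ∂μ :=
  (convexOn_pow n).map_integral_le (by fun_prop) isClosed_Ici (ae_of_all _ h0) hf hfn

lemma sq_integral_le {Ω : Type*} [MeasurableSpace Ω] {μ : Measure Ω} [IsProbabilityMeasure μ]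
    {f : Ω → ℝ} (hf : Integrable f μ) (hf2 : Integrable (fun ω => f ω ^ 2) μ) :
    (∫ ω, f ω ∂μ) ^ 2 ≤ ∫ ω, f ω ^ 2 ∂μ :=
  (Even.convexOn_pow even_two).map_integral_le (by fun_prop) isClosed_univ (by simp) hf hf2

section

variable {d : ℕ}

/-- Coordinates of the conditional mean of `θ` given `θ + √τ z = x`. -/
def postMean (q0 : Measure (Vec d)) (τ : ℝ) (x : Vec d) : Vec d :=
  WithLp.toLp 2 fun i => pmean q0 τ (fun θ => θ i) x

/-- Entries of the conditional covariance of `θ` given `θ + √τ z = x`. -/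
def postCov (q0 : Measure (Vec d)) (τ : ℝ) (i j : Fin d) (x : Vec d) : ℝ :=
  pmean q0 τ (fun θ => θ i * θ j) x - pmean q0 τ (fun θ => θ i) x * pmean q0 τ (fun θ => θ j) x

/-- Directional derivative of the conditional mean. -/
def dMean (q0 : Measure (Vec d)) (τ : ℝ) (i : Fin d) (x v : Vec d) : ℝ :=
  τ⁻¹ * (pmean q0 τ (fun θ => θ i * ⟪θ, v⟫) x
    - pmean q0 τ (fun θ => θ i) x * pmean q0 τ (fun θ => ⟪θ, v⟫) x)

/-- Directional derivative of the conditional covariance. -/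
def dCov (q0 : Measure (Vec d)) (τ : ℝ) (i j : Fin d) (x v : Vec d) : ℝ :=
  τ⁻¹ * (pmean q0 τ (fun θ => θ i * θ j * ⟪θ, v⟫) x
    - pmean q0 τ (fun θ => θ i * θ j) x * pmean q0 τ (fun θ => ⟪θ, v⟫) x)
  - (pmean q0 τ (fun θ => θ i) x * dMean q0 τ j x v
    + dMean q0 τ i x v * pmean q0 τ (fun θ => θ j) x)

variable {q0 : Measure (Vec d)} {D τ : ℝ} {F G : Vec d → ℝ} {A B : ℝ}

@[simp] lemma postMean_apply (x : Vec d) (i : Fin d) :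
    postMean q0 τ x i = pmean q0 τ (fun θ => θ i) x := rfl

variable [IsProbabilityMeasure q0]

lemma hasFDerivAt_coord_postMean (hD : ∀ᵐ θ ∂q0, ‖θ‖ ≤ D) (hτ : 0 < τ) (i : Fin d) (x : Vec d) :
    ∃ L : Vec d →L[ℝ] ℝ, HasFDerivAt (pmean q0 τ fun θ => θ i) L x ∧
      ∀ v, L v = dMean q0 τ i x v :=
  hasFDerivAt_pmean hD hτ (bddObs_coord hD i) x

lemma hasFDerivAt_postCov (hD : ∀ᵐ θ ∂q0, ‖θ‖ ≤ D) (hτ : 0 < τ) (i j : Fin d) (x : Vec d) :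
    ∃ L : Vec d →L[ℝ] ℝ, HasFDerivAt (postCov q0 τ i j) L x ∧
      ∀ v, L v = dCov q0 τ i j x v := by
  obtain ⟨L, hL, hLv⟩ := hasFDerivAt_pmean hD hτ ((bddObs_coord hD i).mul (bddObs_coord hD j)) x
  obtain ⟨M, hM, hMv⟩ := hasFDerivAt_coord_postMean hD hτ i x
  obtain ⟨N, hN, hNv⟩ := hasFDerivAt_coord_postMean hD hτ j x
  refine ⟨_, hL.sub (hM.mul hN), fun v => ?_⟩
  simp only [FunLike.coe_sub, Pi.sub_apply, FunLike.coe_add, Pi.add_apply, FunLike.coe_smul,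
    Pi.smul_apply, smul_eq_mul, hLv, hMv, hNv, dCov]
  ring

/-- Functions of `(τ, x, v)` which for `τ ≥ τ₀` are bounded and Lipschitz in `x`, with constants
proportional to `‖v‖ ^ n`. -/
def Tame (τ₀ : ℝ) (n : ℕ) (G : ℝ → Vec d → Vec d → ℝ) : Prop :=
  ∃ K, 0 ≤ K ∧ ∀ τ, τ₀ ≤ τ → ∀ x v, |G τ x v| ≤ K * ‖v‖ ^ n ∧
    ∀ u, |G τ (x + u) v - G τ x v| ≤ K * ‖v‖ ^ n * ‖u‖

variable {τ₀ : ℝ} {n m : ℕ} {G₁ G₂ : ℝ → Vec d → Vec d → ℝ}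

lemma Tame.mul (h₁ : Tame τ₀ n G₁) (h₂ : Tame τ₀ m G₂) :
    Tame τ₀ (n + m) fun τ x v => G₁ τ x v * G₂ τ x v := by
  obtain ⟨K, hK, h₁⟩ := h₁
  obtain ⟨M, hM, h₂⟩ := h₂
  refine ⟨2 * K * M, by positivity, fun τ hτ x v => ⟨?_, fun u => ?_⟩⟩
  · rw [abs_mul]
    calc |G₁ τ x v| * |G₂ τ x v| ≤ (K * ‖v‖ ^ n) * (M * ‖v‖ ^ m) := by
          gcongr
          · exact (h₁ τ hτ x v).1
          · exact (h₂ τ hτ x v).1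
      _ = K * M * ‖v‖ ^ (n + m) := by ring
      _ ≤ 2 * K * M * ‖v‖ ^ (n + m) := by
          gcongr
          nlinarith [mul_nonneg hK hM]
  · have e : G₁ τ (x + u) v * G₂ τ (x + u) v - G₁ τ x v * G₂ τ x v
        = (G₁ τ (x + u) v - G₁ τ x v) * G₂ τ (x + u) v
          + G₁ τ x v * (G₂ τ (x + u) v - G₂ τ x v) := by ring
    rw [e]
    calc _ ≤ |G₁ τ (x + u) v - G₁ τ x v| * |G₂ τ (x + u) v|
          + |G₁ τ x v| * |G₂ τ (x + u) v - G₂ τ x v| := by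
          rw [← abs_mul, ← abs_mul]; exact abs_add_le _ _
      _ ≤ (K * ‖v‖ ^ n * ‖u‖) * (M * ‖v‖ ^ m) + (K * ‖v‖ ^ n) * (M * ‖v‖ ^ m * ‖u‖) := by
          gcongr
          · exact (h₁ τ hτ x v).2 u
          · exact (h₂ τ hτ (x + u) v).1
          · exact (h₁ τ hτ x v).1
          · exact (h₂ τ hτ x v).2 u
      _ = _ := by ring

lemma Tame.add (h₁ : Tame τ₀ n G₁) (h₂ : Tame τ₀ n G₂) :
    Tame τ₀ n fun τ x v => G₁ τ x v + G₂ τ x v := by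
  obtain ⟨K, hK, h₁⟩ := h₁
  obtain ⟨M, hM, h₂⟩ := h₂
  refine ⟨K + M, by positivity, fun τ hτ x v => ⟨?_, fun u => ?_⟩⟩
  · have := (h₁ τ hτ x v).1
    have := (h₂ τ hτ x v).1
    have := abs_add_le (G₁ τ x v) (G₂ τ x v)
    linarith
  · have h3 := (h₁ τ hτ x v).2 u
    have h4 := (h₂ τ hτ x v).2 u
    have h5 := abs_add_le (G₁ τ (x + u) v - G₁ τ x v) (G₂ τ (x + u) v - G₂ τ x v)
    rw [add_sub_add_comm]
    linarith

lemma Tame.sub (h₁ : Tame τ₀ n G₁) (h₂ : Tame τ₀ n G₂) :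
    Tame τ₀ n fun τ x v => G₁ τ x v - G₂ τ x v := by
  obtain ⟨M, hM, h₂⟩ := h₂
  have h₃ : Tame τ₀ n fun τ x v => -G₂ τ x v := by
    refine ⟨M, hM, fun τ hτ x v => ⟨by rw [abs_neg]; exact (h₂ τ hτ x v).1, fun u => ?_⟩⟩
    rw [neg_sub_neg, abs_sub_comm]
    exact (h₂ τ hτ x v).2 u
  simpa [sub_eq_add_neg] using h₁.add h₃

lemma tame_inv (h : 0 < τ₀) : Tame τ₀ 0 fun τ (_ _ : Vec d) => τ⁻¹ := by
  refine ⟨τ₀⁻¹, by positivity, fun τ hτ x v => ⟨?_, fun u => ?_⟩⟩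
  · have : 0 < τ := h.trans_le hτ
    rw [abs_of_pos (by positivity), pow_zero, mul_one]
    exact inv_anti₀ h hτ
  · simp only [sub_self, abs_zero]; positivity

lemma tame_pmean (hD : ∀ᵐ θ ∂q0, ‖θ‖ ≤ D) (h : 0 < τ₀) {F : Vec d → Vec d → ℝ} {B : ℝ}
    (hB : 0 ≤ B) (hF : ∀ v, BddObs q0 (F v) (B * ‖v‖ ^ n)) :
    Tame τ₀ n fun τ x v => pmean q0 τ (F v) x := by
  have hD0 := nonneg_of_ae_norm_le hD
  refine ⟨B + 2 * B * D / τ₀, by positivity, fun τ hτ x v => ⟨?_, fun u => ?_⟩⟩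
  · refine (abs_pmean_le hD (h.trans_le hτ) (hF v) x).trans ?_
    gcongr
    exact le_add_of_nonneg_right (by positivity)
  · refine (abs_pmean_add_sub_le hD (h.trans_le hτ) (hF v) x u).trans ?_
    have : 0 < τ := h.trans_le hτ
    calc 2 * (B * ‖v‖ ^ n) * D / τ * ‖u‖ ≤ 2 * (B * ‖v‖ ^ n) * D / τ₀ * ‖u‖ := by gcongr
      _ = (2 * B * D / τ₀) * ‖v‖ ^ n * ‖u‖ := by ring
      _ ≤ _ := by
        gcongr
        exact le_add_of_nonneg_left hB

lemma tame_dMean (hD : ∀ᵐ θ ∂q0, ‖θ‖ ≤ D) (h : 0 < τ₀) (i : Fin d) :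
    Tame τ₀ 1 fun τ x v => dMean q0 τ i x v := by
  have hD0 := nonneg_of_ae_norm_le hD
  have h1 : Tame τ₀ 1 fun τ x v => pmean q0 τ (fun θ => θ i * ⟪θ, v⟫) x := by
    refine tame_pmean hD h (B := D * D) (by positivity) fun v => ?_
    simpa [mul_assoc] using (bddObs_coord hD i).mul (bddObs_inner hD v)
  have h2 : Tame τ₀ 0 fun τ x (_ : Vec d) => pmean q0 τ (fun θ => θ i) x :=
    tame_pmean hD h (F := fun _ θ => θ i) hD0 fun v => by simpa using bddObs_coord hD i
  have h3 : Tame τ₀ 1 fun τ x v => pmean q0 τ (fun θ => ⟪θ, v⟫) x :=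
    tame_pmean hD h hD0 fun v => by simpa using bddObs_inner hD v
  have h4 := h2.mul h3
  rw [zero_add] at h4
  have h5 := (tame_inv (d := d) h).mul (h1.sub h4)
  rw [zero_add] at h5
  exact h5

lemma tame_dCov (hD : ∀ᵐ θ ∂q0, ‖θ‖ ≤ D) (h : 0 < τ₀) (i j : Fin d) :
    Tame τ₀ 1 fun τ x v => dCov q0 τ i j x v := by
  have hD0 := nonneg_of_ae_norm_le hD
  have h1 : Tame τ₀ 1 fun τ x v => pmean q0 τ (fun θ => θ i * θ j * ⟪θ, v⟫) x := by
    refine tame_pmean hD h (B := D * D * D) (by positivity) fun v => ?_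
    simpa [mul_assoc] using
      ((bddObs_coord hD i).mul (bddObs_coord hD j)).mul (bddObs_inner hD v)
  have h2 : ∀ i : Fin d, Tame τ₀ 0 fun τ x (_ : Vec d) => pmean q0 τ (fun θ => θ i) x := fun i =>
    tame_pmean hD h (F := fun _ θ => θ i) hD0 fun v => by simpa using bddObs_coord hD i
  have h2' : Tame τ₀ 0 fun τ x (_ : Vec d) => pmean q0 τ (fun θ => θ i * θ j) x :=
    tame_pmean hD h (F := fun _ θ => θ i * θ j) (mul_nonneg hD0 hD0) fun v => by
      simpa using (bddObs_coord hD i).mul (bddObs_coord hD j)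
  have h3 : Tame τ₀ 1 fun τ x v => pmean q0 τ (fun θ => ⟪θ, v⟫) x :=
    tame_pmean hD h hD0 fun v => by simpa using bddObs_inner hD v
  have h4 := h2'.mul h3
  rw [zero_add] at h4
  have h5 := (tame_inv (d := d) h).mul (h1.sub h4)
  have h6 := (h2 i).mul (tame_dMean hD h j)
  have h7 := (tame_dMean hD h i).mul (h2 j)
  rw [zero_add] at h5 h6
  rw [add_zero] at h7
  exact h5.sub (h6.add h7)

lemma abs_sub_sub_le_of_lipschitz_fderiv {f : Vec d → ℝ} {f' : Vec d → Vec d → ℝ} {K : ℝ}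
    (hK : 0 ≤ K) (hf : ∀ x, ∃ L : Vec d →L[ℝ] ℝ, HasFDerivAt f L x ∧ ∀ v, L v = f' x v)
    (hlip : ∀ x v u, |f' (x + u) v - f' x v| ≤ K * ‖v‖ * ‖u‖) (x v : Vec d) :
    |f (x + v) - f x - f' x v| ≤ K * ‖v‖ ^ 2 := by
  choose L hL hLv using hf
  have hb : ∀ y ∈ Metric.closedBall x ‖v‖, ‖L y - L x‖ ≤ K * ‖v‖ := by
    intro y hy
    refine ContinuousLinearMap.opNorm_le_bound _ (by positivity) fun w => ?_
    have h := hlip x w (y - x)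
    rw [add_sub_cancel, ← hLv, ← hLv] at h
    have hy' : ‖y - x‖ ≤ ‖v‖ := by rwa [← dist_eq_norm]
    calc ‖(L y - L x) w‖ ≤ K * ‖w‖ * ‖y - x‖ := h
      _ ≤ K * ‖w‖ * ‖v‖ := by gcongr
      _ = K * ‖v‖ * ‖w‖ := by ring
  have h := Convex.norm_image_sub_le_of_norm_hasFDerivWithin_le' (f := f) (f' := L) (φ := L x)
    (fun y _ => (hL y).hasFDerivWithinAt) hb (convex_closedBall x ‖v‖)
    (Metric.mem_closedBall_self (norm_nonneg _)) (y := x + v) (by simp)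
  rw [add_sub_cancel_left, hLv] at h
  calc _ ≤ K * ‖v‖ * ‖v‖ := h
    _ = _ := by ring

lemma exists_postMean_taylor (hD : ∀ᵐ θ ∂q0, ‖θ‖ ≤ D) (h : 0 < τ₀) :
    ∃ K, 0 ≤ K ∧ ∀ τ, τ₀ ≤ τ → ∀ (i : Fin d) (x v : Vec d),
      |postMean q0 τ (x + v) i - postMean q0 τ x i - dMean q0 τ i x v| ≤ K * ‖v‖ ^ 2 := by
  choose K hK hKb using fun i => tame_dMean (τ₀ := τ₀) hD h i
  refine ⟨∑ i, K i, Finset.sum_nonneg fun i _ => hK i, fun τ hτ i x v => ?_⟩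
  refine (abs_sub_sub_le_of_lipschitz_fderiv (hK i)
    (hasFDerivAt_coord_postMean hD (h.trans_le hτ) i) (fun x v u => ?_) x v).trans ?_
  · simpa using (hKb i τ hτ x v).2 u
  · gcongr
    exact Finset.single_le_sum (fun i _ => hK i) (Finset.mem_univ i)

lemma exists_postCov_taylor (hD : ∀ᵐ θ ∂q0, ‖θ‖ ≤ D) (h : 0 < τ₀) :
    ∃ K, 0 ≤ K ∧ ∀ τ, τ₀ ≤ τ → ∀ (i j : Fin d) (x v : Vec d),
      |postCov q0 τ i j (x + v) - postCov q0 τ i j x - dCov q0 τ i j x v| ≤ K * ‖v‖ ^ 2 := by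
  choose K hK hKb using fun p : Fin d × Fin d => tame_dCov (τ₀ := τ₀) hD h p.1 p.2
  refine ⟨∑ p, K p, Finset.sum_nonneg fun p _ => hK p, fun τ hτ i j x v => ?_⟩
  refine (abs_sub_sub_le_of_lipschitz_fderiv (hK (i, j))
    (hasFDerivAt_postCov hD (h.trans_le hτ) i j) (fun x v u => ?_) x v).trans ?_
  · simpa using (hKb (i, j) τ hτ x v).2 u
  · gcongr
    exact Finset.single_le_sum (fun p _ => hK p) (Finset.mem_univ (i, j))

end

section

variable {d : ℕ} {q0 : Measure (Vec d)} {D τ ε : ℝ} {F G : Vec d → ℝ} {A B : ℝ}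

lemma gaussDensity_sub (hτ : 0 < τ) (x θ : Vec d) :
    gaussDensity d τ (x - θ) = gaussDensity d τ x * rexp (tiltExp τ x θ) := by
  unfold gaussDensity tiltExp
  rw [mul_assoc, ← Real.exp_add, norm_sub_sq_real]
  congr 2
  field_simp
  ring

lemma measurable_tiltExp_uncurry : Measurable fun p : Vec d × Vec d => tiltExp τ p.1 p.2 := by
  unfold tiltExp; fun_prop

lemma lintegral_post {f : Vec d → ENNReal} (x : Vec d) :
    ∫⁻ θ, f θ ∂(post q0 τ x) = ∫⁻ θ, ENNReal.ofReal
      (rexp (tiltExp τ x θ) / expMoment q0 τ (fun _ => 1) x) * f θ ∂q0 := by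
  unfold post
  rw [lintegral_tilted]
  simp [expMoment]

lemma measurable_gaussian_average (hG : Measurable G) :
    Measurable fun x => ∫ g, G (x + √ε • g) ∂(_root_.stdGaussian d) :=
  (StronglyMeasurable.integral_prod_right'
    (f := fun p : Vec d × Vec d => G (p.1 + √ε • p.2))
    (Measurable.stronglyMeasurable (by fun_prop))).measurable

lemma abs_gaussian_average_le (hb : ∀ x, |G x| ≤ B) (x : Vec d) :
    |∫ g, G (x + √ε • g) ∂(_root_.stdGaussian d)| ≤ B := by
  have := norm_integral_le_of_norm_le_const (μ := _root_.stdGaussian d)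
    (f := fun g => G (x + √ε • g)) (ae_of_all _ fun g => hb _)
  simpa using this

variable [IsProbabilityMeasure q0]

lemma measurable_expMoment_one : Measurable (expMoment q0 τ fun _ => 1) := by
  unfold expMoment
  refine StronglyMeasurable.measurable ?_
  refine StronglyMeasurable.integral_prod_right'
    (f := fun p : Vec d × Vec d => 1 * rexp (tiltExp τ p.1 p.2)) ?_
  exact (measurable_tiltExp_uncurry.exp.const_mul 1).stronglyMeasurable

/-- Density of `heatLaw q0 τ`. -/
def heatDensity (q0 : Measure (Vec d)) (τ : ℝ) (x : Vec d) : ℝ :=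
  gaussDensity d τ x * expMoment q0 τ (fun _ => 1) x

lemma measurable_lintegral_post {f : Vec d × Vec d → ENNReal} (hf : Measurable f) :
    Measurable fun x => ∫⁻ θ, f (x, θ) ∂(post q0 τ x) := by
  simp_rw [lintegral_post]
  refine Measurable.lintegral_prod_right' (f := fun p : Vec d × Vec d => ENNReal.ofReal
      (rexp (tiltExp τ p.1 p.2) / expMoment q0 τ (fun _ => 1) p.1) * f p) ?_
  have h1 := measurable_tiltExp_uncurry (d := d) (τ := τ)
  have h2 := measurable_expMoment_one (q0 := q0) (τ := τ)
  exact ((h1.exp.div (h2.comp measurable_fst)).ennreal_ofReal).mul hf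

/-- The conditional laws `post q0 τ` as a kernel. -/
def postKernel (q0 : Measure (Vec d)) [IsProbabilityMeasure q0] (τ : ℝ) : Kernel (Vec d) (Vec d) where
  toFun := post q0 τ
  measurable' := by
    refine Measure.measurable_of_measurable_coe _ fun s hs => ?_
    have := measurable_lintegral_post (q0 := q0) (τ := τ)
      (f := fun p => s.indicator (fun _ => 1) p.2)
      ((measurable_const.indicator hs).comp measurable_snd)
    simpa [lintegral_indicator hs] using this

lemma lintegral_gaussDensity_mul (hD : ∀ᵐ θ ∂q0, ‖θ‖ ≤ D) (hτ : 0 < τ) {f : Vec d → ENNReal}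
    (hf : Measurable f) (x : Vec d) :
    ∫⁻ θ, ENNReal.ofReal (gaussDensity d τ (x - θ)) * f θ ∂q0
      = ENNReal.ofReal (heatDensity q0 τ x) * ∫⁻ θ, f θ ∂(post q0 τ x) := by
  have hZ := expMoment_one_pos hD hτ x
  have hg := gaussDensity_pos (d := d) hτ x
  have hm := measurable_tiltExp (τ := τ) x
  rw [lintegral_post, ← lintegral_const_mul _ (by fun_prop)]
  congr 1 with θ
  rw [← mul_assoc, ← ENNReal.ofReal_mul (by unfold heatDensity; positivity), gaussDensity_sub hτ,
    heatDensity]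
  congr 2
  field_simp

lemma lintegral_gaussian_shift (hD : ∀ᵐ θ ∂q0, ‖θ‖ ≤ D) (hτ : 0 < τ)
    {f : Vec d × Vec d → ENNReal} (hf : Measurable f) :
    ∫⁻ θ, ∫⁻ z, f (θ + √τ • z, θ) ∂(_root_.stdGaussian d) ∂q0
      = ∫⁻ x, ENNReal.ofReal (heatDensity q0 τ x) * ∫⁻ θ, f (x, θ) ∂(post q0 τ x) := by
  have h1 : ∀ θ, ∫⁻ z, f (θ + √τ • z, θ) ∂(_root_.stdGaussian d)
      = ∫⁻ x, ENNReal.ofReal (gaussDensity d τ (x - θ)) * f (x, θ) := fun θ =>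
    lintegral_affine_stdGaussian hτ θ (f := fun x => f (x, θ)) (by fun_prop)
  simp_rw [h1]
  have hg := measurable_gaussDensity (d := d) (τ := τ)
  rw [lintegral_lintegral_swap (by fun_prop)]
  congr 1 with x
  exact lintegral_gaussDensity_mul hD hτ (f := fun θ => f (x, θ)) (by fun_prop) x

lemma measurable_heatDensity : Measurable (heatDensity q0 τ) :=
  measurable_gaussDensity.mul measurable_expMoment_one

lemma heatLaw_eq_withDensity (hD : ∀ᵐ θ ∂q0, ‖θ‖ ≤ D) (hτ : 0 < τ) :
    heatLaw q0 τ = volume.withDensity fun x => ENNReal.ofReal (heatDensity q0 τ x) := by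
  refine Measure.ext_of_lintegral _ fun f hf => ?_
  rw [lintegral_withDensity_eq_lintegral_mul _ measurable_heatDensity.ennreal_ofReal hf, heatLaw,
    lintegral_map hf (by fun_prop), lintegral_prod _ (by fun_prop)]
  have := lintegral_gaussian_shift hD hτ (f := fun p => f p.1) (by fun_prop)
  rw [this]
  congr 1 with x
  have := isProbabilityMeasure_post hD hτ x
  simp

/-- The Bayes formula. -/
lemma map_eq_compProd (hD : ∀ᵐ θ ∂q0, ‖θ‖ ≤ D) (hτ : 0 < τ) :
    (q0.prod (_root_.stdGaussian d)).map (fun p => (p.1 + √τ • p.2, p.1))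
      = heatLaw q0 τ ⊗ₘ postKernel q0 τ := by
  have : IsMarkovKernel (postKernel q0 τ) := ⟨fun x => isProbabilityMeasure_post hD hτ x⟩
  refine Measure.ext_of_lintegral _ fun f hf => ?_
  rw [Measure.lintegral_compProd hf, lintegral_map hf (by fun_prop),
    lintegral_prod _ (by fun_prop), lintegral_gaussian_shift hD hτ hf,
    heatLaw_eq_withDensity hD hτ, lintegral_withDensity_eq_lintegral_mul _
      measurable_heatDensity.ennreal_ofReal]
  · rfl
  · exact measurable_lintegral_post hf

lemma integral_bayes (hD : ∀ᵐ θ ∂q0, ‖θ‖ ≤ D) (hτ : 0 < τ) {f : Vec d × Vec d → ℝ}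
    (hf : Measurable f)
    (hi : Integrable (fun p : Vec d × Vec d => f (p.1 + √τ • p.2, p.1))
      (q0.prod (_root_.stdGaussian d))) :
    Integrable (fun x => ∫ θ, f (x, θ) ∂(post q0 τ x)) (heatLaw q0 τ) ∧
    ∫ x, ∫ θ, f (x, θ) ∂(post q0 τ x) ∂(heatLaw q0 τ)
      = ∫ p, f (p.1 + √τ • p.2, p.1) ∂(q0.prod (_root_.stdGaussian d)) := by
  have : IsMarkovKernel (postKernel q0 τ) := ⟨fun x => isProbabilityMeasure_post hD hτ x⟩
  have hi' : Integrable f (heatLaw q0 τ ⊗ₘ postKernel q0 τ) := by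
    rw [← map_eq_compProd hD hτ]
    exact (integrable_map_measure hf.aestronglyMeasurable (by fun_prop)).2 hi
  refine ⟨by simpa [postKernel] using Integrable.integral_compProd hi', ?_⟩
  have h := Measure.integral_compProd hi'
  rw [← map_eq_compProd hD hτ, integral_map (by fun_prop) hf.aestronglyMeasurable] at h
  exact h.symm

/-- Integral of a bounded function against `heatLaw`. -/
lemma integral_heatLaw (hG : Measurable G) (hb : ∀ x, |G x| ≤ B) :
    ∫ x, G x ∂(heatLaw q0 τ) = ∫ θ, ∫ z, G (θ + √τ • z) ∂(_root_.stdGaussian d) ∂q0 := by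
  rw [heatLaw, integral_map (by fun_prop) hG.aestronglyMeasurable, integral_prod]
  exact Integrable.of_bound (C := B) (Measurable.aestronglyMeasurable (by fun_prop))
    (ae_of_all _ fun p => hb _)

lemma integral_gaussian_add (hτ : 0 ≤ τ) (hε : 0 ≤ ε) (hG : Measurable G) (hb : ∀ x, |G x| ≤ B)
    (θ : Vec d) :
    ∫ z, ∫ g, G (θ + √τ • z + √ε • g) ∂(_root_.stdGaussian d) ∂(_root_.stdGaussian d)
      = ∫ z, G (θ + √(τ + ε) • z) ∂(_root_.stdGaussian d) := by
  have h := heatLaw_heatLaw (Measure.dirac θ) hτ hε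
  have h1 : ∫ x, G x ∂(heatLaw (heatLaw (Measure.dirac θ) τ) ε) = ∫ x, G x ∂(heatLaw (Measure.dirac θ) (τ + ε)) := by
    rw [h]
  have hm := measurable_gaussian_average (ε := ε) hG
  rw [integral_heatLaw hG hb, integral_heatLaw hG hb, integral_dirac, integral_heatLaw (B := B) hm,
    integral_dirac] at h1
  · exact h1
  · exact abs_gaussian_average_le hb

lemma measurable_pmean (hD : ∀ᵐ θ ∂q0, ‖θ‖ ≤ D) (hτ : 0 < τ) (hF : BddObs q0 F A) :
    Measurable (pmean q0 τ F) := (continuous_pmean hD hτ hF).measurable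

lemma integral_pmean_mul (hD : ∀ᵐ θ ∂q0, ‖θ‖ ≤ D) (hτ : 0 < τ) (hF : BddObs q0 F A)
    (hG : Measurable G) (hb : ∀ x, |G x| ≤ B) :
    ∫ x, pmean q0 τ F x * G x ∂(heatLaw q0 τ)
      = ∫ θ, F θ * ∫ z, G (θ + √τ • z) ∂(_root_.stdGaussian d) ∂q0 := by
  have hF1 := hF.1
  have hB : 0 ≤ B := (abs_nonneg _).trans (hb 0)
  have hi : Integrable (fun p : Vec d × Vec d => F p.1 * G (p.1 + √τ • p.2))
      (q0.prod (_root_.stdGaussian d)) := by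
    refine Integrable.of_bound (C := A * B) (by fun_prop) ?_
    have : ∀ᵐ p ∂(q0.prod (_root_.stdGaussian d)), |F p.1| ≤ A :=
      Measure.quasiMeasurePreserving_fst.ae hF.2
    filter_upwards [this] with p hp
    rw [norm_mul]
    exact mul_le_mul hp (hb _) (norm_nonneg _) ((abs_nonneg _).trans hp)
  have h := (integral_bayes hD hτ (f := fun p => F p.2 * G p.1) (by fun_prop) hi).2
  simp only [integral_mul_const] at h
  rw [integral_prod _ hi] at h
  simp only [integral_const_mul] at h
  exact h

/-- The conditional expectations of a function of `θ` form a reverse martingale. -/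
lemma integral_pmean_martingale (hD : ∀ᵐ θ ∂q0, ‖θ‖ ≤ D) (hτ : 0 < τ) (hε : 0 ≤ ε)
    (hF : BddObs q0 F A) (hG : Measurable G) (hb : ∀ x, |G x| ≤ B) :
    ∫ p, (pmean q0 τ F p.1 - pmean q0 (τ + ε) F (p.1 + √ε • p.2)) * G (p.1 + √ε • p.2)
      ∂((heatLaw q0 τ).prod (_root_.stdGaussian d)) = 0 := by
  have hτε : 0 < τ + ε := by positivity
  have hm1 := measurable_pmean hD hτ hF
  have hm2 := measurable_pmean hD hτε hF
  have hB : 0 ≤ B := (abs_nonneg _).trans (hb 0)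
  have hA := hF.nonneg
  have i1 : Integrable (fun p : Vec d × Vec d => pmean q0 τ F p.1 * G (p.1 + √ε • p.2))
      ((heatLaw q0 τ).prod (_root_.stdGaussian d)) := by
    refine Integrable.of_bound (C := A * B) (by fun_prop) (ae_of_all _ fun p => ?_)
    rw [norm_mul]
    exact mul_le_mul (abs_pmean_le hD hτ hF _) (hb _) (norm_nonneg _) hA
  have hb2 : ∀ x, |pmean q0 (τ + ε) F x * G x| ≤ A * B := fun x => by
    rw [abs_mul]
    exact mul_le_mul (abs_pmean_le hD hτε hF _) (hb _) (abs_nonneg _) hA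
  have i2 : Integrable (fun p : Vec d × Vec d =>
      pmean q0 (τ + ε) F (p.1 + √ε • p.2) * G (p.1 + √ε • p.2))
      ((heatLaw q0 τ).prod (_root_.stdGaussian d)) :=
    Integrable.of_bound (C := A * B) (by fun_prop) (ae_of_all _ fun p => hb2 _)
  simp only [sub_mul]
  rw [integral_sub i1 i2, sub_eq_zero]
  have hm := measurable_gaussian_average (ε := ε) hG
  have hmb := abs_gaussian_average_le (ε := ε) hb
  rw [integral_prod _ i1, integral_prod _ i2]
  simp only [integral_const_mul]
  rw [integral_pmean_mul hD hτ hF hm hmb]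
  rw [← integral_heatLaw (q0 := heatLaw q0 τ) (G := fun x => pmean q0 (τ + ε) F x * G x) (by fun_prop) hb2,
    heatLaw_heatLaw q0 hτ.le hε, integral_pmean_mul hD hτε hF hG hb]
  simp only [integral_gaussian_add hτ.le hε hG hb]

end

section

variable {d : ℕ} {q0 : Measure (Vec d)} {D τ ε : ℝ} {F : Vec d → ℝ}

lemma exists_bddObs_of_continuous (hD : ∀ᵐ θ ∂q0, ‖θ‖ ≤ D) (hF : Continuous F) :
    ∃ B, BddObs q0 F B := by
  obtain ⟨B, hB⟩ := (isCompact_closedBall (0 : Vec d) D).exists_bound_of_continuousOn hF.continuousOn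
  refine ⟨B, hF.measurable, ?_⟩
  filter_upwards [hD] with θ h
  exact hB θ (by simpa using h)

variable [IsProbabilityMeasure q0]

lemma integrable_post_of_continuous (hD : ∀ᵐ θ ∂q0, ‖θ‖ ≤ D) (hτ : 0 < τ) (x : Vec d)
    (hF : Continuous F) : Integrable F (post q0 τ x) := by
  obtain ⟨B, hB⟩ := exists_bddObs_of_continuous hD hF
  exact hB.integrable_post hD hτ x

lemma postMean_eq_integral (hD : ∀ᵐ θ ∂q0, ‖θ‖ ≤ D) (hτ : 0 < τ) (x : Vec d) :
    postMean q0 τ x = ∫ θ, θ ∂(post q0 τ x) := by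
  ext i
  rw [eval_integral_piLp fun i => integrable_post_of_continuous hD hτ x (by fun_prop)]
  rfl

lemma integrable_id_post (hD : ∀ᵐ θ ∂q0, ‖θ‖ ≤ D) (hτ : 0 < τ) (x : Vec d) :
    Integrable (fun θ => θ) (post q0 τ x) := by
  have := isProbabilityMeasure_post hD hτ x
  exact Integrable.of_bound (C := D) (by fun_prop) (ae_post hD x)

lemma pmean_inner (hD : ∀ᵐ θ ∂q0, ‖θ‖ ≤ D) (hτ : 0 < τ) (x v : Vec d) :
    pmean q0 τ (fun θ => ⟪θ, v⟫) x = ⟪postMean q0 τ x, v⟫ := by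
  rw [postMean_eq_integral hD hτ, pmean, real_inner_comm,
    ← integral_inner (integrable_id_post hD hτ x)]
  simp only [real_inner_comm]

lemma dMean_eq (hD : ∀ᵐ θ ∂q0, ‖θ‖ ≤ D) (hτ : 0 < τ) (i : Fin d) (x v : Vec d) :
    dMean q0 τ i x v = τ⁻¹ * ∫ θ, (θ - postMean q0 τ x) i * ⟪θ - postMean q0 τ x, v⟫
      ∂(post q0 τ x) := by
  have hI := fun {F : Vec d → ℝ} => integrable_post_of_continuous (F := F) hD hτ x
  have := isProbabilityMeasure_post hD hτ x
  have hc := pmean_inner hD hτ x v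
  have h : ∀ θ, (θ - postMean q0 τ x) i * ⟪θ - postMean q0 τ x, v⟫
      = θ i * ⟪θ, v⟫ - pmean q0 τ (fun θ => θ i) x * ⟪θ, v⟫
        - pmean q0 τ (fun θ => ⟪θ, v⟫) x * θ i
        + pmean q0 τ (fun θ => θ i) x * pmean q0 τ (fun θ => ⟪θ, v⟫) x := by
    intro θ
    rw [hc, inner_sub_left, PiLp.sub_apply, postMean_apply]
    ring
  simp only [h]
  rw [integral_add (hI (by fun_prop)) (hI (by fun_prop)),
    integral_sub (hI (by fun_prop)) (hI (by fun_prop)),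
    integral_sub (hI (by fun_prop)) (hI (by fun_prop)), integral_const_mul, integral_const_mul,
    integral_const, probReal_univ, dMean]
  simp only [pmean, one_smul]
  ring

lemma dCov_eq (hD : ∀ᵐ θ ∂q0, ‖θ‖ ≤ D) (hτ : 0 < τ) (i j : Fin d) (x v : Vec d) :
    dCov q0 τ i j x v = τ⁻¹ * ∫ θ, (θ - postMean q0 τ x) i * (θ - postMean q0 τ x) j
      * ⟪θ - postMean q0 τ x, v⟫ ∂(post q0 τ x) := by
  have hI := fun {F : Vec d → ℝ} => integrable_post_of_continuous (F := F) hD hτ x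
  have := isProbabilityMeasure_post hD hτ x
  have hc := pmean_inner hD hτ x v
  set mi := pmean q0 τ (fun θ => θ i) x with hmi
  set mj := pmean q0 τ (fun θ => θ j) x with hmj
  set c := pmean q0 τ (fun θ => ⟪θ, v⟫) x with hcc
  have h : ∀ θ, (θ - postMean q0 τ x) i * (θ - postMean q0 τ x) j * ⟪θ - postMean q0 τ x, v⟫
      = θ i * θ j * ⟪θ, v⟫ - mj * (θ i * ⟪θ, v⟫) - mi * (θ j * ⟪θ, v⟫) + mi * mj * ⟪θ, v⟫
        - c * (θ i * θ j) + c * mj * θ i + c * mi * θ j - c * mi * mj := by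
    intro θ
    rw [hc, inner_sub_left, PiLp.sub_apply, PiLp.sub_apply, postMean_apply, postMean_apply]
    ring
  simp only [h]
  rw [integral_sub (hI (by fun_prop)) (hI (by fun_prop)),
    integral_add (hI (by fun_prop)) (hI (by fun_prop)),
    integral_add (hI (by fun_prop)) (hI (by fun_prop)),
    integral_sub (hI (by fun_prop)) (hI (by fun_prop)),
    integral_add (hI (by fun_prop)) (hI (by fun_prop)),
    integral_sub (hI (by fun_prop)) (hI (by fun_prop)),
    integral_sub (hI (by fun_prop)) (hI (by fun_prop))]
  simp only [integral_const_mul, integral_const, probReal_univ, one_smul, dCov, dMean]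
  simp only [hmi, hmj, hcc, pmean]
  ring

lemma sum_dMean_sq_sq_le (hD : ∀ᵐ θ ∂q0, ‖θ‖ ≤ D) (hτ : 0 < τ) (x v : Vec d) :
    (∑ i, dMean q0 τ i x v ^ 2) ^ 2 ≤ τ⁻¹ ^ 4 * ∫ θ, ‖θ - postMean q0 τ x‖ ^ 4
      * ⟪θ - postMean q0 τ x, v⟫ ^ 4 ∂(post q0 τ x) := by
  have hI := fun {F : Vec d → ℝ} => integrable_post_of_continuous (F := F) hD hτ x
  have := isProbabilityMeasure_post hD hτ x
  set m := postMean q0 τ x with hm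
  have h1 : ∑ i, dMean q0 τ i x v ^ 2 ≤ τ⁻¹ ^ 2 * ∫ θ, ‖θ - m‖ ^ 2 * ⟪θ - m, v⟫ ^ 2
      ∂(post q0 τ x) := by
    have h2 : ∀ θ, ‖θ - m‖ ^ 2 * ⟪θ - m, v⟫ ^ 2 = ∑ i, ((θ - m) i * ⟪θ - m, v⟫) ^ 2 := by
      intro θ
      rw [EuclideanSpace.real_norm_sq_eq, Finset.sum_mul]
      simp only [mul_pow]
    simp only [h2]
    rw [integral_finsetSum _ fun i _ => hI (by fun_prop), Finset.mul_sum]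
    refine Finset.sum_le_sum fun i _ => ?_
    rw [dMean_eq hD hτ, mul_pow]
    gcongr
    exact sq_integral_le (hI (by fun_prop)) (hI (by fun_prop))
  calc (∑ i, dMean q0 τ i x v ^ 2) ^ 2
      ≤ (τ⁻¹ ^ 2 * ∫ θ, ‖θ - m‖ ^ 2 * ⟪θ - m, v⟫ ^ 2 ∂(post q0 τ x)) ^ 2 := by
        gcongr
    _ = τ⁻¹ ^ 4 * (∫ θ, ‖θ - m‖ ^ 2 * ⟪θ - m, v⟫ ^ 2 ∂(post q0 τ x)) ^ 2 := by ring
    _ ≤ τ⁻¹ ^ 4 * ∫ θ, (‖θ - m‖ ^ 2 * ⟪θ - m, v⟫ ^ 2) ^ 2 ∂(post q0 τ x) := by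
        gcongr
        exact sq_integral_le (hI (by fun_prop)) (hI (by fun_prop))
    _ = _ := by
        congr 2 with θ
        ring

lemma sum_dCov_sq_le (hD : ∀ᵐ θ ∂q0, ‖θ‖ ≤ D) (hτ : 0 < τ) (x v : Vec d) :
    ∑ i, ∑ j, dCov q0 τ i j x v ^ 2 ≤ τ⁻¹ ^ 2 * ∫ θ, ‖θ - postMean q0 τ x‖ ^ 4
      * ⟪θ - postMean q0 τ x, v⟫ ^ 2 ∂(post q0 τ x) := by
  have hI := fun {F : Vec d → ℝ} => integrable_post_of_continuous (F := F) hD hτ x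
  have := isProbabilityMeasure_post hD hτ x
  set m := postMean q0 τ x with hm
  have h2 : ∀ θ, ‖θ - m‖ ^ 4 * ⟪θ - m, v⟫ ^ 2
      = ∑ i, ∑ j, ((θ - m) i * (θ - m) j * ⟪θ - m, v⟫) ^ 2 := by
    intro θ
    have : ‖θ - m‖ ^ 4 = ‖θ - m‖ ^ 2 * ‖θ - m‖ ^ 2 := by ring
    rw [this, EuclideanSpace.real_norm_sq_eq, Finset.sum_mul_sum, Finset.sum_mul]
    simp only [Finset.sum_mul, mul_pow]
  simp only [h2]
  rw [integral_finsetSum _ fun i _ => hI (by fun_prop), Finset.mul_sum]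
  refine Finset.sum_le_sum fun i _ => ?_
  rw [integral_finsetSum _ fun i _ => hI (by fun_prop), Finset.mul_sum]
  refine Finset.sum_le_sum fun j _ => ?_
  rw [dCov_eq hD hτ, mul_pow]
  gcongr
  exact sq_integral_le (hI (by fun_prop)) (hI (by fun_prop))

lemma integral_gaussian_inner_pow (hD : ∀ᵐ θ ∂q0, ‖θ‖ ≤ D) (hτ : 0 < τ) (x m : Vec d) (n : ℕ) :
    Integrable (fun g => ∫ θ, ‖θ - m‖ ^ 4 * ⟪θ - m, √ε • g⟫ ^ n ∂(post q0 τ x))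
      (_root_.stdGaussian d) ∧
    ∫ g, ∫ θ, ‖θ - m‖ ^ 4 * ⟪θ - m, √ε • g⟫ ^ n ∂(post q0 τ x) ∂(_root_.stdGaussian d)
      = √ε ^ n * gaussMoment n * ∫ θ, ‖θ - m‖ ^ (4 + n) ∂(post q0 τ x) := by
  have hI := fun {F : Vec d → ℝ} => integrable_post_of_continuous (F := F) hD hτ x
  have := isProbabilityMeasure_post hD hτ x
  have hi : Integrable (fun p : Vec d × Vec d => ‖p.2 - m‖ ^ 4 * ⟪p.2 - m, √ε • p.1⟫ ^ n)
      ((_root_.stdGaussian d).prod (post q0 τ x)) := by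
    refine (Integrable.mul_prod ((integrable_norm_pow_stdGaussian d n).const_mul (√ε ^ n))
      (hI (F := fun θ => ‖θ - m‖ ^ (4 + n)) (by fun_prop))).mono (by fun_prop) (ae_of_all _ fun p => ?_)
    have hr : 0 ≤ √ε ^ n * ‖p.1‖ ^ n * ‖p.2 - m‖ ^ (4 + n) := by positivity
    rw [norm_mul, norm_pow, norm_pow, norm_norm, Real.norm_of_nonneg hr]
    calc ‖p.2 - m‖ ^ 4 * ‖⟪p.2 - m, √ε • p.1⟫‖ ^ n
        ≤ ‖p.2 - m‖ ^ 4 * (‖p.2 - m‖ * ‖√ε • p.1‖) ^ n := by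
          gcongr
          exact norm_inner_le_norm _ _
      _ = _ := by
          rw [norm_smul, Real.norm_of_nonneg (sqrt_nonneg _)]
          ring
  refine ⟨hi.integral_prod_left, ?_⟩
  rw [integral_integral_swap hi, ← integral_const_mul]
  congr 1 with θ
  simp only [inner_smul_right, mul_pow]
  rw [integral_const_mul, integral_const_mul, integral_inner_pow_stdGaussian]
  ring

lemma integral_norm_sub_postMean_pow_le (hD : ∀ᵐ θ ∂q0, ‖θ‖ ≤ D) (hτ : 0 < τ) (x : Vec d) (n : ℕ) :
    ∫ θ, ‖θ - postMean q0 τ x‖ ^ (n + 1) ∂(post q0 τ x)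
      ≤ 2 ^ (n + 1) * ∫ θ, ‖θ - x‖ ^ (n + 1) ∂(post q0 τ x) := by
  have hI := fun {F : Vec d → ℝ} => integrable_post_of_continuous (F := F) hD hτ x
  have := isProbabilityMeasure_post hD hτ x
  set m := postMean q0 τ x with hm
  have h1 : ‖x - m‖ ≤ ∫ θ, ‖θ - x‖ ∂(post q0 τ x) := by
    have : x - m = ∫ θ, (x - θ) ∂(post q0 τ x) := by
      rw [integral_sub (integrable_const _) (integrable_id_post hD hτ x), hm,
        postMean_eq_integral hD hτ]
      simp
    rw [this]
    refine (norm_integral_le_integral_norm _).trans_eq ?_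
    simp only [norm_sub_rev]
  have h2 : ‖x - m‖ ^ (n + 1) ≤ ∫ θ, ‖θ - x‖ ^ (n + 1) ∂(post q0 τ x) :=
    (pow_le_pow_left₀ (norm_nonneg _) h1 _).trans
      (pow_integral_le (hI (by fun_prop)) (hI (by fun_prop)) fun θ => norm_nonneg _)
  calc ∫ θ, ‖θ - m‖ ^ (n + 1) ∂(post q0 τ x)
      ≤ ∫ θ, 2 ^ n * (‖θ - x‖ ^ (n + 1) + ‖x - m‖ ^ (n + 1)) ∂(post q0 τ x) := by
        refine integral_mono (hI (by fun_prop)) (hI (by fun_prop)) fun θ => ?_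
        have h3 : ‖θ - m‖ ≤ ‖θ - x‖ + ‖x - m‖ := norm_sub_le_norm_sub_add_norm_sub ..
        exact (pow_le_pow_left₀ (norm_nonneg _) h3 _).trans
          (add_pow_le (norm_nonneg _) (norm_nonneg _) _)
    _ = 2 ^ n * (∫ θ, ‖θ - x‖ ^ (n + 1) ∂(post q0 τ x) + ‖x - m‖ ^ (n + 1)) := by
        rw [integral_const_mul, integral_add (hI (by fun_prop)) (hI (by fun_prop))]
        simp
    _ ≤ 2 ^ n * (∫ θ, ‖θ - x‖ ^ (n + 1) ∂(post q0 τ x)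
          + ∫ θ, ‖θ - x‖ ^ (n + 1) ∂(post q0 τ x)) := by gcongr
    _ = _ := by ring

lemma integral_norm_sub_pow_heatLaw (hD : ∀ᵐ θ ∂q0, ‖θ‖ ≤ D) (hτ : 0 < τ) (n : ℕ) :
    Integrable (fun x => ∫ θ, ‖θ - x‖ ^ n ∂(post q0 τ x)) (heatLaw q0 τ) ∧
    ∫ x, ∫ θ, ‖θ - x‖ ^ n ∂(post q0 τ x) ∂(heatLaw q0 τ)
      = √τ ^ n * ∫ z, ‖z‖ ^ n ∂(_root_.stdGaussian d) := by
  have h0 : ∀ p : Vec d × Vec d, ‖p.1 - (p.1 + √τ • p.2)‖ ^ n = √τ ^ n * ‖p.2‖ ^ n := by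
    intro p
    rw [sub_add_cancel_left, norm_neg, norm_smul, Real.norm_of_nonneg (sqrt_nonneg _), mul_pow]
  have hi : Integrable (fun p : Vec d × Vec d => ‖p.1 - (p.1 + √τ • p.2)‖ ^ n)
      (q0.prod (_root_.stdGaussian d)) := by
    simp only [h0]
    exact ((integrable_norm_pow_stdGaussian d n).comp_snd q0).const_mul _
  obtain ⟨h1, h2⟩ := integral_bayes hD hτ (f := fun p => ‖p.2 - p.1‖ ^ n) (by fun_prop) hi
  refine ⟨h1, h2.trans ?_⟩
  simp only [h0]
  rw [integral_const_mul, integral_fun_snd (fun z => ‖z‖ ^ n)]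
  simp

end

section

variable {d : ℕ} {q0 : Measure (Vec d)} {D τ τ₀ ε : ℝ} {F : Vec d → ℝ} [IsProbabilityMeasure q0]

lemma continuous_postCov (hD : ∀ᵐ θ ∂q0, ‖θ‖ ≤ D) (hτ : 0 < τ) (i j : Fin d) :
    Continuous (postCov q0 τ i j) := by
  unfold postCov
  exact (continuous_pmean hD hτ ((bddObs_coord hD i).mul (bddObs_coord hD j))).sub
    ((continuous_pmean hD hτ (bddObs_coord hD i)).mul (continuous_pmean hD hτ (bddObs_coord hD j)))

lemma abs_postCov_le (hD : ∀ᵐ θ ∂q0, ‖θ‖ ≤ D) (hτ : 0 < τ) (i j : Fin d) (x : Vec d) :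
    |postCov q0 τ i j x| ≤ 2 * D ^ 2 := by
  unfold postCov
  have h1 := abs_pmean_le hD hτ ((bddObs_coord hD i).mul (bddObs_coord hD j)) x
  have h2 := abs_pmean_le hD hτ (bddObs_coord hD i) x
  have h3 := abs_pmean_le hD hτ (bddObs_coord hD j) x
  have h4 := mul_le_mul h2 h3 (abs_nonneg _) ((abs_nonneg _).trans h2)
  rw [← abs_mul] at h4
  refine (abs_sub _ _).trans ?_
  linarith

lemma continuous_postMean (hD : ∀ᵐ θ ∂q0, ‖θ‖ ≤ D) (hτ : 0 < τ) :
    Continuous (postMean q0 τ) :=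
  (PiLp.continuous_toLp 2 _).comp
    (continuous_pi fun i => continuous_pmean hD hτ (bddObs_coord hD i))

lemma norm_postMean_le (hD : ∀ᵐ θ ∂q0, ‖θ‖ ≤ D) (hτ : 0 < τ) (x : Vec d) :
    ‖postMean q0 τ x‖ ≤ D := by
  have := isProbabilityMeasure_post hD hτ x
  rw [postMean_eq_integral hD hτ]
  simpa using norm_integral_le_of_norm_le_const (ae_post (τ := τ) hD x)

lemma integral_prod_le_of_forall_integral_le {μ ν : Measure (Vec d)} [SFinite μ] [SFinite ν]
    {f : Vec d × Vec d → ℝ} {h : Vec d → ℝ} (hf : Integrable f (μ.prod ν)) (hh : Integrable h μ)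
    (hle : ∀ x, ∫ g, f (x, g) ∂ν ≤ h x) : ∫ p, f p ∂(μ.prod ν) ≤ ∫ x, h x ∂μ := by
  rw [integral_prod _ hf]
  exact integral_mono hf.integral_prod_left hh hle

lemma integral_norm_sub_postMean_pow_six_le (hD : ∀ᵐ θ ∂q0, ‖θ‖ ≤ D) (hτ : 0 < τ) (x : Vec d) :
    ∫ θ, ‖θ - postMean q0 τ x‖ ^ 6 ∂(post q0 τ x)
      ≤ 64 * ∫ θ, ‖θ - x‖ ^ 6 ∂(post q0 τ x) := by
  have := integral_norm_sub_postMean_pow_le hD hτ x 5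
  norm_num at this
  exact this

lemma integral_norm_sub_postMean_pow_eight_le (hD : ∀ᵐ θ ∂q0, ‖θ‖ ≤ D) (hτ : 0 < τ) (x : Vec d) :
    ∫ θ, ‖θ - postMean q0 τ x‖ ^ 8 ∂(post q0 τ x)
      ≤ 256 * ∫ θ, ‖θ - x‖ ^ 8 ∂(post q0 τ x) := by
  have := integral_norm_sub_postMean_pow_le hD hτ x 7
  norm_num at this
  exact this

lemma exists_integral_postCov_sub_sq_le (hd : 1 ≤ d) (hD : ∀ᵐ θ ∂q0, ‖θ‖ ≤ D) (h0 : 0 < τ₀) :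
    ∃ K, 0 ≤ K ∧ ∀ τ, τ₀ ≤ τ → ∀ ε, 0 ≤ ε →
      ∫ p, ∑ i, ∑ j, (postCov q0 τ i j p.1 - postCov q0 τ i j (p.1 + √ε • p.2)) ^ 2
        ∂((heatLaw q0 τ).prod (_root_.stdGaussian d))
      ≤ 128 * gaussMoment 2 * (1 + gaussMoment 8) * d ^ 3 * τ * ε + K * ε ^ 2 := by
  obtain ⟨K, hK, hKb⟩ := exists_postCov_taylor hD h0
  have hm4 : 0 ≤ ∫ g, ‖g‖ ^ 4 ∂(_root_.stdGaussian d) := integral_nonneg fun _ => by positivity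
  have hg2 := gaussMoment_nonneg even_two
  refine ⟨2 * d ^ 2 * K ^ 2 * ∫ g, ‖g‖ ^ 4 ∂(_root_.stdGaussian d), by positivity,
    fun τ hτ₀ ε hε => ?_⟩
  have hτ : 0 < τ := h0.trans_le hτ₀
  have hc := fun i j => continuous_postCov (τ := τ) hD hτ i j
  have hf : Integrable (fun p : Vec d × Vec d =>
      ∑ i, ∑ j, (postCov q0 τ i j p.1 - postCov q0 τ i j (p.1 + √ε • p.2)) ^ 2)
      ((heatLaw q0 τ).prod (_root_.stdGaussian d)) := by
    refine integrable_finsetSum _ fun i _ => integrable_finsetSum _ fun j _ => ?_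
    refine Integrable.of_bound (C := (4 * D ^ 2) ^ 2) (by fun_prop) (ae_of_all _ fun p => ?_)
    rw [norm_pow, Real.norm_eq_abs]
    gcongr
    have h1 := abs_postCov_le hD hτ i j p.1
    have h2 := abs_postCov_le hD hτ i j (p.1 + √ε • p.2)
    refine (abs_sub _ _).trans ?_
    linarith
  obtain ⟨hi6, he6⟩ := integral_norm_sub_pow_heatLaw hD hτ 6
  refine (integral_prod_le_of_forall_integral_le hf
    (h := fun x => 2 * τ⁻¹ ^ 2 * (√ε ^ 2 * gaussMoment 2 *
      (64 * ∫ θ, ‖θ - x‖ ^ 6 ∂(post q0 τ x)))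
      + 2 * d ^ 2 * K ^ 2 * (√ε ^ 4 * ∫ g, ‖g‖ ^ 4 ∂(_root_.stdGaussian d)))
    (((((hi6.const_mul _).const_mul _).const_mul _)).add (integrable_const _)) fun x => ?_).trans ?_
  · obtain ⟨hi, he⟩ := integral_gaussian_inner_pow (ε := ε) hD hτ x (postMean q0 τ x) 2
    have hi4 := integrable_norm_pow_stdGaussian d 4
    calc ∫ g, ∑ i, ∑ j, (postCov q0 τ i j x - postCov q0 τ i j (x + √ε • g)) ^ 2
          ∂(_root_.stdGaussian d)
        ≤ ∫ g, (2 * τ⁻¹ ^ 2 * (∫ θ, ‖θ - postMean q0 τ x‖ ^ 4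
            * ⟪θ - postMean q0 τ x, √ε • g⟫ ^ 2 ∂(post q0 τ x))
            + 2 * d ^ 2 * K ^ 2 * (√ε ^ 4 * ‖g‖ ^ 4)) ∂(_root_.stdGaussian d) := by
          refine integral_mono_of_nonneg (ae_of_all _ fun g => by positivity)
            ((hi.const_mul _).add ((hi4.const_mul _).const_mul _)) (ae_of_all _ fun g => ?_)
          have h1 := sum_dCov_sq_le hD hτ x (√ε • g)
          have h2 : ∀ i j, (postCov q0 τ i j x - postCov q0 τ i j (x + √ε • g)) ^ 2
              ≤ 2 * dCov q0 τ i j x (√ε • g) ^ 2 + 2 * (K * ‖√ε • g‖ ^ 2) ^ 2 := by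
            intro i j
            have h3 := sq_le_sq' (abs_le.1 (hKb τ hτ₀ i j x (√ε • g))).1
              (abs_le.1 (hKb τ hτ₀ i j x (√ε • g))).2
            nlinarith [sq_nonneg (dCov q0 τ i j x (√ε • g) - (postCov q0 τ i j (x + √ε • g)
              - postCov q0 τ i j x - dCov q0 τ i j x (√ε • g)))]
          have h4 := Finset.sum_le_sum fun i (_ : i ∈ Finset.univ) =>
            Finset.sum_le_sum fun j (_ : j ∈ Finset.univ) => h2 i j
          refine h4.trans ?_
          simp only [Finset.sum_add_distrib, ← Finset.mul_sum, Finset.sum_const, Finset.card_univ,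
            Fintype.card_fin, nsmul_eq_mul]
          rw [norm_smul, Real.norm_of_nonneg (sqrt_nonneg _)]
          nlinarith [h1]
      _ = 2 * τ⁻¹ ^ 2 * (√ε ^ 2 * gaussMoment 2 *
            ∫ θ, ‖θ - postMean q0 τ x‖ ^ 6 ∂(post q0 τ x))
            + 2 * d ^ 2 * K ^ 2 * (√ε ^ 4 * ∫ g, ‖g‖ ^ 4 ∂(_root_.stdGaussian d)) := by
          rw [integral_add (hi.const_mul _) ((hi4.const_mul _).const_mul _), integral_const_mul,
            integral_const_mul, integral_const_mul, he]
      _ ≤ _ := by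
          gcongr
          exact integral_norm_sub_postMean_pow_six_le hD hτ x
  · rw [integral_add ((((hi6.const_mul _).const_mul _).const_mul _)) (integrable_const _),
      integral_const_mul, integral_const_mul, integral_const_mul, he6, integral_const]
    have e1 : √ε ^ 2 = ε := sq_sqrt hε
    have e2 : √ε ^ 4 = ε ^ 2 := by rw [show √ε ^ 4 = (√ε ^ 2) ^ 2 by ring, e1]
    have e3 : √τ ^ 6 = τ ^ 3 := by rw [show √τ ^ 6 = (√τ ^ 2) ^ 3 by ring, sq_sqrt hτ.le]
    rw [e1, e2, e3]
    have h6 := integral_norm_pow_six_stdGaussian_le hd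
    have e4 : 2 * τ⁻¹ ^ 2 * (ε * gaussMoment 2 * (64 * (τ ^ 3
        * ∫ z, ‖z‖ ^ 6 ∂(_root_.stdGaussian d))))
        = 128 * gaussMoment 2 * τ * ε * ∫ z, ‖z‖ ^ 6 ∂(_root_.stdGaussian d) := by
      field_simp; ring
    rw [e4]
    simp only [probReal_univ, one_smul]
    have h7 : 128 * gaussMoment 2 * τ * ε * ∫ z, ‖z‖ ^ 6 ∂(_root_.stdGaussian d)
        ≤ 128 * gaussMoment 2 * τ * ε * ((1 + gaussMoment 8) * (d : ℝ) ^ 3) := by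
      gcongr
    linarith

lemma exists_integral_postMean_sub_pow_four_le (hD : ∀ᵐ θ ∂q0, ‖θ‖ ≤ D) (h0 : 0 < τ₀) :
    ∃ K, 0 ≤ K ∧ ∀ τ, τ₀ ≤ τ → ∀ ε, 0 ≤ ε →
      ∫ p, ‖postMean q0 τ p.1 - postMean q0 τ (p.1 + √ε • p.2)‖ ^ 4
        ∂((heatLaw q0 τ).prod (_root_.stdGaussian d))
      ≤ 2048 * gaussMoment 4 * gaussMoment 8 * d ^ 4 * ε ^ 2 + K * ε ^ 4 := by
  obtain ⟨K, hK, hKb⟩ := exists_postMean_taylor hD h0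
  have hm8 : 0 ≤ ∫ g, ‖g‖ ^ 8 ∂(_root_.stdGaussian d) := integral_nonneg fun _ => by positivity
  have hg4 := gaussMoment_nonneg (n := 4) (by decide)
  refine ⟨8 * d ^ 2 * K ^ 4 * ∫ g, ‖g‖ ^ 8 ∂(_root_.stdGaussian d), by positivity,
    fun τ hτ₀ ε hε => ?_⟩
  have hτ : 0 < τ := h0.trans_le hτ₀
  have hc := continuous_postMean (τ := τ) hD hτ
  have hf : Integrable (fun p : Vec d × Vec d =>
      ‖postMean q0 τ p.1 - postMean q0 τ (p.1 + √ε • p.2)‖ ^ 4)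
      ((heatLaw q0 τ).prod (_root_.stdGaussian d)) := by
    refine Integrable.of_bound (C := (2 * D) ^ 4) (by fun_prop) (ae_of_all _ fun p => ?_)
    rw [norm_pow, norm_norm]
    gcongr
    have h1 := norm_postMean_le hD hτ p.1
    have h2 := norm_postMean_le hD hτ (p.1 + √ε • p.2)
    refine (norm_sub_le _ _).trans ?_
    linarith
  obtain ⟨hi8, he8⟩ := integral_norm_sub_pow_heatLaw hD hτ 8
  refine (integral_prod_le_of_forall_integral_le hf
    (h := fun x => 8 * τ⁻¹ ^ 4 * (√ε ^ 4 * gaussMoment 4 *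
      (256 * ∫ θ, ‖θ - x‖ ^ 8 ∂(post q0 τ x)))
      + 8 * d ^ 2 * K ^ 4 * (√ε ^ 8 * ∫ g, ‖g‖ ^ 8 ∂(_root_.stdGaussian d)))
    (((((hi8.const_mul _).const_mul _).const_mul _)).add (integrable_const _)) fun x => ?_).trans ?_
  · obtain ⟨hi, he⟩ := integral_gaussian_inner_pow (ε := ε) hD hτ x (postMean q0 τ x) 4
    have hi8 := integrable_norm_pow_stdGaussian d 8
    calc ∫ g, ‖postMean q0 τ x - postMean q0 τ (x + √ε • g)‖ ^ 4 ∂(_root_.stdGaussian d)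
        ≤ ∫ g, (8 * τ⁻¹ ^ 4 * (∫ θ, ‖θ - postMean q0 τ x‖ ^ 4
            * ⟪θ - postMean q0 τ x, √ε • g⟫ ^ 4 ∂(post q0 τ x))
            + 8 * d ^ 2 * K ^ 4 * (√ε ^ 8 * ‖g‖ ^ 8)) ∂(_root_.stdGaussian d) := by
          refine integral_mono_of_nonneg (ae_of_all _ fun g => by positivity)
            ((hi.const_mul _).add ((hi8.const_mul _).const_mul _)) (ae_of_all _ fun g => ?_)
          have h1 := sum_dMean_sq_sq_le hD hτ x (√ε • g)
          have h2 : ∀ i, (postMean q0 τ x - postMean q0 τ (x + √ε • g)) i ^ 2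
              ≤ 2 * dMean q0 τ i x (√ε • g) ^ 2 + 2 * (K * ‖√ε • g‖ ^ 2) ^ 2 := by
            intro i
            have h3 := sq_le_sq' (abs_le.1 (hKb τ hτ₀ i x (√ε • g))).1
              (abs_le.1 (hKb τ hτ₀ i x (√ε • g))).2
            rw [PiLp.sub_apply]
            nlinarith [sq_nonneg (dMean q0 τ i x (√ε • g) - (postMean q0 τ (x + √ε • g) i
              - postMean q0 τ x i - dMean q0 τ i x (√ε • g)))]
          have h4 := Finset.sum_le_sum fun i (_ : i ∈ Finset.univ) => h2 i
          rw [← EuclideanSpace.real_norm_sq_eq] at h4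
          simp only [Finset.sum_add_distrib, ← Finset.mul_sum, Finset.sum_const, Finset.card_univ,
            Fintype.card_fin, nsmul_eq_mul] at h4
          rw [norm_smul, Real.norm_of_nonneg (sqrt_nonneg _)] at h4
          dsimp only
          have h5 := pow_le_pow_left₀ (sq_nonneg _) h4 2
          rw [← pow_mul] at h5
          refine h5.trans ?_
          nlinarith [sq_nonneg (2 * (∑ i, dMean q0 τ i x (√ε • g) ^ 2)
            - (d * (2 * (K * (√ε * ‖g‖) ^ 2) ^ 2)))]
      _ = 8 * τ⁻¹ ^ 4 * (√ε ^ 4 * gaussMoment 4 *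
            ∫ θ, ‖θ - postMean q0 τ x‖ ^ 8 ∂(post q0 τ x))
            + 8 * d ^ 2 * K ^ 4 * (√ε ^ 8 * ∫ g, ‖g‖ ^ 8 ∂(_root_.stdGaussian d)) := by
          rw [integral_add (hi.const_mul _) ((hi8.const_mul _).const_mul _), integral_const_mul,
            integral_const_mul, integral_const_mul, he]
      _ ≤ _ := by
          gcongr
          exact integral_norm_sub_postMean_pow_eight_le hD hτ x
  · rw [integral_add ((((hi8.const_mul _).const_mul _).const_mul _)) (integrable_const _),
      integral_const_mul, integral_const_mul, integral_const_mul, he8, integral_const]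
    have e1 : √ε ^ 2 = ε := sq_sqrt hε
    have e2 : √ε ^ 4 = ε ^ 2 := by rw [show √ε ^ 4 = (√ε ^ 2) ^ 2 by ring, e1]
    have e2' : √ε ^ 8 = ε ^ 4 := by rw [show √ε ^ 8 = (√ε ^ 2) ^ 4 by ring, e1]
    have e3 : √τ ^ 8 = τ ^ 4 := by rw [show √τ ^ 8 = (√τ ^ 2) ^ 4 by ring, sq_sqrt hτ.le]
    rw [e2, e2', e3]
    have h8 := integral_norm_pow_eight_stdGaussian_le d
    have e4 : 8 * τ⁻¹ ^ 4 * (ε ^ 2 * gaussMoment 4 * (256 * (τ ^ 4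
        * ∫ z, ‖z‖ ^ 8 ∂(_root_.stdGaussian d))))
        = 2048 * gaussMoment 4 * ε ^ 2 * ∫ z, ‖z‖ ^ 8 ∂(_root_.stdGaussian d) := by
      field_simp; ring
    rw [e4]
    simp only [probReal_univ, one_smul]
    have h7 : 2048 * gaussMoment 4 * ε ^ 2 * ∫ z, ‖z‖ ^ 8 ∂(_root_.stdGaussian d)
        ≤ 2048 * gaussMoment 4 * ε ^ 2 * (gaussMoment 8 * (d : ℝ) ^ 4) := by
      gcongr
    linarith

end

section

variable {d : ℕ} {q0 : Measure (Vec d)} {D τ τ₀ ε η B : ℝ} [IsProbabilityMeasure q0]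

/-- A bounded measurable function is integrable against a finite measure. -/
lemma integrable_of_measurable_of_abs_le {Ω : Type*} [MeasurableSpace Ω] {μ : Measure Ω}
    [IsFiniteMeasure μ] {f : Ω → ℝ} (hf : Measurable f) (hb : ∃ C, ∀ ω, |f ω| ≤ C) :
    Integrable f μ := by
  obtain ⟨C, hC⟩ := hb
  exact Integrable.of_bound (C := C) hf.aestronglyMeasurable (ae_of_all _ hC)

lemma integral_norm_postMean_sub_pow_four_le (hD : ∀ᵐ θ ∂q0, ‖θ‖ ≤ D) (hτ : 0 < τ) (hε : 0 ≤ ε) :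
    ∫ p, ‖postMean q0 τ p.1 - postMean q0 (τ + ε) (p.1 + √ε • p.2)‖ ^ 4
        ∂((heatLaw q0 τ).prod (_root_.stdGaussian d))
      ≤ 16 * ∫ p, ‖postMean q0 τ p.1 - postMean q0 τ (p.1 + √ε • p.2)‖ ^ 4
        ∂((heatLaw q0 τ).prod (_root_.stdGaussian d)) := by
  have hτε : 0 < τ + ε := by positivity
  have hD0 := nonneg_of_ae_norm_le hD
  have hc := continuous_postMean hD hτ
  have hc' := continuous_postMean hD hτε
  set k : Vec d → Vec d := fun y => postMean q0 (τ + ε) y - postMean q0 τ y with hk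
  have hkc : Continuous k := hc'.sub hc
  have hkb : ∀ y, ‖k y‖ ≤ 2 * D := fun y => by
    have h1 := norm_postMean_le hD hτ y
    have h2 := norm_postMean_le hD hτε y
    have := norm_sub_le (postMean q0 (τ + ε) y) (postMean q0 τ y)
    simp only [hk]; linarith
  have hbb : ∀ x y, ‖postMean q0 τ x - postMean q0 τ y‖ ≤ 2 * D := fun x y => by
    have h1 := norm_postMean_le hD hτ x
    have h2 := norm_postMean_le hD hτ y
    have := norm_sub_le (postMean q0 τ x) (postMean q0 τ y)
    linarith
  set μ := (heatLaw q0 τ).prod (_root_.stdGaussian d) with hμ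
  have hkc2 : Continuous fun p : Vec d × Vec d => k (p.1 + √ε • p.2) := by fun_prop
  have hbc : Continuous fun p : Vec d × Vec d =>
    postMean q0 τ p.1 - postMean q0 τ (p.1 + √ε • p.2) := by fun_prop
  have ib : Integrable (fun p : Vec d × Vec d =>
      ‖postMean q0 τ p.1 - postMean q0 τ (p.1 + √ε • p.2)‖ ^ 4) μ := by
    refine integrable_of_measurable_of_abs_le (by fun_prop) ⟨(2 * D) ^ 4, fun p => ?_⟩
    rw [abs_of_nonneg (by positivity)]
    exact pow_le_pow_left₀ (norm_nonneg _) (hbb _ _) 4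
  have ik : Integrable (fun p : Vec d × Vec d => ‖k (p.1 + √ε • p.2)‖ ^ 4) μ := by
    refine integrable_of_measurable_of_abs_le (by fun_prop) ⟨(2 * D) ^ 4, fun p => ?_⟩
    rw [abs_of_nonneg (by positivity)]
    exact pow_le_pow_left₀ (norm_nonneg _) (hkb _) 4
  have hG : ∀ i y, |k y i * ‖k y‖ ^ 2| ≤ 2 * D * (2 * D) ^ 2 := by
    intro i y
    rw [abs_mul, abs_of_nonneg (sq_nonneg ‖k y‖)]
    have h1 : |k y i| ≤ 2 * D := (PiLp.norm_apply_le (k y) i).trans (hkb y)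
    have h2 := pow_le_pow_left₀ (norm_nonneg _) (hkb y) 2
    exact mul_le_mul h1 h2 (by positivity) (by positivity)
  have horth : ∀ i, ∫ p, (postMean q0 τ p.1 - postMean q0 (τ + ε) (p.1 + √ε • p.2)) i
      * (k (p.1 + √ε • p.2) i * ‖k (p.1 + √ε • p.2)‖ ^ 2) ∂μ = 0 := fun i =>
    integral_pmean_martingale hD hτ hε (bddObs_coord hD i)
      (G := fun y => k y i * ‖k y‖ ^ 2) (by fun_prop) (hG i)
  have hab : ∀ x y, ‖postMean q0 τ x - postMean q0 (τ + ε) y‖ ≤ 2 * D := fun x y => by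
    have h1 := norm_postMean_le hD hτ x
    have h2 := norm_postMean_le hD hτε y
    have := norm_sub_le (postMean q0 τ x) (postMean q0 (τ + ε) y)
    linarith
  have io : ∀ i, Integrable (fun p : Vec d × Vec d =>
      (postMean q0 τ p.1 - postMean q0 (τ + ε) (p.1 + √ε • p.2)) i
      * (k (p.1 + √ε • p.2) i * ‖k (p.1 + √ε • p.2)‖ ^ 2)) μ := by
    intro i
    refine integrable_of_measurable_of_abs_le (by fun_prop)
      ⟨2 * D * (2 * D * (2 * D) ^ 2), fun p => ?_⟩
    rw [abs_mul]
    exact mul_le_mul ((PiLp.norm_apply_le _ i).trans (hab _ _)) (hG i _) (abs_nonneg _)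
      (by positivity)
  have hpt : ∀ p : Vec d × Vec d, ‖k (p.1 + √ε • p.2)‖ ^ 4
      ≤ ‖postMean q0 τ p.1 - postMean q0 τ (p.1 + √ε • p.2)‖ ^ 4
        - 4 * ∑ i, (postMean q0 τ p.1 - postMean q0 (τ + ε) (p.1 + √ε • p.2)) i
      * (k (p.1 + √ε • p.2) i * ‖k (p.1 + √ε • p.2)‖ ^ 2) := by
    intro p
    set y := p.1 + √ε • p.2
    set b := postMean q0 τ p.1 - postMean q0 τ y with hb
    have ha : postMean q0 τ p.1 - postMean q0 (τ + ε) y = b - k y := by simp [hb, hk]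
    have hs : ∑ i, (b - k y) i * (k y i * ‖k y‖ ^ 2) = ⟪b - k y, k y⟫ * ‖k y‖ ^ 2 := by
      rw [PiLp.inner_apply, Finset.sum_mul]
      refine Finset.sum_congr rfl fun i _ => ?_
      simp only [RCLike.inner_apply, conj_trivial]
      ring
    rw [ha, hs, inner_sub_left, real_inner_self_eq_norm_sq]
    have h1 : ⟪b, k y⟫ * ‖k y‖ ^ 2 ≤ ‖b‖ * ‖k y‖ * ‖k y‖ ^ 2 := by
      gcongr; exact real_inner_le_norm _ _
    nlinarith [sq_nonneg (‖b‖ ^ 2 - ‖k y‖ ^ 2), sq_nonneg (‖b‖ * ‖k y‖ - ‖k y‖ ^ 2)]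
  have hkle : ∫ p, ‖k (p.1 + √ε • p.2)‖ ^ 4 ∂μ
      ≤ ∫ p, ‖postMean q0 τ p.1 - postMean q0 τ (p.1 + √ε • p.2)‖ ^ 4 ∂μ := by
    refine (integral_mono ik (ib.sub ((integrable_finsetSum _ fun i _ => io i).const_mul 4))
      hpt).trans_eq ?_
    simp only [Pi.sub_apply]
    rw [integral_sub ib ((integrable_finsetSum _ fun i _ => io i).const_mul 4),
      integral_const_mul, integral_finsetSum _ fun i _ => io i]
    rw [Finset.sum_eq_zero fun i _ => horth i, mul_zero, sub_zero]
  calc _ ≤ ∫ p, 8 * (‖postMean q0 τ p.1 - postMean q0 τ (p.1 + √ε • p.2)‖ ^ 4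
        + ‖k (p.1 + √ε • p.2)‖ ^ 4) ∂μ := by
        refine integral_mono_of_nonneg (ae_of_all _ fun p => by positivity)
          ((ib.add ik).const_mul 8) (ae_of_all _ fun p => ?_)
        have h1 : ‖postMean q0 τ p.1 - postMean q0 (τ + ε) (p.1 + √ε • p.2)‖
            ≤ ‖postMean q0 τ p.1 - postMean q0 τ (p.1 + √ε • p.2)‖ + ‖k (p.1 + √ε • p.2)‖ := by
          refine le_trans (le_of_eq ?_) (norm_sub_le _ _)
          simp [hk]
        refine (pow_le_pow_left₀ (norm_nonneg _) h1 4).trans ?_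
        have := add_pow_le (norm_nonneg (postMean q0 τ p.1 - postMean q0 τ (p.1 + √ε • p.2)))
          (norm_nonneg (k (p.1 + √ε • p.2))) 4
        norm_num at this
        exact this
    _ = 8 * (∫ p, ‖postMean q0 τ p.1 - postMean q0 τ (p.1 + √ε • p.2)‖ ^ 4 ∂μ
        + ∫ p, ‖k (p.1 + √ε • p.2)‖ ^ 4 ∂μ) := by
        rw [integral_const_mul, integral_add ib ik]
    _ ≤ _ := by linarith

/-- The increment of `𝔼[θ_i θ_j | ·]`, corrected by the increments of the conditional means. -/
def covMart (q0 : Measure (Vec d)) (τ τ' : ℝ) (i j : Fin d) (x y : Vec d) : ℝ :=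
  (pmean q0 τ (fun θ => θ i * θ j) x - pmean q0 τ' (fun θ => θ i * θ j) y)
    - (pmean q0 τ (fun θ => θ i) x - pmean q0 τ' (fun θ => θ i) y) * pmean q0 τ' (fun θ => θ j) y
    - (pmean q0 τ (fun θ => θ j) x - pmean q0 τ' (fun θ => θ j) y) * pmean q0 τ' (fun θ => θ i) y

lemma integral_covMart_mul (hD : ∀ᵐ θ ∂q0, ‖θ‖ ≤ D) (hτ : 0 < τ) (hε : 0 ≤ ε) (i j : Fin d)
    {G : Vec d → ℝ} (hG : Measurable G) (hb : ∀ x, |G x| ≤ B) :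
    Integrable (fun p : Vec d × Vec d => covMart q0 τ (τ + ε) i j p.1 (p.1 + √ε • p.2)
      * G (p.1 + √ε • p.2)) ((heatLaw q0 τ).prod (_root_.stdGaussian d)) ∧
    ∫ p, covMart q0 τ (τ + ε) i j p.1 (p.1 + √ε • p.2) * G (p.1 + √ε • p.2)
      ∂((heatLaw q0 τ).prod (_root_.stdGaussian d)) = 0 := by
  have hτε : 0 < τ + ε := by positivity
  have hint : ∀ {F H : Vec d → ℝ} {A C : ℝ}, BddObs q0 F A → Measurable H → (∀ x, |H x| ≤ C) →
      Integrable (fun p : Vec d × Vec d =>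
        (pmean q0 τ F p.1 - pmean q0 (τ + ε) F (p.1 + √ε • p.2)) * H (p.1 + √ε • p.2))
        ((heatLaw q0 τ).prod (_root_.stdGaussian d)) := by
    intro F H A C hF hH hC
    have h1 := measurable_pmean hD hτ hF
    have h2 := measurable_pmean hD hτε hF
    refine integrable_of_measurable_of_abs_le (by fun_prop) ⟨2 * A * C, fun p => ?_⟩
    rw [abs_mul]
    have h3 := abs_pmean_le hD hτ hF p.1
    have h4 := abs_pmean_le hD hτε hF (p.1 + √ε • p.2)
    have h5 := hF.nonneg
    refine mul_le_mul ((abs_sub _ _).trans ?_) (hC _) (abs_nonneg _) (by positivity)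
    linarith
  have hGb : ∀ (l : Fin d) x, |pmean q0 (τ + ε) (fun θ => θ l) x * G x| ≤ D * B := fun l x => by
    rw [abs_mul]
    exact mul_le_mul (abs_pmean_le hD hτε (bddObs_coord hD l) x) (hb x) (abs_nonneg _)
      (nonneg_of_ae_norm_le hD)
  have hGm : ∀ l : Fin d, Measurable fun x => pmean q0 (τ + ε) (fun θ => θ l) x * G x := fun l =>
    (measurable_pmean hD hτε (bddObs_coord hD l)).mul hG
  have hN := (bddObs_coord hD i).mul (bddObs_coord hD j)
  have i1 := hint hN hG hb
  have i2 := hint (bddObs_coord hD i) (hGm j) (hGb j)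
  have i3 := hint (bddObs_coord hD j) (hGm i) (hGb i)
  have e1 := integral_pmean_martingale hD hτ hε hN hG hb
  have e2 := integral_pmean_martingale hD hτ hε (bddObs_coord hD i) (hGm j) (hGb j)
  have e3 := integral_pmean_martingale hD hτ hε (bddObs_coord hD j) (hGm i) (hGb i)
  simp only [covMart, sub_mul _ _ (G _), mul_assoc] at i1 i2 i3 e1 e2 e3 ⊢
  simp only [← sub_mul] at i1 e1 ⊢
  refine ⟨(i1.sub i2).sub i3, ?_⟩
  refine (integral_sub (i1.sub i2) i3).trans ?_
  rw [integral_sub' i1 i2, e1, e2, e3, sub_zero, sub_zero]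

lemma integral_sum_sub_postCov_sq_le (hD : ∀ᵐ θ ∂q0, ‖θ‖ ≤ D) (hτ : 0 < τ) (hε : 0 ≤ ε) (hη : 0 < η)
    {c : Fin d → Fin d → Vec d → ℝ} (hc : ∀ i j, Measurable (c i j))
    (hb : ∀ i j x, |c i j x| ≤ B) :
    ∫ p, ∑ i, ∑ j, (c i j (p.1 + √ε • p.2) - postCov q0 τ i j p.1) ^ 2
        ∂((heatLaw q0 τ).prod (_root_.stdGaussian d))
      ≤ (1 + η) * ∫ p, ∑ i, ∑ j, (c i j (p.1 + √ε • p.2)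
          - postCov q0 (τ + ε) i j (p.1 + √ε • p.2)) ^ 2
          ∂((heatLaw q0 τ).prod (_root_.stdGaussian d))
        + 4 * ∫ p, ∑ i, ∑ j, (postCov q0 τ i j p.1 - postCov q0 τ i j (p.1 + √ε • p.2)) ^ 2
          ∂((heatLaw q0 τ).prod (_root_.stdGaussian d))
        + (6 + η⁻¹) * ∫ p, ‖postMean q0 τ p.1 - postMean q0 (τ + ε) (p.1 + √ε • p.2)‖ ^ 4
          ∂((heatLaw q0 τ).prod (_root_.stdGaussian d)) := by
  have hτε : 0 < τ + ε := by positivity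
  have hC := fun i j => (continuous_postCov hD hτ i j).measurable
  have hC' := fun i j => (continuous_postCov hD hτε i j).measurable
  have hm := (continuous_postMean hD hτ).measurable
  have hm' := (continuous_postMean hD hτε).measurable
  set μ := (heatLaw q0 τ).prod (_root_.stdGaussian d) with hμ
  have hsq : ∀ {u v M N : ℝ}, |u| ≤ M → |v| ≤ N → |(u - v) ^ 2| ≤ (M + N) ^ 2 := by
    intro u v M N hu hv
    rw [abs_pow]
    exact pow_le_pow_left₀ (abs_nonneg _) ((abs_sub _ _).trans (add_le_add hu hv)) 2
  have iA : Integrable (fun p : Vec d × Vec d => ∑ i, ∑ j, (c i j (p.1 + √ε • p.2)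
      - postCov q0 (τ + ε) i j (p.1 + √ε • p.2)) ^ 2) μ :=
    integrable_finsetSum _ fun i _ => integrable_finsetSum _ fun j _ =>
      integrable_of_measurable_of_abs_le (by fun_prop)
        ⟨_, fun p => hsq (hb i j _) (abs_postCov_le hD hτε i j _)⟩
  have iΔ : Integrable (fun p : Vec d × Vec d => ∑ i, ∑ j, (postCov q0 τ i j p.1
      - postCov q0 τ i j (p.1 + √ε • p.2)) ^ 2) μ :=
    integrable_finsetSum _ fun i _ => integrable_finsetSum _ fun j _ =>
      integrable_of_measurable_of_abs_le (by fun_prop)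
        ⟨_, fun p => hsq (abs_postCov_le hD hτ i j _) (abs_postCov_le hD hτ i j _)⟩
  have ia : Integrable (fun p : Vec d × Vec d =>
      ‖postMean q0 τ p.1 - postMean q0 (τ + ε) (p.1 + √ε • p.2)‖ ^ 4) μ := by
    refine integrable_of_measurable_of_abs_le (by fun_prop) ⟨(D + D) ^ 4, fun p => ?_⟩
    rw [abs_of_nonneg (by positivity)]
    exact pow_le_pow_left₀ (norm_nonneg _) ((norm_sub_le _ _).trans
      (add_le_add (norm_postMean_le hD hτ _) (norm_postMean_le hD hτε _))) 4
  let G : Fin d → Fin d → Vec d → ℝ := fun i j y =>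
    4 * (postCov q0 τ i j y - postCov q0 (τ + ε) i j y)
      - 2 * (c i j y - postCov q0 (τ + ε) i j y)
  have hGm : ∀ i j, Measurable (G i j) := fun i j => by fun_prop
  have hGb : ∀ i j y, |G i j y| ≤ 4 * (2 * D ^ 2 + 2 * D ^ 2) + 2 * (B + 2 * D ^ 2) := by
    intro i j y
    have h1 := abs_le.1 (abs_postCov_le hD hτ i j y)
    have h2 := abs_le.1 (abs_postCov_le hD hτε i j y)
    have h3 := abs_le.1 (hb i j y)
    refine abs_le.2 ⟨?_, ?_⟩ <;> simp only [G] <;> linarith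
  have hW := fun i j => integral_covMart_mul hD hτ hε i j (hGm i j) (hGb i j)
  have iW := integrable_finsetSum Finset.univ fun i (_ : i ∈ Finset.univ) =>
    integrable_finsetSum Finset.univ fun j (_ : j ∈ Finset.univ) => (hW i j).1
  have hpt : ∀ p : Vec d × Vec d,
      ∑ i, ∑ j, (c i j (p.1 + √ε • p.2) - postCov q0 τ i j p.1) ^ 2
      ≤ (1 + η) * (∑ i, ∑ j, (c i j (p.1 + √ε • p.2)
          - postCov q0 (τ + ε) i j (p.1 + √ε • p.2)) ^ 2)
        + 4 * (∑ i, ∑ j, (postCov q0 τ i j p.1 - postCov q0 τ i j (p.1 + √ε • p.2)) ^ 2)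
        + (6 + η⁻¹) * ‖postMean q0 τ p.1 - postMean q0 (τ + ε) (p.1 + √ε • p.2)‖ ^ 4
        + ∑ i, ∑ j, covMart q0 τ (τ + ε) i j p.1 (p.1 + √ε • p.2) * G i j (p.1 + √ε • p.2) := by
    intro p
    set y := p.1 + √ε • p.2
    set a := postMean q0 τ p.1 - postMean q0 (τ + ε) y with ha
    have h4 : ‖a‖ ^ 4 = ∑ i, ∑ j, (a i * a j) ^ 2 := by
      have : ‖a‖ ^ 4 = ‖a‖ ^ 2 * ‖a‖ ^ 2 := by ring
      rw [this, EuclideanSpace.real_norm_sq_eq, Finset.sum_mul_sum]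
      simp only [mul_pow]
    rw [h4]
    simp only [Finset.mul_sum, ← Finset.sum_add_distrib]
    refine Finset.sum_le_sum fun i _ => Finset.sum_le_sum fun j _ => ?_
    have hai : a i = pmean q0 τ (fun θ => θ i) p.1 - pmean q0 (τ + ε) (fun θ => θ i) y := rfl
    have haj : a j = pmean q0 τ (fun θ => θ j) p.1 - pmean q0 (τ + ε) (fun θ => θ j) y := rfl
    have key : covMart q0 τ (τ + ε) i j p.1 y
        = a i * a j + postCov q0 τ i j p.1 - postCov q0 (τ + ε) i j y := by
      rw [hai, haj, covMart, postCov, postCov]; ring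
    rw [key]
    simp only [G]
    generalize a i * a j = q
    generalize postCov q0 τ i j p.1 = C
    generalize postCov q0 (τ + ε) i j y = C'
    generalize postCov q0 τ i j y = E
    generalize c i j y = z
    have h5 : 2 * (z - C') * q ≤ η * (z - C') ^ 2 + η⁻¹ * q ^ 2 := by
      have h6 : η * (z - C') ^ 2 + η⁻¹ * q ^ 2 - 2 * (z - C') * q
          = η * ((z - C') - η⁻¹ * q) ^ 2 := by field_simp; ring
      nlinarith [mul_nonneg hη.le (sq_nonneg ((z - C') - η⁻¹ * q))]
    nlinarith [sq_nonneg (q + (q + C - C')), sq_nonneg (q - (C - E)), sq_nonneg (E - C')]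
  refine (integral_mono_of_nonneg (ae_of_all _ fun p => by positivity)
    ((((iA.const_mul (1 + η)).add (iΔ.const_mul 4)).add (ia.const_mul (6 + η⁻¹))).add iW)
    (ae_of_all _ hpt)).trans_eq ?_
  refine (integral_add (((iA.const_mul (1 + η)).add (iΔ.const_mul 4)).add
    (ia.const_mul (6 + η⁻¹))) iW).trans ?_
  rw [integral_add' ((iA.const_mul (1 + η)).add (iΔ.const_mul 4)) (ia.const_mul (6 + η⁻¹)),
    integral_add' (iA.const_mul (1 + η)) (iΔ.const_mul 4), integral_const_mul, integral_const_mul,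
    integral_const_mul]
  have : ∫ p, ∑ i, ∑ j, covMart q0 τ (τ + ε) i j p.1 (p.1 + √ε • p.2) * G i j (p.1 + √ε • p.2) ∂μ
      = 0 := by
    rw [integral_finsetSum _ fun i _ => integrable_finsetSum _ fun j _ => (hW i j).1]
    refine Finset.sum_eq_zero fun i _ => ?_
    rw [integral_finsetSum _ fun j _ => (hW i j).1]
    exact Finset.sum_eq_zero fun j _ => (hW i j).2
  rw [this, add_zero]

end

section

variable {d : ℕ} {q0 : Measure (Vec d)} {D τ τ₀ δ ε η B : ℝ} [IsProbabilityMeasure q0]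

/-- Mean-square increment of the posterior covariance between times `τ` and `τ + δ`. -/
def covIncr (q0 : Measure (Vec d)) (τ δ : ℝ) : ℝ :=
  ∫ p, ∑ i, ∑ j, (postCov q0 (τ + δ) i j (p.1 + √δ • p.2) - postCov q0 τ i j p.1) ^ 2
    ∂((heatLaw q0 τ).prod (_root_.stdGaussian d))

lemma covIncr_zero (q0 : Measure (Vec d)) (τ : ℝ) : covIncr q0 τ 0 = 0 := by
  simp [covIncr]

lemma abs_sum_sum_sq_sub_le {f g : Fin d → Fin d → ℝ} {M : ℝ} (hf : ∀ i j, |f i j| ≤ M)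
    (hg : ∀ i j, |g i j| ≤ M) :
    |∑ i, ∑ j, (f i j - g i j) ^ 2| ≤ ∑ _i : Fin d, ∑ _j : Fin d, (M + M) ^ 2 := by
  rw [abs_of_nonneg (by positivity)]
  refine Finset.sum_le_sum fun i _ => Finset.sum_le_sum fun j _ => ?_
  rw [← sq_abs]
  exact pow_le_pow_left₀ (abs_nonneg _) ((abs_sub _ _).trans (add_le_add (hf i j) (hg i j))) 2

lemma covIncr_add_le (hD : ∀ᵐ θ ∂q0, ‖θ‖ ≤ D) (hτ : 0 < τ) (hε : 0 ≤ ε) (hδ : 0 ≤ δ)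
    (hη : 0 < η) :
    covIncr q0 τ (ε + δ) ≤ (1 + η) * covIncr q0 (τ + ε) δ
        + 4 * ∫ p, ∑ i, ∑ j, (postCov q0 τ i j p.1 - postCov q0 τ i j (p.1 + √ε • p.2)) ^ 2
          ∂((heatLaw q0 τ).prod (_root_.stdGaussian d))
        + (6 + η⁻¹) * ∫ p, ‖postMean q0 τ p.1 - postMean q0 (τ + ε) (p.1 + √ε • p.2)‖ ^ 4
          ∂((heatLaw q0 τ).prod (_root_.stdGaussian d)) := by
  have hτε : 0 < τ + ε := by positivity
  have hτεδ : 0 < τ + ε + δ := by positivity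
  have hC := fun i j => (continuous_postCov hD hτ i j).measurable
  have hC' := fun i j => (continuous_postCov hD hτε i j).measurable
  have hC'' := fun i j => (continuous_postCov hD hτεδ i j).measurable
  have hb := fun i j => abs_postCov_le hD hτ i j
  have hb' := fun i j => abs_postCov_le hD hτε i j
  have hb'' := fun i j => abs_postCov_le hD hτεδ i j
  set γ := _root_.stdGaussian d with hγ
  set μ := (heatLaw q0 τ).prod γ with hμ
  set R := 4 * ∫ p, ∑ i, ∑ j, (postCov q0 τ i j p.1 - postCov q0 τ i j (p.1 + √ε • p.2)) ^ 2 ∂μ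
    with hR
  set S := (6 + η⁻¹) * ∫ p, ‖postMean q0 τ p.1 - postMean q0 (τ + ε) (p.1 + √ε • p.2)‖ ^ 4 ∂μ
    with hS
  have hstep := fun g : Vec d => integral_sum_sub_postCov_sq_le hD hτ hε hη
    (c := fun i j y => postCov q0 (τ + ε + δ) i j (y + √δ • g)) (fun i j => by fun_prop)
    (fun i j y => hb'' i j _)
  let L : Vec d → Vec d × Vec d → ℝ := fun g p => ∑ i, ∑ j,
    (postCov q0 (τ + ε + δ) i j (p.1 + √ε • p.2 + √δ • g) - postCov q0 τ i j p.1) ^ 2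
  let F : Vec d → Vec d → ℝ := fun g y => ∑ i, ∑ j,
    (postCov q0 (τ + ε + δ) i j (y + √δ • g) - postCov q0 (τ + ε) i j y) ^ 2
  have iL : Integrable (Function.uncurry L) (γ.prod μ) :=
    integrable_of_measurable_of_abs_le (by simp only [Function.uncurry_def, L]; fun_prop)
      ⟨_, fun p => abs_sum_sum_sq_sub_le (fun i j => hb'' i j _) (fun i j => hb i j _)⟩
  have iF' : Integrable (fun q : Vec d × (Vec d × Vec d) => F q.1 (q.2.1 + √ε • q.2.2))
      (γ.prod μ) :=
    integrable_of_measurable_of_abs_le (by simp only [F]; fun_prop)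
      ⟨_, fun p => abs_sum_sum_sq_sub_le (fun i j => hb'' i j _) (fun i j => hb' i j _)⟩
  have iF : Integrable (Function.uncurry F) (γ.prod (heatLaw q0 (τ + ε))) :=
    integrable_of_measurable_of_abs_le (by simp only [Function.uncurry_def, F]; fun_prop)
      ⟨_, fun p => abs_sum_sum_sq_sub_le (fun i j => hb'' i j _) (fun i j => hb' i j _)⟩
  have hmono : ∫ g, ∫ p, L g p ∂μ ∂γ
      ≤ ∫ g, ((1 + η) * ∫ p, F g (p.1 + √ε • p.2) ∂μ) + (R + S) ∂γ := by
    refine integral_mono iL.integral_prod_left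
      ((iF'.integral_prod_left.const_mul _).add (integrable_const _)) fun g => ?_
    have := hstep g
    simp only [L, F]
    linarith
  have hLHS : ∫ g, ∫ p, L g p ∂μ ∂γ = covIncr q0 τ (ε + δ) := by
    rw [integral_integral_swap iL]
    have iL1 := iL.integral_prod_right
    simp only [Function.uncurry_apply_pair] at iL1
    rw [hμ, integral_prod _ iL1, covIncr, integral_prod]
    · refine integral_congr_ae (ae_of_all _ fun x => ?_)
      have := integral_gaussian_add hε hδ (B := ∑ _i : Fin d, ∑ _j : Fin d, (2 * D ^ 2 + 2 * D ^ 2) ^ 2)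
        (G := fun y => ∑ i, ∑ j, (postCov q0 (τ + ε + δ) i j y - postCov q0 τ i j x) ^ 2)
        (by fun_prop) (fun y => abs_sum_sum_sq_sub_le (fun i j => hb'' i j _) (fun i j => hb i j _)) x
      simp only [L, ← add_assoc]
      exact this
    · rw [← add_assoc]
      exact integrable_of_measurable_of_abs_le (by fun_prop)
        ⟨_, fun p => abs_sum_sum_sq_sub_le (fun i j => hb'' i j _) (fun i j => hb i j _)⟩
  have hRHS : ∫ g, ∫ p, F g (p.1 + √ε • p.2) ∂μ ∂γ = covIncr q0 (τ + ε) δ := by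
    have h1 : ∀ g, ∫ p, F g (p.1 + √ε • p.2) ∂μ = ∫ y, F g y ∂(heatLaw q0 (τ + ε)) := fun g => by
      rw [← heatLaw_heatLaw q0 hτ.le hε, heatLaw,
        integral_map (by fun_prop) (by simp only [F]; exact Measurable.aestronglyMeasurable (by fun_prop))]
    simp only [h1]
    rw [integral_integral_swap iF, covIncr, integral_prod]
    exact integrable_of_measurable_of_abs_le (by fun_prop)
        ⟨_, fun p => abs_sum_sum_sq_sub_le (fun i j => hb'' i j _) (fun i j => hb' i j _)⟩
  rw [integral_add (iF'.integral_prod_left.const_mul _) (integrable_const _), integral_const_mul,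
    hLHS, hRHS] at hmono
  simp at hmono
  linarith

/-- Discrete Grönwall bound for the mean-square increment of the posterior covariance. -/
lemma covIncr_le (hd : 1 ≤ d) (hD : ∀ᵐ θ ∂q0, ‖θ‖ ≤ D) (hτ : 0 < τ) (hδ : 0 ≤ δ) :
    covIncr q0 τ δ ≤ rexp 1 * (4 * (128 * gaussMoment 2 * (1 + gaussMoment 8) * d ^ 3) * (τ + δ) * δ
      + 16 * (2048 * gaussMoment 4 * gaussMoment 8 * d ^ 4) * δ ^ 2) := by
  obtain ⟨K, hK0, hK⟩ := exists_integral_postCov_sub_sq_le hd hD hτ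
  obtain ⟨K', hK'0, hK'⟩ := exists_integral_postMean_sub_pow_four_le hD hτ
  set b := 128 * gaussMoment 2 * (1 + gaussMoment 8) * (d : ℝ) ^ 3 with hb
  set a := 2048 * gaussMoment 4 * gaussMoment 8 * (d : ℝ) ^ 4 with ha
  have hb0 : 0 ≤ b := by
    have := gaussMoment_nonneg (n := 2) (by decide)
    have := gaussMoment_nonneg (n := 8) (by decide)
    positivity
  have ha0 : 0 ≤ a := by
    have := gaussMoment_nonneg (n := 4) (by decide)
    have := gaussMoment_nonneg (n := 8) (by decide)
    positivity
  let R : ℝ → ℝ := fun N => 4 * (b * (τ + δ) * (δ / N) + K * (δ / N) ^ 2)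
    + (6 + N) * (16 * (a * (δ / N) ^ 2 + K' * (δ / N) ^ 4))
  have hind : ∀ N : ℕ, 0 < N → ∀ n : ℕ, n ≤ N →
      covIncr q0 (τ + (N - n) * (δ / N)) (n * (δ / N)) ≤ (1 + (N : ℝ)⁻¹) ^ n * (n * R N) := by
    intro N hN n
    have hN' : (0 : ℝ) < N := by exact_mod_cast hN
    have hR0 : 0 ≤ R N := by simp only [R]; positivity
    have hε : 0 ≤ δ / N := by positivity
    induction n with
    | zero => intro _; simp [covIncr_zero]
    | succ n ih =>
      intro hn
      have hn' : ((n : ℝ) + 1) ≤ N := by exact_mod_cast hn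
      have ih := ih (by omega)
      have hnn : 0 ≤ ((N : ℝ) - (n + 1)) * (δ / N) := mul_nonneg (by linarith) hε
      have hτ1 : τ ≤ τ + ((N : ℝ) - (n + 1)) * (δ / N) := by linarith
      have hτ2 : τ + ((N : ℝ) - (n + 1)) * (δ / N) ≤ τ + δ := by
        have : (N : ℝ) * (δ / N) = δ := by field_simp
        have h3 : 0 ≤ ((n : ℝ) + 1) * (δ / N) := by positivity
        linarith
      have hstep := covIncr_add_le hD (hτ.trans_le hτ1) hε (δ := n * (δ / N)) (by positivity)
        (inv_pos.2 hN')
      have h1 := hK _ hτ1 _ hε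
      have h2 := (integral_norm_postMean_sub_pow_four_le hD (hτ.trans_le hτ1) hε).trans
        (mul_le_mul_of_nonneg_left (hK' _ hτ1 _ hε) (by norm_num : (0 : ℝ) ≤ 16))
      rw [inv_inv] at hstep
      have e1 : ((n + 1 : ℕ) : ℝ) * (δ / N) = δ / N + n * (δ / N) := by push_cast; ring
      have e2 : τ + ((N : ℝ) - (n + 1)) * (δ / N) + δ / N = τ + (N - n) * (δ / N) := by ring
      rw [e1, Nat.cast_succ]
      rw [e2] at hstep h2
      have h3 : b * (τ + ((N : ℝ) - (n + 1)) * (δ / N)) * (δ / N) ≤ b * (τ + δ) * (δ / N) := by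
        gcongr
      have h4 := mul_le_mul_of_nonneg_left h2 (by positivity : (0 : ℝ) ≤ 6 + N)
      have h5 := mul_le_mul_of_nonneg_left ih (by positivity : (0 : ℝ) ≤ 1 + (N : ℝ)⁻¹)
      have h6 : (1 : ℝ) ≤ (1 + (N : ℝ)⁻¹) ^ (n + 1) :=
        one_le_pow₀ (by have : (0 : ℝ) ≤ (N : ℝ)⁻¹ := by positivity
                        linarith)
      have h7 := mul_le_mul_of_nonneg_right h6 hR0
      have h8 : (1 + (N : ℝ)⁻¹) ^ (n + 1) * ((n + 1) * R N)
          = (1 + (N : ℝ)⁻¹) * ((1 + (N : ℝ)⁻¹) ^ n * (n * R N)) + (1 + (N : ℝ)⁻¹) ^ (n + 1) * R N := by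
        rw [pow_succ]; ring
      have h9 : R N = 4 * (b * (τ + δ) * (δ / N) + K * (δ / N) ^ 2)
        + (6 + N) * (16 * (a * (δ / N) ^ 2 + K' * (δ / N) ^ 4)) := rfl
      rw [h8]
      linarith
  have hN : ∀ N : ℕ, covIncr q0 τ δ ≤ rexp 1 * (((N : ℝ) + 1) * R ((N : ℝ) + 1)) := by
    intro N
    have h := hind (N + 1) (by omega) (N + 1) le_rfl
    have hN' : (0 : ℝ) < (N : ℝ) + 1 := by positivity
    push_cast at h
    rw [sub_self, zero_mul, add_zero, mul_div_cancel₀ _ hN'.ne'] at h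
    refine h.trans ?_
    have hR0 : 0 ≤ R ((N : ℝ) + 1) := by simp only [R]; positivity
    refine mul_le_mul_of_nonneg_right ?_ (by positivity)
    have h1 := Real.add_one_le_exp ((N : ℝ) + 1)⁻¹
    calc (1 + ((N : ℝ) + 1)⁻¹) ^ (N + 1) ≤ rexp ((N : ℝ) + 1)⁻¹ ^ (N + 1) :=
          pow_le_pow_left₀ (by positivity) (by linarith) _
      _ = rexp 1 := by
        rw [← Real.exp_nat_mul]
        push_cast
        rw [mul_inv_cancel₀ hN'.ne']
  have hlim : Filter.Tendsto (fun N : ℕ => rexp 1 * (((N : ℝ) + 1) * R ((N : ℝ) + 1))) Filter.atTop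
      (nhds (rexp 1 * (4 * b * (τ + δ) * δ + 16 * a * δ ^ 2))) := by
    have hu : Filter.Tendsto (fun N : ℕ => 1 / ((N : ℝ) + 1)) Filter.atTop (nhds 0) :=
      tendsto_one_div_add_atTop_nhds_zero_nat
    have hcont : Continuous fun u : ℝ => rexp 1 * (4 * (b * (τ + δ) * δ + K * δ ^ 2 * u)
        + (6 * u + 1) * (16 * (a * δ ^ 2 + K' * δ ^ 4 * u ^ 2))) := by fun_prop
    have := (hcont.tendsto 0).comp hu
    convert this using 1
    · funext N
      have hN' : (0 : ℝ) < (N : ℝ) + 1 := by positivity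
      simp only [Function.comp, R]
      field_simp
    · congr 1; ring
  have := ge_of_tendsto' hlim hN
  exact this

end

lemma dMean_single {d : ℕ} (q0 : Measure (Vec d)) (τ : ℝ) (i j : Fin d) (x : Vec d) :
    dMean q0 τ i x (EuclideanSpace.single j 1) = τ⁻¹ * postCov q0 τ i j x := by
  simp [dMean, postCov, EuclideanSpace.inner_single_right]

section

variable {d : ℕ} {q0 : Measure (Vec d)} {D τ s : ℝ} [IsProbabilityMeasure q0]

/-- The heat-flow time corresponding to Ornstein–Uhlenbeck time `s`. -/
def heatTime (s : ℝ) : ℝ := rexp (2 * s) - 1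

lemma heatTime_pos (hs : 0 < s) : 0 < heatTime s :=
  sub_pos.2 (Real.one_lt_exp_iff.2 (by linarith))

lemma exp_neg_mul_sqrt_heatTime (s : ℝ) : rexp (-s) * √(heatTime s) = √(1 - rexp (-2 * s)) := by
  have h : 1 - rexp (-2 * s) = rexp (-s) ^ 2 * heatTime s := by
    rw [heatTime, mul_sub, ← Real.exp_nat_mul, ← Real.exp_add]
    push_cast
    ring_nf
    rw [Real.exp_zero]; ring
  rw [h, Real.sqrt_mul (by positivity), Real.sqrt_sq (Real.exp_pos _).le]

lemma forwardLaw_eq_map (q0 : Measure (Vec d)) [IsProbabilityMeasure q0] (s : ℝ) :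
    forwardLaw q0 s = (heatLaw q0 (heatTime s)).map (rexp (-s) • ·) := by
  rw [heatLaw, Measure.map_map (by fun_prop) (by fun_prop), forwardLaw]
  congr 1
  funext p
  simp only [Function.comp, smul_add, smul_smul, exp_neg_mul_sqrt_heatTime]

lemma continuous_heatDensity (hD : ∀ᵐ θ ∂q0, ‖θ‖ ≤ D) (hτ : 0 < τ) :
    Continuous (heatDensity q0 τ) := by
  have h1 : Continuous (expMoment q0 τ fun _ => 1) := continuous_iff_continuousAt.2 fun x => by
    obtain ⟨L, hL, -⟩ := hasFDerivAt_expMoment hD hτ bddObs_one x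
    exact hL.continuousAt
  have h2 : Continuous (gaussDensity d τ) := by unfold gaussDensity; fun_prop
  exact h2.mul h1

lemma heatDensity_pos (hD : ∀ᵐ θ ∂q0, ‖θ‖ ≤ D) (hτ : 0 < τ) (x : Vec d) : 0 < heatDensity q0 τ x :=
  mul_pos (gaussDensity_pos hτ x) (expMoment_one_pos hD hτ x)

lemma exists_forall_eq_mul_heatDensity (hD : ∀ᵐ θ ∂q0, ‖θ‖ ≤ D) (hs : 0 < s) {r : Vec d → ℝ}
    (hr : forwardLaw q0 s = volume.withDensity fun x => ENNReal.ofReal (r x))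
    (hpos : ∀ x, 0 < r x) (hcont : Continuous r) :
    ∃ c > 0, ∀ x, r x = c * heatDensity q0 (heatTime s) (rexp s • x) := by
  have hτ := heatTime_pos hs
  have hc := continuous_heatDensity hD hτ
  set c := |((rexp (-s)) ^ Module.finrank ℝ (Vec d))⁻¹| with hcdef
  have hcpos : 0 < c := by positivity
  refine ⟨c, hcpos, fun x => ?_⟩
  have hm : forwardLaw q0 s = volume.withDensity fun x =>
      ENNReal.ofReal (c * heatDensity q0 (heatTime s) (rexp s • x)) := by
    refine Measure.ext_of_lintegral _ fun f hf => ?_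
    rw [forwardLaw_eq_map, heatLaw_eq_withDensity hD hτ, lintegral_map hf (by fun_prop),
      lintegral_withDensity_eq_lintegral_mul _ (by fun_prop) (by fun_prop),
      lintegral_withDensity_eq_lintegral_mul _ (by fun_prop) (by fun_prop)]
    have h1 : ∀ y : Vec d, rexp s • rexp (-s) • y = y := fun y => by
      rw [smul_smul, ← Real.exp_add]; simp
    have h2 : ∫⁻ y, ENNReal.ofReal (heatDensity q0 (heatTime s) y) * f (rexp (-s) • y)
        = ∫⁻ x, ENNReal.ofReal (heatDensity q0 (heatTime s) (rexp s • x)) * f x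
          ∂(Measure.map (rexp (-s) • ·) (volume : Measure (Vec d))) := by
      rw [lintegral_map (by fun_prop) (by fun_prop)]
      simp only [h1]
    simp only [Pi.mul_apply]
    rw [h2, Measure.map_addHaar_smul _ (Real.exp_pos _).ne', lintegral_smul_measure,
      smul_eq_mul, ← lintegral_const_mul _ (by fun_prop)]
    refine lintegral_congr fun y => ?_
    rw [ENNReal.ofReal_mul hcpos.le, mul_assoc]
  rw [hr, withDensity_eq_iff_of_sigmaFinite (by fun_prop) (by fun_prop)] at hm
  have hae : r =ᵐ[volume] fun x => c * heatDensity q0 (heatTime s) (rexp s • x) := by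
    filter_upwards [hm] with y hy
    exact (ENNReal.ofReal_eq_ofReal_iff (hpos y).le
      (mul_pos hcpos (heatDensity_pos hD hτ _)).le).1 hy
  exact congrFun ((Continuous.ae_eq_iff_eq volume hcont (by fun_prop)).1 hae) x

lemma pd_log_heatDensity (hD : ∀ᵐ θ ∂q0, ‖θ‖ ≤ D) (hτ : 0 < τ) (j : Fin d) (y : Vec d) :
    pd j (fun y => Real.log (heatDensity q0 τ y)) y
      = τ⁻¹ * (pmean q0 τ (fun θ => θ j) y - y j) := by
  obtain ⟨L, hL, hLv⟩ := hasFDerivAt_expMoment hD hτ bddObs_one y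
  have hpos := expMoment_one_pos hD hτ y
  have hfun : (fun y => Real.log (heatDensity q0 τ y)) = fun y =>
      Real.log (((π / (2 * τ)⁻¹) ^ ((d : ℝ) / 2))⁻¹) + -(2 * τ)⁻¹ * ‖y‖ ^ 2
        + Real.log (expMoment q0 τ (fun _ => 1) y) := by
    funext z
    rw [heatDensity, gaussDensity, Real.log_mul (by positivity) (expMoment_one_pos hD hτ z).ne',
      Real.log_mul (by positivity) (Real.exp_pos _).ne', Real.log_exp]
  have h := (((hasStrictFDerivAt_norm_sq y).hasFDerivAt.const_mul (-(2 * τ)⁻¹)).const_add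
    (Real.log (((π / (2 * τ)⁻¹) ^ ((d : ℝ) / 2))⁻¹))).add (hL.log hpos.ne')
  have h' : HasFDerivAt (fun y => Real.log (heatDensity q0 τ y)) _ y :=
    h.congr_of_eventuallyEq (Filter.Eventually.of_forall (congrFun hfun))
  rw [pd, h'.fderiv, pmean_eq_div]
  simp [hLv, expMoment, EuclideanSpace.inner_single_right]
  field_simp
  ring

lemma pd_comp_smul (i : Fin d) (f : Vec d → ℝ) (a : ℝ) (x : Vec d) :
    pd i (fun y => f (a • y)) x = a * pd i f (a • x) := by
  rw [pd, fderiv_comp_smul, pd]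
  simp

lemma pd_pd_log_density (hD : ∀ᵐ θ ∂q0, ‖θ‖ ≤ D) (hs : 0 < s) {r : Vec d → ℝ}
    (hr : forwardLaw q0 s = volume.withDensity fun x => ENNReal.ofReal (r x))
    (hpos : ∀ x, 0 < r x) (hcont : Continuous r) (i j : Fin d) (x : Vec d) :
    pd i (pd j fun y => Real.log (r y)) x
      = rexp (2 * s) * ((heatTime s)⁻¹ ^ 2 * postCov q0 (heatTime s) i j (rexp s • x)
        - (heatTime s)⁻¹ * if i = j then 1 else 0) := by
  have hτ := heatTime_pos hs
  obtain ⟨c, hc, hrc⟩ := exists_forall_eq_mul_heatDensity hD hs hr hpos hcont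
  set τ := heatTime s with hτdef
  have h1 : (pd j fun y => Real.log (r y)) = fun x =>
      rexp s * (τ⁻¹ * (pmean q0 τ (fun θ => θ j) (rexp s • x) - (rexp s • x) j)) := by
    funext z
    have : (fun y => Real.log (r y))
        = fun y => Real.log c + Real.log (heatDensity q0 τ (rexp s • y)) := by
      funext y
      rw [hrc, Real.log_mul hc.ne' (heatDensity_pos hD hτ _).ne']
    rw [this, ← pd_log_heatDensity hD hτ j (rexp s • z), ← pd_comp_smul]
    simp only [pd, fderiv_const_add]
  rw [h1, pd_comp_smul i (fun y : Vec d => rexp s * (τ⁻¹ * (pmean q0 τ (fun θ => θ j) y - y j))), pd]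
  obtain ⟨L, hL, hLv⟩ := hasFDerivAt_coord_postMean hD hτ j (rexp s • x)
  have hp : HasFDerivAt (fun y : Vec d => y j) (EuclideanSpace.proj (𝕜 := ℝ) j) (rexp s • x) :=
    (EuclideanSpace.proj (𝕜 := ℝ) j).hasFDerivAt
  have h2 := ((hL.sub hp).const_mul τ⁻¹).const_mul (rexp s)
  rw [show (fun y : Vec d => rexp s * (τ⁻¹ * (pmean q0 τ (fun θ => θ j) y - y j)))
    = fun y => rexp s * (τ⁻¹ * ((pmean q0 τ (fun θ => θ j)) - fun y : Vec d => y j) y) from rfl,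
    h2.fderiv]
  have h4 : postCov q0 τ j i (rexp s • x) = postCov q0 τ i j (rexp s • x) := by
    simp only [postCov, mul_comm]
  have h5 : rexp (2 * s) = rexp s * rexp s := by rw [← Real.exp_add]; ring_nf
  have h6 : (if j = i then (1 : ℝ) else 0) = if i = j then 1 else 0 := by simp only [eq_comm]
  simp [hLv, dMean_single, h4, h5, h6]
  split_ifs <;> ring

end

lemma integral_norm_pow_four_stdGaussian_le {d : ℕ} (hd : 1 ≤ d) :
    ∫ z, ‖z‖ ^ 4 ∂(_root_.stdGaussian d) ≤ (1 + gaussMoment 8) * (d : ℝ) ^ 2 := by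
  have hd' : (0 : ℝ) < d := by exact_mod_cast hd
  have hpt : ∀ z : Vec d, ‖z‖ ^ 4 ≤ (d : ℝ) ^ 2 + ((d : ℝ) ^ 2)⁻¹ * ‖z‖ ^ 8 := by
    intro z
    have h1 : 0 < ((d : ℝ) ^ 2)⁻¹ := by positivity
    have h2 : (d : ℝ) ^ 2 * ((d : ℝ) ^ 2)⁻¹ = 1 := by field_simp
    have h3 : (d : ℝ) ^ 2 + ((d : ℝ) ^ 2)⁻¹ * ‖z‖ ^ 8 - 2 * ‖z‖ ^ 4
        = ((d : ℝ) ^ 2)⁻¹ * ((d : ℝ) ^ 2 - ‖z‖ ^ 4) ^ 2 := by field_simp; ring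
    have h4 := mul_nonneg h1.le (sq_nonneg ((d : ℝ) ^ 2 - ‖z‖ ^ 4))
    have h5 : 0 ≤ ‖z‖ ^ 4 := by positivity
    linarith
  have hi := integrable_norm_pow_stdGaussian d
  refine (integral_mono (hi 4) ((integrable_const _).add ((hi 8).const_mul _)) hpt).trans ?_
  simp only [Pi.add_apply]
  rw [integral_add (integrable_const _) ((hi 8).const_mul _), integral_const_mul]
  have h := mul_le_mul_of_nonneg_left (integral_norm_pow_eight_stdGaussian_le d)
    (by positivity : 0 ≤ ((d : ℝ) ^ 2)⁻¹)
  have h2 : ((d : ℝ) ^ 2)⁻¹ * (gaussMoment 8 * (d : ℝ) ^ 4) = gaussMoment 8 * (d : ℝ) ^ 2 := by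
    field_simp
  simp
  linarith

section

variable {d : ℕ} {q0 : Measure (Vec d)} {D τ s h : ℝ} [IsProbabilityMeasure q0]

lemma postCov_eq_integral (hD : ∀ᵐ θ ∂q0, ‖θ‖ ≤ D) (hτ : 0 < τ) (i j : Fin d) (x : Vec d) :
    postCov q0 τ i j x = ∫ θ, (θ - postMean q0 τ x) i * (θ - postMean q0 τ x) j ∂(post q0 τ x) := by
  have h := dMean_eq hD hτ i x (EuclideanSpace.single j 1)
  rw [dMean_single] at h
  have h' := mul_left_cancel₀ (inv_ne_zero hτ.ne') h
  simpa only [EuclideanSpace.inner_single_right, one_mul, conj_trivial] using h'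

lemma integral_sum_postCov_sq_le (hd : 1 ≤ d) (hD : ∀ᵐ θ ∂q0, ‖θ‖ ≤ D) (hτ : 0 < τ) :
    ∫ x, ∑ i, ∑ j, postCov q0 τ i j x ^ 2 ∂(heatLaw q0 τ)
      ≤ 16 * (1 + gaussMoment 8) * d ^ 2 * τ ^ 2 := by
  have hpt : ∀ x, ∑ i, ∑ j, postCov q0 τ i j x ^ 2
      ≤ 2 ^ 4 * ∫ θ, ‖θ - x‖ ^ 4 ∂(post q0 τ x) := by
    intro x
    have hI := fun {F : Vec d → ℝ} => integrable_post_of_continuous (F := F) hD hτ x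
    have := isProbabilityMeasure_post hD hτ x
    refine le_trans ?_ (integral_norm_sub_postMean_pow_le hD hτ x 3)
    set m := postMean q0 τ x with hm
    have h4 : ∀ θ : Vec d, ‖θ - m‖ ^ (3 + 1) = ∑ i, ∑ j, ((θ - m) i * (θ - m) j) ^ 2 := by
      intro θ
      have : ‖θ - m‖ ^ (3 + 1) = ‖θ - m‖ ^ 2 * ‖θ - m‖ ^ 2 := by ring
      rw [this, EuclideanSpace.real_norm_sq_eq, Finset.sum_mul_sum]
      simp only [mul_pow]
    simp only [h4]
    rw [integral_finsetSum _ fun i _ => integrable_finsetSum _ fun j _ => hI (by fun_prop)]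
    refine Finset.sum_le_sum fun i _ => ?_
    rw [integral_finsetSum _ fun j _ => hI (by fun_prop)]
    refine Finset.sum_le_sum fun j _ => ?_
    rw [postCov_eq_integral hD hτ]
    exact sq_integral_le (hI (by fun_prop)) (hI (by fun_prop))
  obtain ⟨hi, he⟩ := integral_norm_sub_pow_heatLaw hD hτ 4
  refine (integral_mono_of_nonneg (ae_of_all _ fun x => by positivity) (hi.const_mul (2 ^ 4))
    (ae_of_all _ hpt)).trans ?_
  rw [integral_const_mul, he]
  have h1 : √τ ^ 4 = τ ^ 2 := by
    rw [show (4 : ℕ) = 2 * 2 from rfl, pow_mul, Real.sq_sqrt hτ.le]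
  rw [h1]
  have h2 := mul_le_mul_of_nonneg_left (integral_norm_pow_four_stdGaussian_le hd)
    (by positivity : 0 ≤ 2 ^ 4 * τ ^ 2)
  linarith

lemma heatTime_add (s h : ℝ) :
    heatTime (s + h) = heatTime s + rexp (2 * (s + h)) * (1 - rexp (-2 * h)) := by
  rw [heatTime, heatTime, mul_sub, ← Real.exp_add]
  ring_nf

/-- Mean-square Hessian increment in terms of the covariance increment. -/
lemma integral_hessian_increment_le (hd : 1 ≤ d) (hD : ∀ᵐ θ ∂q0, ‖θ‖ ≤ D) (hs : 0 < s) (hh : 0 ≤ h)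
    (a a' b b' : ℝ) :
    ∫ p : Vec d × Vec d, ∑ i, ∑ j,
      ((a * postCov q0 (heatTime s) i j (rexp s • p.1) - b * if i = j then 1 else 0)
        - (a' * postCov q0 (heatTime (s + h)) i j (rexp (s + h) • (rexp (-h) • p.1
          + √(1 - rexp (-2 * h)) • p.2)) - b' * if i = j then 1 else 0)) ^ 2
      ∂((forwardLaw q0 s).prod (_root_.stdGaussian d))
    ≤ 3 * (a' ^ 2 * covIncr q0 (heatTime s) (heatTime (s + h) - heatTime s)
      + (a - a') ^ 2 * (16 * (1 + gaussMoment 8) * d ^ 2 * heatTime s ^ 2)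
      + (b - b') ^ 2 * d) := by
  have hτ := heatTime_pos hs
  have hτ' := heatTime_pos (s := s + h) (by linarith)
  have hC := fun i j => continuous_postCov hD hτ i j
  have hC' := fun i j => continuous_postCov hD hτ' i j
  set τ := heatTime s with hτdef
  set τ' := heatTime (s + h) with hτ'def
  have hδ : τ' - τ = rexp (s + h) ^ 2 * (1 - rexp (-2 * h)) := by
    rw [hτ'def, heatTime_add, ← Real.exp_nat_mul]; push_cast; ring
  have hsqrt : √(τ' - τ) = rexp (s + h) * √(1 - rexp (-2 * h)) := by
    rw [hδ, Real.sqrt_mul (by positivity), Real.sqrt_sq (Real.exp_pos _).le]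
  have hprod : (forwardLaw q0 s).prod (_root_.stdGaussian d)
      = ((heatLaw q0 τ).prod (_root_.stdGaussian d)).map
        (Prod.map (rexp (-s) • ·) id) := by
    rw [← Measure.map_prod_map _ _ (by fun_prop) (by fun_prop), Measure.map_id,
      forwardLaw_eq_map]
  rw [hprod, integral_map (by fun_prop) (Measurable.aestronglyMeasurable (by fun_prop))]
  have e1 : ∀ y : Vec d, rexp s • rexp (-s) • y = y := fun y => by
    rw [smul_smul, ← Real.exp_add]; simp
  have e2 : ∀ y g : Vec d, rexp (s + h) • (rexp (-h) • rexp (-s) • y + √(1 - rexp (-2 * h)) • g)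
      = y + √(τ' - τ) • g := fun y g => by
    rw [smul_add, smul_smul, smul_smul, smul_smul, ← Real.exp_add, ← Real.exp_add, hsqrt]
    ring_nf
    simp
  simp only [Prod.map_fst, Prod.map_snd, id, e1, e2]
  set μ := (heatLaw q0 τ).prod (_root_.stdGaussian d) with hμ
  have hb := fun i j => abs_postCov_le hD hτ i j
  have hb' := fun i j => abs_postCov_le hD hτ' i j
  have iΔ : Integrable (fun p : Vec d × Vec d => ∑ i, ∑ j,
      (postCov q0 τ' i j (p.1 + √(τ' - τ) • p.2) - postCov q0 τ i j p.1) ^ 2) μ :=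
    integrable_of_measurable_of_abs_le (by fun_prop)
      ⟨_, fun p => abs_sum_sum_sq_sub_le (fun i j => hb' i j _) (fun i j => hb i j _)⟩
  have iC' : Integrable (fun x : Vec d => ∑ i, ∑ j, postCov q0 τ i j x ^ 2) (heatLaw q0 τ) := by
    refine integrable_of_measurable_of_abs_le (by fun_prop)
      ⟨∑ _i : Fin d, ∑ _j : Fin d, (2 * D ^ 2) ^ 2, fun p => ?_⟩
    rw [abs_of_nonneg (by positivity)]
    refine Finset.sum_le_sum fun i _ => Finset.sum_le_sum fun j _ => ?_
    rw [← sq_abs]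
    exact pow_le_pow_left₀ (abs_nonneg _) (hb i j _) 2
  have iC : Integrable (fun p : Vec d × Vec d => ∑ i, ∑ j, postCov q0 τ i j p.1 ^ 2) μ :=
    iC'.comp_fst _
  have hdelta : ∑ i : Fin d, ∑ j : Fin d, (if i = j then (1 : ℝ) else 0) = d := by simp
  have hpt : ∀ p : Vec d × Vec d, ∑ i, ∑ j,
      ((a * postCov q0 τ i j p.1 - b * if i = j then 1 else 0)
        - (a' * postCov q0 τ' i j (p.1 + √(τ' - τ) • p.2) - b' * if i = j then 1 else 0)) ^ 2
      ≤ 3 * a' ^ 2 * (∑ i, ∑ j,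
        (postCov q0 τ' i j (p.1 + √(τ' - τ) • p.2) - postCov q0 τ i j p.1) ^ 2)
        + 3 * (a - a') ^ 2 * (∑ i, ∑ j, postCov q0 τ i j p.1 ^ 2) + 3 * (b - b') ^ 2 * d := by
    intro p
    rw [← hdelta]
    simp only [Finset.mul_sum, ← Finset.sum_add_distrib]
    refine Finset.sum_le_sum fun i _ => Finset.sum_le_sum fun j _ => ?_
    generalize postCov q0 τ i j p.1 = x
    generalize postCov q0 τ' i j _ = y
    have key : ∀ u v w : ℝ, (u + v + w) ^ 2 ≤ 3 * u ^ 2 + 3 * v ^ 2 + 3 * w ^ 2 := fun u v w => by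
      nlinarith [sq_nonneg (u - v), sq_nonneg (v - w), sq_nonneg (u - w)]
    have := key (a' * (x - y)) ((a - a') * x) (-(b - b') * if i = j then 1 else 0)
    split_ifs at this ⊢ <;> nlinarith
  refine (integral_mono_of_nonneg (ae_of_all _ fun p => by positivity)
    (((iΔ.const_mul _).add (iC.const_mul _)).add (integrable_const _)) (ae_of_all _ hpt)).trans ?_
  refine (integral_add ((iΔ.const_mul _).add (iC.const_mul _)) (integrable_const _)).trans_le ?_
  rw [integral_add' (iΔ.const_mul _) (iC.const_mul _), integral_const_mul, integral_const_mul,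
    integral_const, probReal_univ, one_smul]
  have h1 : ∫ p : Vec d × Vec d, ∑ i, ∑ j, postCov q0 τ i j p.1 ^ 2 ∂μ
      = ∫ x, ∑ i, ∑ j, postCov q0 τ i j x ^ 2 ∂(heatLaw q0 τ) := by
    rw [hμ, integral_prod _ iC]
    simp
  have h2 := mul_le_mul_of_nonneg_left (integral_sum_postCov_sq_le hd hD hτ)
    (by positivity : 0 ≤ 3 * (a - a') ^ 2)
  have h3 : covIncr q0 τ (τ' - τ) = ∫ p, ∑ i, ∑ j,
      (postCov q0 τ' i j (p.1 + √(τ' - τ) • p.2) - postCov q0 τ i j p.1) ^ 2 ∂μ := by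
    rw [covIncr, add_sub_cancel]
  rw [h1, h3]
  linarith

end

lemma min_one_sq_le {s : ℝ} (hs : 0 < s) : min 1 (s ^ 2) ≤ 3 / 2 * (1 - rexp (-2 * s)) := by
  have h1 : rexp (-2 * s) ≤ (1 + 2 * s)⁻¹ := by
    rw [neg_mul, Real.exp_neg]
    exact inv_anti₀ (by positivity) (by have := Real.add_one_le_exp (2 * s); linarith)
  have h2 : min 1 (s ^ 2) * (1 + 2 * s) ≤ 3 * s := by
    rcases le_total s 1 with h | h
    · have := mul_le_mul_of_nonneg_right (min_le_right 1 (s ^ 2)) (by positivity : 0 ≤ 1 + 2 * s)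
      nlinarith [mul_nonneg hs.le (sub_nonneg.2 h)]
    · have := mul_le_mul_of_nonneg_right (min_le_left 1 (s ^ 2)) (by positivity : 0 ≤ 1 + 2 * s)
      linarith
  have h3 : min 1 (s ^ 2) ≤ 3 * s / (1 + 2 * s) := (le_div_iff₀ (by positivity)).2 h2
  have h4 : 3 * s / (1 + 2 * s) = 3 / 2 * (1 - (1 + 2 * s)⁻¹) := by field_simp; ring
  linarith

/-- Elementary bounds on the coefficients of the Hessian and on their increments. -/
lemma coefficient_bounds {τ δ h w : ℝ} (hτ : 0 < τ) (hδ : 0 ≤ δ) (hh : δ ≤ 2 * h * (τ + δ + 1))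
    (hw : (τ + 1) * τ⁻¹ ≤ w) :
    ((τ + δ + 1) * (τ + δ)⁻¹ ^ 2) ^ 2 * ((τ + δ) * δ) ≤ 2 * h * w ^ 3 ∧
    ((τ + δ + 1) * (τ + δ)⁻¹ ^ 2) ^ 2 * δ ^ 2 ≤ 4 * h ^ 2 * w ^ 4 ∧
    ((τ + 1) * τ⁻¹ ^ 2 - (τ + δ + 1) * (τ + δ)⁻¹ ^ 2) ^ 2 * τ ^ 2 ≤ 16 * h ^ 2 * w ^ 4 ∧
    ((τ + 1) * τ⁻¹ - (τ + δ + 1) * (τ + δ)⁻¹) ^ 2 ≤ 4 * h ^ 2 * w ^ 4 := by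
  have hτ' : 0 < τ + δ := by positivity
  have hh0 : 0 ≤ h := by
    by_contra hneg
    have : 2 * h * (τ + δ + 1) < 0 := mul_neg_of_neg_of_pos (by linarith) (by linarith)
    linarith
  set r' := (τ + δ + 1) * (τ + δ)⁻¹ with hr'
  set r := (τ + 1) * τ⁻¹ with hr
  have hr0 : 0 < r := by positivity
  have hr'0 : 0 < r' := by positivity
  have hr'r : r' ≤ r := by
    rw [hr, hr', ← div_eq_mul_inv, ← div_eq_mul_inv, div_le_div_iff₀ hτ' hτ]
    linarith
  have hr'w : r' ≤ w := hr'r.trans hw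
  have hw0 : 0 < w := hr0.trans_le hw
  set e := δ * (τ + δ)⁻¹ with he
  have he0 : 0 ≤ e := by positivity
  have her : e ≤ 2 * h * r' := by
    rw [he, hr', ← mul_assoc]
    exact mul_le_mul_of_nonneg_right hh (by positivity)
  have hew : e ≤ 2 * h * w := her.trans (by gcongr)
  have hrew : r * e ≤ w * (2 * h * w) := mul_le_mul hw hew he0 hw0.le
  refine ⟨?_, ?_, ?_, ?_⟩
  · have : ((τ + δ + 1) * (τ + δ)⁻¹ ^ 2) ^ 2 * ((τ + δ) * δ) = r' ^ 2 * e := by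
      rw [hr', he]; field_simp
    rw [this]
    calc r' ^ 2 * e ≤ w ^ 2 * (2 * h * w) := by gcongr
      _ = _ := by ring
  · have : ((τ + δ + 1) * (τ + δ)⁻¹ ^ 2) ^ 2 * δ ^ 2 = r' ^ 2 * e ^ 2 := by
      rw [hr', he]; field_simp
    rw [this]
    calc r' ^ 2 * e ^ 2 ≤ w ^ 2 * (2 * h * w) ^ 2 := by gcongr
      _ = _ := by ring
  · have h1 : ((τ + 1) * τ⁻¹ ^ 2 - (τ + δ + 1) * (τ + δ)⁻¹ ^ 2) * τ
        = e * (τ * (τ + δ) + 2 * τ + δ) * (τ * (τ + δ))⁻¹ := by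
      rw [he]; field_simp; ring
    have h2 : (τ * (τ + δ) + 2 * τ + δ) * (τ * (τ + δ))⁻¹ ≤ 2 * r := by
      rw [hr, ← div_eq_mul_inv, div_le_iff₀ (by positivity)]
      have : 2 * ((τ + 1) * τ⁻¹) * (τ * (τ + δ)) = 2 * (τ + 1) * (τ + δ) := by field_simp
      rw [this]; nlinarith [mul_pos hτ hτ']
    have h3 : e * ((τ * (τ + δ) + 2 * τ + δ) * (τ * (τ + δ))⁻¹) ≤ 4 * h * w ^ 2 :=
      (mul_le_mul_of_nonneg_left h2 he0).trans (by linarith)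
    rw [← mul_pow, h1, mul_assoc]
    calc _ ≤ (4 * h * w ^ 2) ^ 2 := pow_le_pow_left₀ (by positivity) h3 2
      _ = _ := by ring
  · have h1 : r - r' = e * τ⁻¹ := by
      rw [hr, hr', he]; field_simp; ring
    have h2 : τ⁻¹ ≤ r := by
      rw [hr, add_mul, one_mul, mul_inv_cancel₀ hτ.ne']; linarith
    have h3 : e * τ⁻¹ ≤ 2 * h * w ^ 2 :=
      (mul_le_mul_of_nonneg_left h2 he0).trans (by linarith)
    rw [h1]
    calc _ ≤ (2 * h * w ^ 2) ^ 2 := pow_le_pow_left₀ (by positivity) h3 2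
      _ = _ := by ring

lemma exp_two_mul_eq (s : ℝ) : rexp (2 * s) = heatTime s + 1 := by rw [heatTime]; ring

/-- The constant in the Hessian increment bound. -/
def hessianConst : ℝ :=
  3 * (rexp 1 * (8 * (128 * gaussMoment 2 * (1 + gaussMoment 8))
      + 96 * (2048 * gaussMoment 4 * gaussMoment 8))
    + 24 * (16 * (1 + gaussMoment 8)) + 6)

lemma hessianConst_pos : 0 < hessianConst := by
  have := gaussMoment_nonneg (n := 2) (by decide)
  have := gaussMoment_nonneg (n := 4) (by decide)
  have := gaussMoment_nonneg (n := 8) (by decide)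
  unfold hessianConst
  positivity

lemma hessian_increment_coefficient_le {d : ℕ} {q0 : Measure (Vec d)} [IsProbabilityMeasure q0] {D s h v : ℝ}
    (hd : 1 ≤ d) (hD : ∀ᵐ θ ∂q0, ‖θ‖ ≤ D) (hs : 0 < s) (hh : 0 ≤ h) (hv : 0 < v)
    (hvs : v ≤ 1 - rexp (-2 * s)) (hdh : d * h ≤ 3 / 2 * v) :
    3 * ((rexp (2 * (s + h)) * (heatTime (s + h))⁻¹ ^ 2) ^ 2
        * covIncr q0 (heatTime s) (heatTime (s + h) - heatTime s)
      + (rexp (2 * s) * (heatTime s)⁻¹ ^ 2 - rexp (2 * (s + h)) * (heatTime (s + h))⁻¹ ^ 2) ^ 2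
        * (16 * (1 + gaussMoment 8) * d ^ 2 * heatTime s ^ 2)
      + (rexp (2 * s) * (heatTime s)⁻¹ - rexp (2 * (s + h)) * (heatTime (s + h))⁻¹) ^ 2 * d)
    ≤ hessianConst * d ^ 3 * h / v ^ 3 := by
  have hτ := heatTime_pos hs
  have hadd := heatTime_add s h
  rw [exp_two_mul_eq, exp_two_mul_eq] at *
  set τ := heatTime s with hτdef
  set δ := heatTime (s + h) - τ with hδdef
  have hτ' : heatTime (s + h) = τ + δ := by rw [hδdef]; ring
  rw [hτ'] at hadd ⊢
  have hδ : 0 ≤ δ := by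
    have h1 : rexp (-2 * h) ≤ 1 := Real.exp_le_one_iff.2 (by linarith)
    have h2 : 0 < τ + δ + 1 := by rw [← hτ', ← exp_two_mul_eq]; positivity
    have := mul_nonneg h2.le (sub_nonneg.2 h1)
    linarith
  have hδh : δ ≤ 2 * h * (τ + δ + 1) := by
    have h1 := Real.add_one_le_exp (-2 * h)
    have := mul_le_mul_of_nonneg_left (by linarith : 1 - rexp (-2 * h) ≤ 2 * h)
      (by positivity : 0 ≤ τ + δ + 1)
    linarith
  have hw : (τ + 1) * τ⁻¹ ≤ v⁻¹ := by
    have h1 : 1 - rexp (-2 * s) = τ * (τ + 1)⁻¹ := by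
      rw [neg_mul, Real.exp_neg, exp_two_mul_eq, ← hτdef]
      field_simp
      ring
    rw [h1] at hvs
    refine (inv_anti₀ hv hvs).trans_eq' ?_
    rw [mul_inv, inv_inv, mul_comm]
  obtain ⟨h1, h2, h3, h4⟩ := coefficient_bounds hτ hδ hδh hw
  have hg2 := gaussMoment_nonneg (n := 2) (by decide)
  have hg4 := gaussMoment_nonneg (n := 4) (by decide)
  have hg8 := gaussMoment_nonneg (n := 8) (by decide)
  set b := 128 * gaussMoment 2 * (1 + gaussMoment 8) with hb
  set a := 2048 * gaussMoment 4 * gaussMoment 8 with ha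
  set m := 16 * (1 + gaussMoment 8) with hm
  have hb0 : 0 ≤ b := by positivity
  have ha0 : 0 ≤ a := by positivity
  have hm0 : 0 ≤ m := by positivity
  have hd1 : (1 : ℝ) ≤ d := by exact_mod_cast hd
  set w := v⁻¹ with hwdef
  have hw0 : 0 < w := by positivity
  have hdhw : d * h * w ≤ 3 / 2 := by
    rw [hwdef, ← div_eq_mul_inv]; exact (div_le_iff₀ hv).2 hdh
  have hcov := covIncr_le (q0 := q0) hd hD hτ hδ
  set A := (τ + δ + 1) * (τ + δ)⁻¹ ^ 2 with hA
  have k1 : A ^ 2 * covIncr q0 τ δ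
      ≤ rexp 1 * (8 * b + 96 * a) * (d ^ 3 * h * w ^ 3) := by
    have e1 := mul_le_mul_of_nonneg_left hcov (sq_nonneg A)
    have e2 := mul_le_mul_of_nonneg_left h1 (by positivity : 0 ≤ rexp 1 * (4 * b * d ^ 3))
    have e3 := mul_le_mul_of_nonneg_left h2 (by positivity : 0 ≤ rexp 1 * (16 * a * d ^ 4))
    have e4 := mul_le_mul_of_nonneg_left hdhw
      (by positivity : 0 ≤ rexp 1 * 64 * a * (d ^ 3 * h * w ^ 3))
    linarith
  have hdh2 : (d : ℝ) ^ 2 * (h ^ 2 * w ^ 4) ≤ 3 / 2 * (d ^ 3 * h * w ^ 3) := by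
    have e1 := mul_le_mul_of_nonneg_left hdhw (by positivity : 0 ≤ d * h * w ^ 3)
    have e2 : (d : ℝ) * (h * w ^ 3) ≤ d ^ 3 * (h * w ^ 3) := by
      gcongr; exact le_self_pow₀ hd1 (by norm_num)
    linarith
  have hdh1 : (d : ℝ) * (h ^ 2 * w ^ 4) ≤ 3 / 2 * (d ^ 3 * h * w ^ 3) := by
    refine le_trans ?_ hdh2
    gcongr; exact le_self_pow₀ hd1 (by norm_num)
  have k2 := mul_le_mul_of_nonneg_left h3 (by positivity : 0 ≤ m * d ^ 2)
  have k3 := mul_le_mul_of_nonneg_right h4 (by positivity : (0 : ℝ) ≤ d)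
  have k4 := mul_le_mul_of_nonneg_left hdh2 (by positivity : 0 ≤ 16 * m)
  have e5 : hessianConst * d ^ 3 * h / v ^ 3
      = 3 * (rexp 1 * (8 * b + 96 * a) + 24 * m + 6) * (d ^ 3 * h * w ^ 3) := by
    rw [hwdef, inv_pow, hessianConst, ← hb, ← ha, ← hm]; ring
  rw [e5]
  linarith

/-- **Lemma (Hessian increment bound along the reverse process).** Under the bounded-support and
step-size assumptions, for `k < K` and `u ∈ [t_k, t_{k+1}]`, with `Y_u ~ q_{T-u}` and
`Y_{t_k} = e^{-(u - t_k)} Y_u + √(1 - e^{-2(u-t_k)}) g` (`g ~ N(0, I_d)` independent of `Y_u`),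
`E[‖∇² log q_{T-u}(Y_u) - ∇² log q_{T-t_k}(Y_{t_k})‖_F²] ≤ C d³ σ_{T-t_{k+1}}⁻⁶ Δ_k` for
universal constants `c₀, C > 0`. -/
theorem hessian_increment_bound :
    ∃ c₀ > (0:ℝ), ∃ C > (0:ℝ),
    ∀ (d : ℕ), 1 ≤ d →
    ∀ (q0 : Measure (Vec d)), IsProbabilityMeasure q0 →
    (∀ᵐ y ∂q0, ‖y‖ ≤ Real.sqrt d) →
    ∀ (ρ : ℝ → Vec d → ℝ),
    (∀ u, 0 < u → forwardLaw q0 u = volume.withDensity fun x => ENNReal.ofReal (ρ u x)) →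
    (∀ u, 0 < u → ∀ x, 0 < ρ u x) →
    (∀ u, 0 < u → ContDiff ℝ (⊤ : ℕ∞) (ρ u)) →
    ∀ (T : ℝ), 0 < T →
    ∀ (K : ℕ) (t : ℕ → ℝ),
    t 0 = 0 → (∀ k < K, t k < t (k+1)) → t K < T →
    ∀ (κ : ℝ), 0 < κ → κ < 1/4 →
    -- step-size condition
    (∀ k < K, t (k+1) - t k ≤ κ * min 1 ((T - t (k+1))^2)) →
    ((d:ℝ)^2 * κ ≤ c₀) →
    (∀ k < K,
      1.3 * (t (k+1) - t k)
        + (53 * (t (k+1) - t k) + 10 * (t (k+1) - t k)^2)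
          * ((1 - Real.exp (-2*(T - t k)))⁻¹
              + Real.exp (-(T - t k))^2 * ((1 - Real.exp (-2*(T - t k)))^2)⁻¹) * d ≤ 1/2) →
    ∀ k < K, ∀ u ∈ Set.Icc (t k) (t (k+1)),
    ∫ p : Vec d × Vec d,
        ∑ i, ∑ j,
          (pd i (pd j (fun y => Real.log (ρ (T - u) y))) p.1
            - pd i (pd j (fun y => Real.log (ρ (T - t k) y)))
                (Real.exp (-(u - t k)) • p.1
                  + Real.sqrt (1 - Real.exp (-2*(u - t k))) • p.2))^2
      ∂((forwardLaw q0 (T - u)).prod (stdGaussian d))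
      ≤ C * (d:ℝ)^3 * (t (k+1) - t k) / (1 - Real.exp (-2*(T - t (k+1))))^3 := by
  refine ⟨1, one_pos, hessianConst, hessianConst_pos, ?_⟩
  intro d hd q0 hq hD ρ hρ hpos hsmooth T _ K t _ hmono hK κ hκ _ hstep hdκ _ k hk u hu
  have hKk : t (k + 1) ≤ t K := by
    have : ∀ n, k + 1 ≤ n → n ≤ K → t (k + 1) ≤ t n := by
      intro n hn
      induction n, hn using Nat.le_induction with
      | base => intro _; exact le_rfl
      | succ n _ ih => intro hnK; exact (ih (by omega)).trans (hmono n (by omega)).le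
    exact this K hk le_rfl
  have hs₀ : 0 < T - t (k + 1) := by linarith
  have hs : 0 < T - u := by linarith [hu.2]
  have hs' : 0 < T - t k := by linarith [hmono k hk]
  have hh : 0 ≤ u - t k := by linarith [hu.1]
  have hhΔ : u - t k ≤ t (k + 1) - t k := by linarith [hu.2]
  have hv : 0 < 1 - rexp (-2 * (T - t (k + 1))) :=
    sub_pos.2 (Real.exp_lt_one_iff.2 (by linarith))
  have hvs : 1 - rexp (-2 * (T - t (k + 1))) ≤ 1 - rexp (-2 * (T - u)) :=
    sub_le_sub_left (Real.exp_le_exp.2 (by linarith [hu.2])) _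
  have hd1 : (1 : ℝ) ≤ d := by exact_mod_cast hd
  have hdh : d * (u - t k) ≤ 3 / 2 * (1 - rexp (-2 * (T - t (k + 1)))) := by
    have h1 := min_one_sq_le hs₀
    have h2 : 0 ≤ min 1 ((T - t (k + 1)) ^ 2) := by positivity
    have h3 : d * κ ≤ 1 := by nlinarith
    calc d * (u - t k) ≤ d * (κ * min 1 ((T - t (k + 1)) ^ 2)) := by
          gcongr; exact hhΔ.trans (hstep k hk)
      _ = d * κ * min 1 ((T - t (k + 1)) ^ 2) := by ring
      _ ≤ 1 * min 1 ((T - t (k + 1)) ^ 2) := by gcongr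
      _ ≤ _ := by linarith
  have hTk : T - t k = T - u + (u - t k) := by ring
  have e1 := pd_pd_log_density hD hs (hρ _ hs) (hpos _ hs) (hsmooth _ hs).continuous
  have e2 := pd_pd_log_density hD hs' (hρ _ hs') (hpos _ hs') (hsmooth _ hs').continuous
  simp only [e1, e2, mul_sub (rexp (2 * _)), ← mul_assoc]
  rw [hTk]
  refine (integral_hessian_increment_le hd hD hs hh _ _ _ _).trans
    ((hessian_increment_coefficient_le hd hD hs hh hv hvs hdh).trans ?_)
  have := hessianConst_pos
  gcongr

end
end

section
/- Assume q_0 is supported in the Euclidean ball {y ∈ ℝ^d : ‖y‖₂ ≤ √d}. Then there is a universal constant C > 0 such that for every t ∈ (0, ∞), E_{X ~ q_t}[ ‖∂_t ∇_x log q_t(X)‖₂² ] ≤ C ( d³ λ_t⁴ σ_t^{−6} + d λ_t² σ_t^{−4} ). -/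
open MeasureTheory ProbabilityTheory Real

noncomputable section

/-! ### The standard Gaussian measure -/

lemma pi_gaussianReal_eq_withDensity (d : ℕ) :
    (Measure.pi fun _ : Fin d => gaussianReal 0 1) =
      volume.withDensity fun x : Fin d → ℝ =>
        ENNReal.ofReal (∏ i, gaussianPDFReal 0 1 (x i)) := by
  refine (Measure.pi_eq fun s hs => ?_)
  rw [withDensity_apply _ (MeasurableSet.univ_pi hs), volume_pi, Measure.restrict_pi_pi,
    ← ofReal_integral_eq_lintegral_ofReal, integral_fintype_prod_eq_prod,
    ENNReal.ofReal_prod_of_nonneg]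
  · refine Finset.prod_congr rfl fun i _ => ?_
    rw [gaussianReal_apply_eq_integral 0 one_ne_zero]
  · exact fun i _ => integral_nonneg fun x => gaussianPDFReal_nonneg 0 1 x
  · exact Integrable.fintype_prod fun i => (integrable_gaussianPDFReal 0 1).restrict
  · exact ae_of_all _ fun x => Finset.prod_nonneg fun i _ => gaussianPDFReal_nonneg 0 1 _

lemma stdGaussian_eq_withDensity (d : ℕ) :
    stdGaussian d = volume.withDensity fun x : Vec d =>
      ENNReal.ofReal ((√(2 * π))⁻¹ ^ d * exp (-‖x‖ ^ 2 / 2)) := by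
  have hmp := PiLp.volume_preserving_toLp (Fin d)
  have hemb := (MeasurableEquiv.toLp 2 (Fin d → ℝ)).measurableEmbedding
  have hmap : stdGaussian d = Measure.map (@WithLp.toLp 2 (Fin d → ℝ))
      (Measure.pi fun _ : Fin d => gaussianReal 0 1) := rfl
  rw [hmap, pi_gaussianReal_eq_withDensity]
  ext s hs
  rw [Measure.map_apply hmp.measurable hs, withDensity_apply _ (hmp.measurable hs),
    withDensity_apply _ hs, ← hmp.setLIntegral_comp_preimage_emb hemb]
  refine lintegral_congr fun x => ?_
  congr 1
  simp only [gaussianPDFReal, Finset.prod_mul_distrib, ← Real.exp_sum, EuclideanSpace.norm_sq_eq]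
  simp [Finset.sum_div, neg_div]

lemma lintegral_affine_stdGaussian_s16 {d : ℕ} {σ : ℝ} (hσ : 0 < σ) (a : Vec d)
    {f : Vec d → ENNReal} (hf : Measurable f) :
    ∫⁻ g, f (a + σ • g) ∂(stdGaussian d) =
      ∫⁻ x, f x * ENNReal.ofReal
        ((σ ^ d)⁻¹ * (√(2 * π))⁻¹ ^ d * exp (-‖x - a‖ ^ 2 / (2 * σ ^ 2))) := by
  have hmap : Measure.map (fun g : Vec d => a + σ • g) volume =
      ENNReal.ofReal (σ ^ d)⁻¹ • volume := by
    have h : (fun g : Vec d => a + σ • g) = (fun y => a + y) ∘ (fun g => σ • g) := rfl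
    rw [h, ← Measure.map_map (by fun_prop) (by fun_prop), Measure.map_addHaar_smul _ hσ.ne',
      Measure.map_smul, map_add_left_eq_self, finrank_euclideanSpace_fin, abs_of_pos (by positivity)]
  set H : Vec d → ENNReal := fun x =>
    ENNReal.ofReal ((√(2 * π))⁻¹ ^ d * exp (-‖x - a‖ ^ 2 / (2 * σ ^ 2))) * f x with hH
  have hHm : Measurable H := by fun_prop
  calc ∫⁻ g, f (a + σ • g) ∂(stdGaussian d)
      = ∫⁻ g, H (a + σ • g) := by
        rw [stdGaussian_eq_withDensity, lintegral_withDensity_eq_lintegral_mul _ (by fun_prop)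
          (by fun_prop)]
        refine lintegral_congr fun g => ?_
        simp only [hH, Pi.mul_apply, add_sub_cancel_left, norm_smul, Real.norm_eq_abs,
          abs_of_pos hσ]
        congr 4
        field_simp
    _ = ∫⁻ x, H x ∂(Measure.map (fun g : Vec d => a + σ • g) volume) := by
        rw [lintegral_map hHm (by fun_prop)]
    _ = _ := by
        rw [hmap, lintegral_smul_measure, smul_eq_mul, ← lintegral_const_mul _ hHm]
        refine lintegral_congr fun x => ?_
        rw [mul_assoc (σ ^ d)⁻¹, ENNReal.ofReal_mul (p := (σ ^ d)⁻¹) (by positivity)]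
        simp only [hH]
        ring

instance (d : ℕ) : IsProbabilityMeasure (_root_.stdGaussian d) :=
  Measure.isProbabilityMeasure_map (by fun_prop)

lemma lintegral_norm_pow_six_stdGaussian_le (d : ℕ) :
    ∫⁻ g : Vec d, ENNReal.ofReal (‖g‖ ^ 6) ∂(stdGaussian d) ≤
      ENNReal.ofReal ((d : ℝ) ^ 3 * ∫ x, x ^ 6 ∂(gaussianReal 0 1)) := by
  have h_integrable : Integrable (fun x : ℝ => x ^ 6) (gaussianReal 0 1) := by
    have h := (memLp_id_gaussianReal (μ := 0) (v := 1) 6).integrable_norm_pow (by norm_num)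
    refine h.congr (ae_of_all _ fun x => ?_)
    simp [Even.pow_abs (show Even 6 by decide)]
  have hcoord (i : Fin d) : ∫⁻ g : Vec d, ENNReal.ofReal (g i ^ 6) ∂(stdGaussian d) =
      ENNReal.ofReal (∫ x, x ^ 6 ∂(gaussianReal 0 1)) := by
    have hm : Measurable fun x : ℝ => ENNReal.ofReal (x ^ 6) := by fun_prop
    rw [_root_.stdGaussian, lintegral_map (by fun_prop) (by fun_prop),
      ofReal_integral_eq_lintegral_ofReal h_integrable (ae_of_all _ fun x => by positivity)]
    exact (measurePreserving_eval (fun _ : Fin d => gaussianReal 0 1) i).lintegral_comp hm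
  calc ∫⁻ g : Vec d, ENNReal.ofReal (‖g‖ ^ 6) ∂(stdGaussian d)
      ≤ ∫⁻ g : Vec d, ENNReal.ofReal ((d : ℝ) ^ 2) * ∑ i, ENNReal.ofReal (g i ^ 6)
          ∂(stdGaussian d) := by
        refine lintegral_mono fun g => ?_
        dsimp only
        rw [← ENNReal.ofReal_sum_of_nonneg fun i _ => by positivity,
          ← ENNReal.ofReal_mul (by positivity)]
        refine ENNReal.ofReal_le_ofReal ?_
        have h := pow_sum_le_card_mul_sum_pow (s := Finset.univ) (f := fun i => g i ^ 2)
          (fun i _ => by positivity) 2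
        simp only [Finset.card_univ, Fintype.card_fin, ← pow_mul] at h
        rw [show ‖g‖ ^ 6 = (‖g‖ ^ 2) ^ 3 by ring, EuclideanSpace.real_norm_sq_eq]
        exact h
    _ = _ := by
        rw [lintegral_const_mul _ (by fun_prop), lintegral_finsetSum _ (by fun_prop)]
        simp only [hcoord, Finset.sum_const, Finset.card_univ, Fintype.card_fin, nsmul_eq_mul]
        rw [ENNReal.ofReal_mul (by positivity), ← mul_assoc, pow_succ (d : ℝ) 2,
          ENNReal.ofReal_mul (by positivity), ENNReal.ofReal_natCast]

/-! ### The law of the forward process -/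

lemma one_sub_exp_pos {t : ℝ} (ht : 0 < t) : 0 < 1 - exp (-2 * t) := by
  have : exp (-2 * t) < 1 := by simpa using ht
  linarith

lemma weight_pos {d : ℕ} (t : ℝ) (x θ : Vec d) : 0 < weight t x θ := Real.exp_pos _

lemma continuous_weight {d : ℕ} (t : ℝ) :
    Continuous fun p : Vec d × Vec d => weight t p.1 p.2 := by
  unfold weight
  fun_prop

lemma weight_le_one {d : ℕ} {t : ℝ} (ht : 0 < t) (x θ : Vec d) : weight t x θ ≤ 1 := by
  have := one_sub_exp_pos ht
  refine Real.exp_le_one_iff.2 (div_nonpos_of_nonpos_of_nonneg ?_ (by positivity))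
  exact neg_nonpos.2 (by positivity)

/-- Normalising constant of the Gaussian weight. -/
def gaussConst (d : ℕ) (t : ℝ) : ℝ :=
  (√(1 - exp (-2 * t)) ^ d)⁻¹ * (√(2 * π))⁻¹ ^ d

lemma gaussConst_pos (d : ℕ) {t : ℝ} (ht : 0 < t) : 0 < gaussConst d t := by
  have := Real.sqrt_pos.2 (one_sub_exp_pos ht)
  unfold gaussConst
  positivity

/-- The unnormalised density `x ↦ ∫ exp(-‖x - λ_t θ‖² / (2σ_t²)) dq0(θ)` of `q_t`. -/
def partitionFn {d : ℕ} (q0 : Measure (Vec d)) (t : ℝ) (x : Vec d) : ℝ :=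
  ∫ θ, weight t x θ ∂q0

lemma integrable_of_continuous {d : ℕ} (q0 : Measure (Vec d)) [IsFiniteMeasure q0] {R : ℝ}
    (hR : ∀ᵐ y ∂q0, ‖y‖ ≤ R)
    {f : Vec d → ℝ} (hf : Continuous f) : Integrable f q0 := by
  obtain ⟨C, hC⟩ := (isCompact_closedBall (0 : Vec d) R).exists_bound_of_continuousOn
    hf.continuousOn
  refine Integrable.of_bound (C := C) hf.aestronglyMeasurable ?_
  filter_upwards [hR] with y hy
  exact hC y (by simpa using hy)

section Forward

variable {d : ℕ} (q0 : Measure (Vec d)) [IsProbabilityMeasure q0]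

lemma lintegral_forward {t : ℝ} (ht : 0 < t) {F : Vec d → Vec d → ENNReal}
    (hF : Measurable (Function.uncurry F)) :
    ∫⁻ p, F p.1 (exp (-t) • p.1 + √(1 - exp (-2 * t)) • p.2) ∂(q0.prod (stdGaussian d)) =
      ∫⁻ x, ∫⁻ θ, F θ x * ENNReal.ofReal (gaussConst d t * weight t x θ) ∂q0 := by
  have hs := one_sub_exp_pos ht
  have hw := (continuous_weight (d := d) t).measurable
  have hm : Measurable fun p : Vec d × Vec d =>
      F p.1 p.2 * ENNReal.ofReal (gaussConst d t * weight t p.2 p.1) :=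
    hF.mul (((hw.comp measurable_swap).const_mul _).ennreal_ofReal)
  have hcomp : Measurable fun p : Vec d × Vec d =>
      F p.1 (exp (-t) • p.1 + √(1 - exp (-2 * t)) • p.2) :=
    hF.comp (f := fun p : Vec d × Vec d =>
      (p.1, exp (-t) • p.1 + √(1 - exp (-2 * t)) • p.2)) (by fun_prop)
  rw [lintegral_prod _ hcomp.aemeasurable,
    lintegral_lintegral_swap (f := fun x θ =>
      F θ x * ENNReal.ofReal (gaussConst d t * weight t x θ))
      (hm.comp measurable_swap).aemeasurable]
  refine lintegral_congr fun θ => ?_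
  rw [lintegral_affine_stdGaussian_s16 (Real.sqrt_pos.2 hs) (exp (-t) • θ) (f := F θ)
    (hF.comp measurable_prodMk_left)]
  refine lintegral_congr fun x => ?_
  rw [weight, gaussConst, Real.sq_sqrt hs.le]

lemma integrable_weight {t : ℝ} (ht : 0 < t) (x : Vec d) : Integrable (weight t x) q0 := by
  refine Integrable.of_bound (C := 1)
    ((continuous_weight t).comp (Continuous.prodMk_right x)).aestronglyMeasurable
    (ae_of_all _ fun θ => ?_)
  rw [Real.norm_of_nonneg (weight_pos t x θ).le]
  exact weight_le_one ht x θ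

lemma partitionFn_pos {t : ℝ} (ht : 0 < t) (x : Vec d) : 0 < partitionFn q0 t x := by
  refine (integral_pos_iff_support_of_nonneg (fun θ => (weight_pos t x θ).le)
    (integrable_weight q0 ht x)).2 ?_
  rw [show Function.support (weight t x) = Set.univ from
    Set.eq_univ_of_forall fun θ => (weight_pos t x θ).ne', measure_univ]
  exact one_pos

lemma continuous_partitionFn {t : ℝ} (ht : 0 < t) : Continuous (partitionFn q0 t) := by
  have hw (θ : Vec d) : Continuous fun x => weight t x θ := by unfold weight; fun_prop
  refine continuous_of_dominated (F := weight t) (bound := fun _ => 1)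
    (fun x => (integrable_weight q0 ht x).aestronglyMeasurable)
    (fun x => ae_of_all _ fun θ => ?_) (integrable_const _) (ae_of_all _ hw)
  rw [Real.norm_of_nonneg (weight_pos t x θ).le]
  exact weight_le_one ht x θ

lemma forwardLaw_eq_withDensity {t : ℝ} (ht : 0 < t) :
    forwardLaw q0 t =
      volume.withDensity fun x => ENNReal.ofReal (gaussConst d t * partitionFn q0 t x) := by
  have hc := gaussConst_pos d ht
  ext s hs
  rw [withDensity_apply _ hs, ← lintegral_indicator_one hs, forwardLaw,
    lintegral_map (measurable_one.indicator hs) (by fun_prop),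
    lintegral_forward q0 ht (F := fun _ x => s.indicator 1 x)
      ((measurable_one.indicator hs).comp measurable_snd), ← lintegral_indicator hs]
  refine lintegral_congr fun x => ?_
  by_cases hx : x ∈ s
  · simp only [hx, Set.indicator_of_mem, Pi.one_apply, one_mul]
    rw [← ofReal_integral_eq_lintegral_ofReal ((integrable_weight q0 ht x).const_mul _)
      (ae_of_all _ fun θ => mul_nonneg hc.le (weight_pos t x θ).le), integral_const_mul,
      partitionFn]
  · simp [hx]

lemma density_eq {t : ℝ} (ht : 0 < t) {ρ : Vec d → ℝ} (hρ : Continuous ρ) (hpos : ∀ x, 0 < ρ x)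
    (h : forwardLaw q0 t = volume.withDensity fun x => ENNReal.ofReal (ρ x)) (x : Vec d) :
    ρ x = gaussConst d t * partitionFn q0 t x := by
  have hZ := continuous_partitionFn q0 ht
  have hc := gaussConst_pos d ht
  rw [forwardLaw_eq_withDensity q0 ht, withDensity_eq_iff_of_sigmaFinite (by fun_prop)
    (by fun_prop)] at h
  refine congrFun (Continuous.ae_eq_iff_eq volume hρ (hZ.const_mul _) |>.1 ?_) x
  filter_upwards [h] with y hy
  exact ((ENNReal.ofReal_eq_ofReal_iff
    (mul_nonneg hc.le (partitionFn_pos q0 ht y).le) (hpos y).le).1 hy).symm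

/-- The posterior sixth moment of the noise `x - λ_t θ`. -/
def noiseSixth (q0 : Measure (Vec d)) (t : ℝ) (x : Vec d) : ℝ :=
  (∫ θ, ‖x - exp (-t) • θ‖ ^ 6 * weight t x θ ∂q0) / partitionFn q0 t x

lemma noiseSixth_nonneg {t : ℝ} (ht : 0 < t) (x : Vec d) : 0 ≤ noiseSixth q0 t x :=
  div_nonneg (integral_nonneg fun θ => mul_nonneg (by positivity) (weight_pos t x θ).le)
    (partitionFn_pos q0 ht x).le

lemma measurable_noiseSixth {t : ℝ} (ht : 0 < t) : Measurable (noiseSixth q0 t) := by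
  refine Measurable.div (StronglyMeasurable.measurable ?_) (continuous_partitionFn q0 ht).measurable
  refine StronglyMeasurable.integral_prod_right (Continuous.stronglyMeasurable ?_)
  exact Continuous.mul (by fun_prop) (continuous_weight t)

lemma lintegral_noiseSixth {R t : ℝ} (hR : ∀ᵐ y ∂q0, ‖y‖ ≤ R) (ht : 0 < t) :
    ∫⁻ x, ENNReal.ofReal (noiseSixth q0 t x) ∂(forwardLaw q0 t) ≤
      ENNReal.ofReal ((1 - exp (-2 * t)) ^ 3 *
        ((d : ℝ) ^ 3 * ∫ x, x ^ 6 ∂(gaussianReal 0 1))) := by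
  have hs := one_sub_exp_pos ht
  have hc := gaussConst_pos d ht
  have hZ := continuous_partitionFn q0 ht
  have hnum (x : Vec d) : ENNReal.ofReal (gaussConst d t * partitionFn q0 t x) *
      ENNReal.ofReal (noiseSixth q0 t x) = ∫⁻ θ, ENNReal.ofReal (‖x - exp (-t) • θ‖ ^ 6) *
        ENNReal.ofReal (gaussConst d t * weight t x θ) ∂q0 := by
    have hZx := partitionFn_pos q0 ht x
    rw [← ENNReal.ofReal_mul (by positivity), noiseSixth, mul_assoc, mul_div_cancel₀ _ hZx.ne',
      ← integral_const_mul, ofReal_integral_eq_lintegral_ofReal]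
    · refine lintegral_congr fun θ => ?_
      rw [← ENNReal.ofReal_mul (by positivity)]
      congr 1
      ring
    · refine integrable_of_continuous q0 hR ?_
      unfold weight
      fun_prop
    · exact ae_of_all _ fun θ =>
        mul_nonneg hc.le (mul_nonneg (by positivity) (weight_pos t x θ).le)
  rw [forwardLaw_eq_withDensity q0 ht, lintegral_withDensity_eq_lintegral_mul _ (by fun_prop)
    (measurable_noiseSixth q0 ht).ennreal_ofReal]
  simp only [Pi.mul_apply, hnum]
  rw [← lintegral_forward q0 ht
    (F := fun θ x => ENNReal.ofReal (‖x - exp (-t) • θ‖ ^ 6)) (by fun_prop)]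
  have hr (p : Vec d × Vec d) : ENNReal.ofReal
      (‖exp (-t) • p.1 + √(1 - exp (-2 * t)) • p.2 - exp (-t) • p.1‖ ^ 6) =
      ENNReal.ofReal ((1 - exp (-2 * t)) ^ 3) * ENNReal.ofReal (‖p.2‖ ^ 6) := by
    rw [add_sub_cancel_left, norm_smul, mul_pow, ENNReal.ofReal_mul (by positivity),
      Real.norm_of_nonneg (Real.sqrt_nonneg _), show √(1 - exp (-2 * t)) ^ 6 =
        (√(1 - exp (-2 * t)) ^ 2) ^ 3 by ring, Real.sq_sqrt hs.le]
  simp only [hr]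
  rw [lintegral_const_mul _ (by fun_prop), ENNReal.ofReal_mul (by positivity),
    lintegral_prod _ (by fun_prop)]
  simp only [lintegral_const, measure_univ, mul_one]
  gcongr
  exact lintegral_norm_pow_six_stdGaussian_le d

end Forward

/-! ### Moment bounds under a probability measure with bounded support -/

section Moments

variable {d : ℕ} (μ : Measure (Vec d)) [IsProbabilityMeasure μ] {R : ℝ}

lemma sum_sq_integral_le (hR : ∀ᵐ y ∂μ, ‖y‖ ≤ R) {V : Vec d → Vec d} (hV : Continuous V) :
    ∑ i, (∫ θ, V θ i ∂μ) ^ 2 ≤ ∫ θ, ‖V θ‖ ^ 2 ∂μ := by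
  simp only [EuclideanSpace.real_norm_sq_eq]
  rw [integral_finsetSum _ fun i _ => integrable_of_continuous μ hR (by fun_prop)]
  refine Finset.sum_le_sum fun i _ => ?_
  exact (even_two.convexOn_pow (𝕜 := ℝ)).map_integral_le (f := fun θ => V θ i)
    (by fun_prop) isClosed_univ (by simp) (integrable_of_continuous μ hR (by fun_prop))
    (integrable_of_continuous μ hR (by fun_prop))

lemma sq_integral_le_s16 (hR : ∀ᵐ y ∂μ, ‖y‖ ≤ R) {f : Vec d → ℝ} (hf : Continuous f) :
    (∫ θ, f θ ∂μ) ^ 2 ≤ ∫ θ, f θ ^ 2 ∂μ :=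
  (even_two.convexOn_pow (𝕜 := ℝ)).map_integral_le (f := f)
    (by fun_prop) isClosed_univ (by simp) (integrable_of_continuous μ hR (by fun_prop))
    (integrable_of_continuous μ hR (by fun_prop))

lemma cube_integral_norm_sq_le (hR : ∀ᵐ y ∂μ, ‖y‖ ≤ R) {V : Vec d → Vec d} (hV : Continuous V) :
    (∫ θ, ‖V θ‖ ^ 2 ∂μ) ^ 3 ≤ ∫ θ, ‖V θ‖ ^ 6 ∂μ := by
  have h := (convexOn_pow (𝕜 := ℝ) 3).map_integral_le (μ := μ) (f := fun θ => ‖V θ‖ ^ 2)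
    (by fun_prop) isClosed_Ici (ae_of_all _ fun θ => by simp)
    (integrable_of_continuous μ hR (by fun_prop))
    (integrable_of_continuous μ hR (by fun_prop))
  simpa only [← pow_mul] using h

/-- Derivative in time of `log (weight t x θ)`, in terms of `l = λ_t` and `s = σ_t²`. -/
def logWeightDeriv (l s : ℝ) (x θ : Vec d) : ℝ :=
  -(l * inner ℝ (x - l • θ) θ) / s + ‖x - l • θ‖ ^ 2 * l ^ 2 / s ^ 2

/-- The `i`-th coordinate of the time derivative of the score, as a posterior expectation
plus a posterior covariance. -/
def scoreDeriv (μ : Measure (Vec d)) (l s : ℝ) (x : Vec d) (i : Fin d) : ℝ :=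
  ∫ θ, (-(l * θ i) / s + 2 * l ^ 2 * (x - l • θ) i / s ^ 2
      + -(x - l • θ) i / s * logWeightDeriv l s x θ) ∂μ
    - (∫ θ, -(x - l • θ) i / s ∂μ) * ∫ θ, logWeightDeriv l s x θ ∂μ

lemma scoreDeriv_eq (hR : ∀ᵐ y ∂μ, ‖y‖ ≤ R) (l : ℝ) {s : ℝ} (hs : 0 < s) (x : Vec d) (i : Fin d) :
    scoreDeriv μ l s x i =
      -(l / s) * ∫ θ, θ i ∂μ + 2 * (l ^ 2 / s ^ 2) * ∫ θ, (x - l • θ) i ∂μ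
      - l ^ 2 / s ^ 2 * (∫ θ, (inner ℝ (x - l • θ) θ • θ) i ∂μ)
      + l ^ 2 / s ^ 2 * ((∫ θ, θ i ∂μ) * ∫ θ, inner ℝ (x - l • θ) θ ∂μ)
      - l ^ 2 / s ^ 3 * (∫ θ, (‖x - l • θ‖ ^ 2 • (x - l • θ)) i ∂μ)
      + l ^ 2 / s ^ 3 * ((∫ θ, (x - l • θ) i ∂μ) * ∫ θ, ‖x - l • θ‖ ^ 2 ∂μ) := by
  have h_integrable {f : Vec d → ℝ} (hf : Continuous f) : Integrable f μ :=
    integrable_of_continuous μ hR hf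
  have hr : ∫ θ, (x - l • θ) i ∂μ = x i - l * ∫ θ, θ i ∂μ := by
    simp only [PiLp.sub_apply, PiLp.smul_apply, smul_eq_mul]
    rw [integral_sub (integrable_const _) (h_integrable (by fun_prop)), integral_const_mul]
    simp
  have hH : ∫ θ, logWeightDeriv l s x θ ∂μ = -(l / s) * ∫ θ, inner ℝ (x - l • θ) θ ∂μ
      + l ^ 2 / s ^ 2 * ∫ θ, ‖x - l • θ‖ ^ 2 ∂μ := by
    rw [← integral_const_mul, ← integral_const_mul, ← integral_add (h_integrable (by fun_prop))
      (h_integrable (by fun_prop))]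
    refine integral_congr_ae (ae_of_all _ fun θ => ?_)
    simp only [logWeightDeriv]
    ring
  have hrs : ∫ θ, -(x - l • θ) i / s ∂μ = -(1 / s) * ∫ θ, (x - l • θ) i ∂μ := by
    rw [← integral_const_mul]
    refine integral_congr_ae (ae_of_all _ fun θ => ?_)
    dsimp only
    ring
  have hmain : ∫ θ, (-(l * θ i) / s + 2 * l ^ 2 * (x - l • θ) i / s ^ 2
      + -(x - l • θ) i / s * logWeightDeriv l s x θ) ∂μ =
      -(l / s) * ∫ θ, θ i ∂μ + 2 * (l ^ 2 / s ^ 2) * ∫ θ, (x - l • θ) i ∂μ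
      + l / s ^ 2 * x i * (∫ θ, inner ℝ (x - l • θ) θ ∂μ)
      + -(l ^ 2 / s ^ 2) * (∫ θ, (inner ℝ (x - l • θ) θ • θ) i ∂μ)
      + -(l ^ 2 / s ^ 3) * (∫ θ, (‖x - l • θ‖ ^ 2 • (x - l • θ)) i ∂μ) := by
    simp only [← integral_const_mul]
    rw [← integral_add (h_integrable (by fun_prop)) (h_integrable (by fun_prop)),
      ← integral_add (h_integrable (by fun_prop)) (h_integrable (by fun_prop)),
      ← integral_add (h_integrable (by fun_prop)) (h_integrable (by fun_prop)),
      ← integral_add (h_integrable (by fun_prop)) (h_integrable (by fun_prop))]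
    refine integral_congr_ae (ae_of_all _ fun θ => ?_)
    simp only [logWeightDeriv, PiLp.sub_apply, PiLp.smul_apply, smul_eq_mul]
    field_simp
    ring
  rw [scoreDeriv, hmain, hH, hrs, hr]
  field_simp
  ring

lemma sum_sq_scoreDeriv_le (hd : 1 ≤ d) (hR : ∀ᵐ y ∂μ, ‖y‖ ≤ √d) (l : ℝ) {s : ℝ} (hs : 0 < s)
    (x : Vec d) :
    ∑ i, scoreDeriv μ l s x i ^ 2 ≤
      6 * (l ^ 2 / s ^ 2 * d + 6 * (l ^ 4 / s ^ 3) * (d : ℝ) ^ 3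
        + 8 * (l ^ 4 / s ^ 6) * ∫ θ, ‖x - l • θ‖ ^ 6 ∂μ) := by
  have h_integrable {f : Vec d → ℝ} (hf : Continuous f) : Integrable f μ :=
    integrable_of_continuous μ hR hf
  have hd' : (1 : ℝ) ≤ d := by exact_mod_cast hd
  have hsq : ∀ᵐ y ∂μ, ‖y‖ ^ 2 ≤ d := by
    filter_upwards [hR] with y hy
    calc ‖y‖ ^ 2 ≤ √(d : ℝ) ^ 2 := by gcongr
      _ = (d : ℝ) := Real.sq_sqrt (by positivity)
  have hinner : ∀ᵐ y ∂μ, inner ℝ (x - l • y) y ^ 2 ≤ d * ‖x - l • y‖ ^ 2 := by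
    filter_upwards [hsq] with y hy
    have h1 := abs_real_inner_le_norm (x - l • y) y
    calc inner ℝ (x - l • y) y ^ 2 = |inner ℝ (x - l • y) y| ^ 2 := (sq_abs _).symm
      _ ≤ (‖x - l • y‖ * ‖y‖) ^ 2 := by gcongr
      _ = ‖y‖ ^ 2 * ‖x - l • y‖ ^ 2 := by ring
      _ ≤ d * ‖x - l • y‖ ^ 2 := by gcongr
  set M2 := ∫ θ, ‖x - l • θ‖ ^ 2 ∂μ with hM2
  set M6 := ∫ θ, ‖x - l • θ‖ ^ 6 ∂μ
  have hM2_nonneg : 0 ≤ M2 := integral_nonneg fun θ => by positivity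
  have hcube : M2 ^ 3 ≤ M6 := cube_integral_norm_sq_le μ hR (by fun_prop)
  have hmean : ∑ i, (∫ θ, θ i ∂μ) ^ 2 ≤ d := by
    refine (sum_sq_integral_le μ hR continuous_id).trans ?_
    simpa using integral_mono_ae (h_integrable (by fun_prop)) (integrable_const (d : ℝ)) hsq
  have hnoise : ∑ i, (∫ θ, (x - l • θ) i ∂μ) ^ 2 ≤ M2 :=
    sum_sq_integral_le μ hR (V := fun θ => x - l • θ) (by fun_prop)
  have hmean_inner : ∑ i, (∫ θ, (inner ℝ (x - l • θ) θ • θ) i ∂μ) ^ 2 ≤ (d : ℝ) ^ 2 * M2 := by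
    refine (sum_sq_integral_le μ hR (V := fun θ => inner ℝ (x - l • θ) θ • θ)
      (by fun_prop)).trans ?_
    rw [hM2, ← integral_const_mul]
    refine integral_mono_ae (h_integrable (by fun_prop)) (h_integrable (by fun_prop)) ?_
    filter_upwards [hsq, hinner] with y hy hy'
    rw [norm_smul, mul_pow, Real.norm_eq_abs, sq_abs]
    calc inner ℝ (x - l • y) y ^ 2 * ‖y‖ ^ 2 ≤ (d * ‖x - l • y‖ ^ 2) * d := by gcongr
      _ = (d : ℝ) ^ 2 * ‖x - l • y‖ ^ 2 := by ring
  have hinner_sq : (∫ θ, inner ℝ (x - l • θ) θ ∂μ) ^ 2 ≤ d * M2 := by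
    refine (sq_integral_le_s16 μ hR (by fun_prop)).trans ?_
    rw [hM2, ← integral_const_mul]
    exact integral_mono_ae (h_integrable (by fun_prop)) (h_integrable (by fun_prop)) hinner
  have hnoise_cube : ∑ i, (∫ θ, (‖x - l • θ‖ ^ 2 • (x - l • θ)) i ∂μ) ^ 2 ≤ M6 := by
    refine (sum_sq_integral_le μ hR (V := fun θ => ‖x - l • θ‖ ^ 2 • (x - l • θ))
      (by fun_prop)).trans (le_of_eq (integral_congr_ae (ae_of_all _ fun θ => ?_)))
    simp only [norm_smul, norm_pow, norm_norm]
    ring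
  have hmix : (d : ℝ) ^ 2 * M2 ≤ s * (d : ℝ) ^ 3 + M6 / s ^ 2 := by
    have hM6_nonneg : 0 ≤ M6 := integral_nonneg fun θ => by positivity
    rcases le_total M2 (s * d) with h | h
    · have : (d : ℝ) ^ 2 * M2 ≤ (d : ℝ) ^ 2 * (s * d) := by gcongr
      have : 0 ≤ M6 / s ^ 2 := by positivity
      linarith
    · have h1 : (s * d) ^ 2 * M2 ≤ M2 ^ 2 * M2 := by gcongr
      have h2 : (d : ℝ) ^ 2 * M2 ≤ M6 / s ^ 2 := by
        rw [le_div_iff₀ (by positivity)]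
        linarith
      have : 0 ≤ s * (d : ℝ) ^ 3 := by positivity
      linarith
  have hsix (a b c e f g : ℝ) : (a + b - c + e - f + g) ^ 2 ≤
      6 * (a ^ 2 + b ^ 2 + c ^ 2 + e ^ 2 + f ^ 2 + g ^ 2) := by
    have h := sq_sum_le_card_mul_sum_sq (s := Finset.univ) (f := ![a, b, -c, e, -f, g])
    simp [Fin.sum_univ_succ] at h
    linarith
  calc ∑ i, scoreDeriv μ l s x i ^ 2
      ≤ ∑ i, 6 * (l ^ 2 / s ^ 2 * (∫ θ, θ i ∂μ) ^ 2
          + 4 * (l ^ 4 / s ^ 4) * (∫ θ, (x - l • θ) i ∂μ) ^ 2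
          + l ^ 4 / s ^ 4 * (∫ θ, (inner ℝ (x - l • θ) θ • θ) i ∂μ) ^ 2
          + l ^ 4 / s ^ 4 * ((∫ θ, inner ℝ (x - l • θ) θ ∂μ) ^ 2 * (∫ θ, θ i ∂μ) ^ 2)
          + l ^ 4 / s ^ 6 * (∫ θ, (‖x - l • θ‖ ^ 2 • (x - l • θ)) i ∂μ) ^ 2
          + l ^ 4 / s ^ 6 * (M2 ^ 2 * (∫ θ, (x - l • θ) i ∂μ) ^ 2)) := by
        refine Finset.sum_le_sum fun i _ => ?_
        rw [scoreDeriv_eq μ hR l hs x i]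
        refine (hsix _ _ _ _ _ _).trans (le_of_eq ?_)
        ring
    _ = 6 * (l ^ 2 / s ^ 2 * ∑ i, (∫ θ, θ i ∂μ) ^ 2
          + 4 * (l ^ 4 / s ^ 4) * ∑ i, (∫ θ, (x - l • θ) i ∂μ) ^ 2
          + l ^ 4 / s ^ 4 * ∑ i, (∫ θ, (inner ℝ (x - l • θ) θ • θ) i ∂μ) ^ 2
          + l ^ 4 / s ^ 4 * ((∫ θ, inner ℝ (x - l • θ) θ ∂μ) ^ 2 * ∑ i, (∫ θ, θ i ∂μ) ^ 2)
          + l ^ 4 / s ^ 6 * ∑ i, (∫ θ, (‖x - l • θ‖ ^ 2 • (x - l • θ)) i ∂μ) ^ 2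
          + l ^ 4 / s ^ 6 * (M2 ^ 2 * ∑ i, (∫ θ, (x - l • θ) i ∂μ) ^ 2)) := by
        simp only [Finset.mul_sum, Finset.sum_add_distrib, mul_add]
    _ ≤ 6 * (l ^ 2 / s ^ 2 * d + 4 * (l ^ 4 / s ^ 4) * ((d : ℝ) ^ 2 * M2)
          + l ^ 4 / s ^ 4 * ((d : ℝ) ^ 2 * M2) + l ^ 4 / s ^ 4 * (d * M2 * d)
          + l ^ 4 / s ^ 6 * M6 + l ^ 4 / s ^ 6 * (M2 ^ 2 * M2)) := by
        gcongr
        exact hnoise.trans (le_mul_of_one_le_left hM2_nonneg (one_le_pow₀ hd'))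
    _ ≤ 6 * (l ^ 2 / s ^ 2 * d + 6 * (l ^ 4 / s ^ 4) * (s * (d : ℝ) ^ 3 + M6 / s ^ 2)
          + 2 * (l ^ 4 / s ^ 6) * M6) := by
        have h1 : l ^ 4 / s ^ 4 * ((d : ℝ) ^ 2 * M2) ≤
          l ^ 4 / s ^ 4 * (s * (d : ℝ) ^ 3 + M6 / s ^ 2) := by gcongr
        have h2 : l ^ 4 / s ^ 6 * M2 ^ 3 ≤ l ^ 4 / s ^ 6 * M6 := by gcongr
        linarith
    _ = _ := by
        field_simp
        ring

end Moments

/-! ### Differentiation of the score -/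

lemma hasDerivAt_integral_of_bounded_support {d : ℕ} (q0 : Measure (Vec d)) [IsFiniteMeasure q0]
    {R : ℝ} (hR : ∀ᵐ y ∂q0, ‖y‖ ≤ R) {f f' : ℝ → Vec d → ℝ} {a ε : ℝ} (hε : 0 < ε)
    (hf : ∀ b, Continuous (f b))
    (hf' : ContinuousOn (Function.uncurry f') (Metric.closedBall a ε ×ˢ Set.univ))
    (hderiv : ∀ b ∈ Metric.closedBall a ε, ∀ θ, HasDerivAt (fun c => f c θ) (f' b θ) b) :
    HasDerivAt (fun b => ∫ θ, f b θ ∂q0) (∫ θ, f' a θ ∂q0) a := by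
  obtain ⟨C, hC⟩ := ((isCompact_closedBall a ε).prod
    (isCompact_closedBall (0 : Vec d) R)).exists_bound_of_continuousOn
      (hf'.mono (Set.prod_mono_right (Set.subset_univ _)))
  have hcont : Continuous (f' a) := by
    rw [← continuousOn_univ]
    exact hf'.comp (f := fun θ => (a, θ)) (by fun_prop)
      fun θ _ => ⟨Metric.mem_closedBall_self hε.le, Set.mem_univ _⟩
  refine (hasDerivAt_integral_of_dominated_loc_of_deriv_le (bound := fun _ => C)
    (Metric.closedBall_mem_nhds a hε)
    (Filter.Eventually.of_forall fun b => (hf b).aestronglyMeasurable)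
    (integrable_of_continuous q0 hR (hf a)) hcont.aestronglyMeasurable ?_ (integrable_const C)
    (ae_of_all _ fun θ b hb => hderiv b hb θ)).2
  filter_upwards [hR] with θ hθ b hb
  exact hC (b, θ) ⟨hb, by simpa using hθ⟩

lemma hasDerivAt_exp_neg (u : ℝ) : HasDerivAt (fun v : ℝ => exp (-v)) (-exp (-u)) u := by
  simpa using (hasDerivAt_neg u).exp

lemma hasDerivAt_one_sub_exp (u : ℝ) :
    HasDerivAt (fun v : ℝ => 1 - exp (-2 * v)) (2 * exp (-u) ^ 2) u := by
  refine ((((hasDerivAt_id u).const_mul (-2)).exp).const_sub 1).congr_deriv ?_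
  rw [← Real.exp_nat_mul, show ((2 : ℕ) : ℝ) * -u = -2 * u by push_cast; ring, id]
  ring

lemma hasDerivAt_weight_time {d : ℕ} {u : ℝ} (hu : 0 < u) (x θ : Vec d) :
    HasDerivAt (fun v => weight v x θ)
      (logWeightDeriv (exp (-u)) (1 - exp (-2 * u)) x θ * weight u x θ) u := by
  have hs := one_sub_exp_pos hu
  have hr : HasDerivAt (fun v : ℝ => x - exp (-v) • θ) (exp (-u) • θ) u := by
    simpa using ((hasDerivAt_exp_neg u).smul_const θ).const_sub x
  have h := ((hr.norm_sq.neg).div ((hasDerivAt_one_sub_exp u).const_mul 2) (by positivity)).exp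
  refine h.congr_deriv ?_
  rw [mul_comm]
  change _ * weight u x θ = _
  congr 1
  rw [logWeightDeriv, inner_smul_right, Pi.neg_apply]
  field_simp
  ring

lemma hasDerivAt_weight_line {d : ℕ} {u : ℝ} (hu : 0 < u) (x θ : Vec d) (i : Fin d) (a : ℝ) :
    HasDerivAt (fun b : ℝ => weight u (x + b • EuclideanSpace.single i (1 : ℝ)) θ)
      (-(x + a • EuclideanSpace.single i (1 : ℝ) - exp (-u) • θ) i / (1 - exp (-2 * u)) *
        weight u (x + a • EuclideanSpace.single i (1 : ℝ)) θ) a := by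
  have hs := one_sub_exp_pos hu
  have hr : HasDerivAt (fun b : ℝ => x + b • EuclideanSpace.single i (1 : ℝ) - exp (-u) • θ)
      (EuclideanSpace.single i (1 : ℝ)) a := by
    simpa using (((hasDerivAt_id a).smul_const (EuclideanSpace.single i (1 : ℝ))).const_add
      x).sub_const (exp (-u) • θ)
  have h := ((hr.norm_sq.neg).div_const (2 * (1 - exp (-2 * u)))).exp
  refine h.congr_deriv ?_
  rw [mul_comm]
  change _ * weight u _ θ = _
  congr 1
  rw [EuclideanSpace.inner_single_right]
  simp only [one_mul, conj_trivial]
  field_simp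

lemma condMeasure_absolutelyContinuous {d : ℕ} (q0 : Measure (Vec d)) (t : ℝ) (x : Vec d) :
    condMeasure q0 t x ≪ q0 :=
  (withDensity_absolutelyContinuous _ _).smul_left _

section Score

variable {d : ℕ} (q0 : Measure (Vec d)) [IsProbabilityMeasure q0] {R : ℝ}

lemma integral_condMeasure {t : ℝ} (ht : 0 < t) (x : Vec d) (f : Vec d → ℝ) :
    ∫ θ, f θ ∂(condMeasure q0 t x) = (∫ θ, f θ * weight t x θ ∂q0) / partitionFn q0 t x := by
  have hw : Measurable (weight t x) := by unfold weight; fun_prop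
  rw [condMeasure, integral_smul_measure, integral_withDensity_eq_integral_toReal_smul
    (by fun_prop) (by simp), ← ofReal_integral_eq_lintegral_ofReal (integrable_weight q0 ht x)
    (ae_of_all _ fun θ => (weight_pos t x θ).le), ENNReal.toReal_inv,
    ENNReal.toReal_ofReal (integral_nonneg fun θ => (weight_pos t x θ).le), smul_eq_mul,
    mul_comm, ← div_eq_mul_inv, partitionFn]
  congr 1
  refine integral_congr_ae (ae_of_all _ fun θ => ?_)
  simp only [ENNReal.toReal_ofReal (weight_pos t x θ).le, smul_eq_mul, mul_comm]

lemma isProbabilityMeasure_condMeasure {t : ℝ} (ht : 0 < t) (x : Vec d) :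
    IsProbabilityMeasure (condMeasure q0 t x) := by
  have hZ := partitionFn_pos q0 ht x
  constructor
  rw [condMeasure, Measure.smul_apply, withDensity_apply _ MeasurableSet.univ,
    Measure.restrict_univ, smul_eq_mul, ← ofReal_integral_eq_lintegral_ofReal
    (integrable_weight q0 ht x) (ae_of_all _ fun θ => (weight_pos t x θ).le)]
  exact ENNReal.inv_mul_cancel (ENNReal.ofReal_pos.2 hZ).ne' ENNReal.ofReal_ne_top

lemma pd_log_density {u : ℝ} (hu : 0 < u) (hR : ∀ᵐ y ∂q0, ‖y‖ ≤ R) {ρ : Vec d → ℝ}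
    (hρ : Differentiable ℝ ρ) (hpos : ∀ x, 0 < ρ x)
    (h : forwardLaw q0 u = volume.withDensity fun x => ENNReal.ofReal (ρ x)) (x : Vec d)
    (i : Fin d) :
    pd i (fun y => Real.log (ρ y)) x =
      (∫ θ, -(x - exp (-u) • θ) i / (1 - exp (-2 * u)) * weight u x θ ∂q0) /
        partitionFn q0 u x := by
  have hdiff : DifferentiableAt ℝ (fun y => Real.log (ρ y)) x := (hρ x).log (hpos x).ne'
  have hZ := hasDerivAt_integral_of_bounded_support q0 hR (a := 0) one_pos
    (f := fun h θ => weight u (x + h • EuclideanSpace.single i (1 : ℝ)) θ)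
    (f' := fun h θ => -(x + h • EuclideanSpace.single i (1 : ℝ) - exp (-u) • θ) i /
      (1 - exp (-2 * u)) * weight u (x + h • EuclideanSpace.single i (1 : ℝ)) θ)
    (fun b => by unfold weight; fun_prop)
    (Continuous.continuousOn (by unfold Function.uncurry weight; fun_prop))
    (fun b _ θ => hasDerivAt_weight_line hu x θ i b)
  have hlog := (hZ.const_mul (gaussConst d u)).log (by
    simpa [partitionFn] using (mul_pos (gaussConst_pos d hu) (partitionFn_pos q0 hu x)).ne')
  rw [pd, ← hdiff.lineDeriv_eq_fderiv, lineDeriv]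
  simp only [density_eq q0 hu hρ.continuous hpos h]
  unfold partitionFn
  rw [hlog.deriv]
  simp only [zero_smul, add_zero]
  exact mul_div_mul_left _ _ (gaussConst_pos d hu).ne'

lemma hasDerivAt_score {t : ℝ} (ht : 0 < t) (hR : ∀ᵐ y ∂q0, ‖y‖ ≤ R) (x : Vec d) (i : Fin d) :
    HasDerivAt (fun u => (∫ θ, -(x - exp (-u) • θ) i / (1 - exp (-2 * u)) * weight u x θ ∂q0) /
        partitionFn q0 u x)
      (scoreDeriv (condMeasure q0 t x) (exp (-t)) (1 - exp (-2 * t)) x i) t := by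
  have hZ0 := partitionFn_pos q0 ht x
  have hball {b : ℝ} (hb : b ∈ Metric.closedBall t (t / 2)) : 0 < b := by
    rw [Real.closedBall_eq_Icc] at hb
    linarith [hb.1]
  have hw : ContinuousOn (fun p : ℝ × Vec d => weight p.1 x p.2)
      (Metric.closedBall t (t / 2) ×ˢ Set.univ) := by
    unfold weight
    refine Real.continuous_exp.comp_continuousOn (ContinuousOn.div (by fun_prop) (by fun_prop) ?_)
    intro p hp
    have := one_sub_exp_pos (hball hp.1)
    positivity
  have hH : ContinuousOn (fun p : ℝ × Vec d =>
      logWeightDeriv (exp (-p.1)) (1 - exp (-2 * p.1)) x p.2)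
      (Metric.closedBall t (t / 2) ×ˢ Set.univ) := by
    unfold logWeightDeriv
    refine ContinuousOn.add (ContinuousOn.div (by fun_prop) (by fun_prop) ?_)
      (ContinuousOn.div (by fun_prop) (by fun_prop) ?_) <;>
    · intro p hp
      have := one_sub_exp_pos (hball hp.1)
      positivity
  have hZ : HasDerivAt (fun u => partitionFn q0 u x)
      (∫ θ, logWeightDeriv (exp (-t)) (1 - exp (-2 * t)) x θ * weight t x θ ∂q0) t :=
    hasDerivAt_integral_of_bounded_support q0 hR (half_pos ht) (f := fun u θ => weight u x θ)
      (f' := fun u θ => logWeightDeriv (exp (-u)) (1 - exp (-2 * u)) x θ * weight u x θ)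
      (fun b => by unfold weight; fun_prop) (hH.mul hw)
      (fun b hb θ => hasDerivAt_weight_time (hball hb) x θ)
  have hN := hasDerivAt_integral_of_bounded_support q0 hR (half_pos ht)
      (f := fun u θ => -(x - exp (-u) • θ) i / (1 - exp (-2 * u)) * weight u x θ)
      (f' := fun u θ => (-(exp (-u) * θ i) / (1 - exp (-2 * u))
        + 2 * exp (-u) ^ 2 * (x - exp (-u) • θ) i / (1 - exp (-2 * u)) ^ 2
        + -(x - exp (-u) • θ) i / (1 - exp (-2 * u))
          * logWeightDeriv (exp (-u)) (1 - exp (-2 * u)) x θ) * weight u x θ)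
      (fun b => by unfold weight; fun_prop)
      (by
        refine ContinuousOn.mul (ContinuousOn.add (ContinuousOn.add
          (ContinuousOn.div (by fun_prop) (by fun_prop) ?_)
          (ContinuousOn.div (by fun_prop) (by fun_prop) ?_))
          (ContinuousOn.mul (ContinuousOn.div (by fun_prop) (by fun_prop) ?_) hH)) hw <;>
        · intro p hp
          have := one_sub_exp_pos (hball hp.1)
          positivity)
      (fun b hb θ => by
        have hs := one_sub_exp_pos (hball hb)
        have hr := (((hasDerivAt_exp_neg b).mul_const (θ i)).const_sub (x i)).neg
        have h := (hr.div (hasDerivAt_one_sub_exp b) hs.ne').mul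
          (hasDerivAt_weight_time (hball hb) x θ)
        refine h.congr_deriv ?_
        simp only [PiLp.sub_apply, PiLp.smul_apply, smul_eq_mul, Pi.neg_apply, Pi.div_apply]
        field_simp
        ring)
  refine (hN.div hZ hZ0.ne').congr_deriv ?_
  rw [scoreDeriv, integral_condMeasure q0 ht, integral_condMeasure q0 ht,
    integral_condMeasure q0 ht]
  have hquot (a b c z : ℝ) (hz : z ≠ 0) :
      (a * z - b * c) / z ^ 2 = a / z - b / z * (c / z) := by
    field_simp
  exact hquot _ _ _ _ hZ0.ne'

end Score

/-- **Lemma (refined second moment of the time derivative of the score).** Under the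
bounded-support assumption, `E_{X ~ q_t}[‖∂_t ∇_x log q_t(X)‖²] ≤ C (d³λ_t⁴σ_t⁻⁶ + dλ_t²σ_t⁻⁴)`
for a universal constant `C`. -/
theorem partial_t_score_second_moment_refined :
    ∃ C > (0:ℝ),
    ∀ (d : ℕ), 1 ≤ d →
    ∀ (q0 : Measure (Vec d)), IsProbabilityMeasure q0 →
    (∀ᵐ y ∂q0, ‖y‖ ≤ Real.sqrt d) →
    ∀ (ρ : ℝ → Vec d → ℝ),
    (∀ u, 0 < u → forwardLaw q0 u = volume.withDensity fun x => ENNReal.ofReal (ρ u x)) →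
    (∀ u, 0 < u → ∀ x, 0 < ρ u x) →
    (∀ u, 0 < u → ContDiff ℝ (⊤ : ℕ∞) (ρ u)) →
    -- the score is differentiable in time
    (∀ u, 0 < u → ∀ (x : Vec d) (i : Fin d),
      DifferentiableAt ℝ (fun v => pd i (fun y => Real.log (ρ v y)) x) u) →
    ∀ (t : ℝ), 0 < t →
    ∫ x, ∑ i, (deriv (fun u => pd i (fun y => Real.log (ρ u y)) x) t)^2
        ∂(forwardLaw q0 t)
      ≤ C * ((d:ℝ)^3 * Real.exp (-t)^4 / (1 - Real.exp (-2*t))^3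
          + d * Real.exp (-t)^2 / (1 - Real.exp (-2*t))^2) := by
  set K : ℝ := ∫ x, x ^ 6 ∂(gaussianReal 0 1)
  have hK_nonneg : 0 ≤ K := integral_nonneg fun x => by positivity
  refine ⟨6 * (6 + 8 * K), by positivity, ?_⟩
  intro d hd q0 hq0 hR ρ hlaw hpos hsmooth _ t ht
  have hs := one_sub_exp_pos ht
  set l := exp (-t)
  set s := 1 - exp (-2 * t)
  have hderiv (x : Vec d) (i : Fin d) :
      deriv (fun u => pd i (fun y => Real.log (ρ u y)) x) t =
        scoreDeriv (condMeasure q0 t x) l s x i := by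
    refine ((hasDerivAt_score q0 ht hR x i).congr_of_eventuallyEq ?_).deriv
    filter_upwards [lt_mem_nhds ht] with u hu
    exact pd_log_density q0 hu hR ((hsmooth u hu).differentiable (by simp)) (hpos u hu)
      (hlaw u hu) x i
  have hbound (x : Vec d) : ∑ i, scoreDeriv (condMeasure q0 t x) l s x i ^ 2 ≤
      6 * (l ^ 2 / s ^ 2 * d + 6 * (l ^ 4 / s ^ 3) * (d : ℝ) ^ 3
        + 8 * (l ^ 4 / s ^ 6) * noiseSixth q0 t x) := by
    have := isProbabilityMeasure_condMeasure q0 ht x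
    have h := sum_sq_scoreDeriv_le (condMeasure q0 t x) hd
      ((condMeasure_absolutelyContinuous q0 t x).ae_le hR) l hs x
    rwa [integral_condMeasure q0 ht] at h
  have hprob : IsProbabilityMeasure (forwardLaw q0 t) :=
    Measure.isProbabilityMeasure_map (by fun_prop)
  have hlint := lintegral_noiseSixth q0 hR ht
  have hnonneg : 0 ≤ᵐ[forwardLaw q0 t] noiseSixth q0 t :=
    ae_of_all _ (noiseSixth_nonneg q0 ht)
  have h_integrable : Integrable (noiseSixth q0 t) (forwardLaw q0 t) := by
    refine ⟨(measurable_noiseSixth q0 ht).aestronglyMeasurable, ?_⟩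
    rw [hasFiniteIntegral_iff_ofReal hnonneg]
    exact hlint.trans_lt ENNReal.ofReal_lt_top
  have hsixth : ∫ x, noiseSixth q0 t x ∂(forwardLaw q0 t) ≤ s ^ 3 * ((d : ℝ) ^ 3 * K) := by
    rw [integral_eq_lintegral_of_nonneg_ae hnonneg h_integrable.aestronglyMeasurable]
    exact ENNReal.toReal_le_of_le_ofReal (by positivity) hlint
  simp only [hderiv]
  calc ∫ x, ∑ i, scoreDeriv (condMeasure q0 t x) l s x i ^ 2 ∂(forwardLaw q0 t)
      ≤ ∫ x, 6 * (l ^ 2 / s ^ 2 * d + 6 * (l ^ 4 / s ^ 3) * (d : ℝ) ^ 3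
        + 8 * (l ^ 4 / s ^ 6) * noiseSixth q0 t x) ∂(forwardLaw q0 t) :=
        integral_mono_of_nonneg (ae_of_all _ fun x => Finset.sum_nonneg fun i _ => sq_nonneg _)
          (((integrable_const _).add (h_integrable.const_mul _)).const_mul _) (ae_of_all _ hbound)
    _ = 6 * (l ^ 2 / s ^ 2 * d + 6 * (l ^ 4 / s ^ 3) * (d : ℝ) ^ 3
        + 8 * (l ^ 4 / s ^ 6) * ∫ x, noiseSixth q0 t x ∂(forwardLaw q0 t)) := by
        rw [integral_const_mul, integral_add (integrable_const _) (h_integrable.const_mul _),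
          integral_const_mul]
        simp
    _ ≤ 6 * (l ^ 2 / s ^ 2 * d + 6 * (l ^ 4 / s ^ 3) * (d : ℝ) ^ 3
        + 8 * (l ^ 4 / s ^ 6) * (s ^ 3 * ((d : ℝ) ^ 3 * K))) := by gcongr
    _ = 6 * (d * l ^ 2 / s ^ 2 + (6 + 8 * K) * ((d : ℝ) ^ 3 * l ^ 4 / s ^ 3)) := by
        field_simp
        ring
    _ ≤ 6 * ((6 + 8 * K) * (d * l ^ 2 / s ^ 2)
        + (6 + 8 * K) * ((d : ℝ) ^ 3 * l ^ 4 / s ^ 3)) := by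
        gcongr
        exact le_mul_of_one_le_left (by positivity) (by linarith)
    _ = _ := by ring

end
end
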